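/- arXiv:1010.1073 — 2 statements merged into one kernel-verified Lean document; each statement's English description precedes it below -/
import Mathlib

section
/- As T → ∞, |∫_T^{2T} Z^3(t) dt| ≪ T (log T)^{5/2}. -/
open MeasureTheory

/-- The phase factor `e^{iθ(t)} = π^{-it/2} Γ(1/4+it/2)/|Γ(1/4+it/2)|`. -/
noncomputable def eTheta (t : ℝ) : ℂ :=
  (Real.pi : ℂ) ^ (-(Complex.I * (t : ℂ)) / 2) *
    (Complex.Gamma (1 / 4 + Complex.I * (t : ℂ) / 2) /
      ‖Complex.Gamma (1 / 4 + Complex.I * (t : ℂ) / 2)‖)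

/-- Hardy's function `Z(t) = e^{iθ(t)} ζ(1/2+it)` (a real number for real `t`). -/
noncomputable def HardyZ (t : ℝ) : ℝ :=
  (eTheta t * riemannZeta (1 / 2 + Complex.I * (t : ℂ))).re

section Plancherel

open FourierTransform SchwartzMap

/-- On `L¹ ∩ L²` the `L²` Fourier transform is given by the Fourier integral. -/
theorem fourier_toLp_ae_eq {f : ℝ → ℂ} (hf : Integrable f) (hf2 : MemLp f 2) :
    ((𝓕 (hf2.toLp f) : Lp ℂ 2 (volume : Measure ℝ)) : ℝ → ℂ) =ᵐ[volume] 𝓕 f := by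
  have hcont : Continuous (𝓕 f) := VectorFourier.fourierIntegral_continuous
    Real.continuous_fourierChar (by exact continuous_inner) hf
  apply ae_eq_of_integral_contDiff_smul_eq
  · exact (Lp.memLp _).locallyIntegrable (by norm_num)
  · exact hcont.locallyIntegrable
  intro g hg hgc
  let G : ℝ → ℂ := fun x => (g x : ℂ)
  have hG : ContDiff ℝ (⊤ : ℕ∞) G := Complex.ofRealCLM.contDiff.comp hg
  have hGc : HasCompactSupport G := hgc.comp_left (g := fun x : ℝ => (x : ℂ)) (by simp)
  let φ : 𝓢(ℝ, ℂ) := hGc.toSchwartzMap hG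
  have h1 := congrArg (fun T => T φ) (Lp.fourier_toTemperedDistribution_eq (hf2.toLp f))
  simp only [TemperedDistribution.fourier_apply, Lp.toTemperedDistribution_apply] at h1
  have e1 : ∫ x, g x • ((𝓕 (hf2.toLp f) : Lp ℂ 2 (volume : Measure ℝ)) : ℝ → ℂ) x
      = ∫ x, φ x • ((𝓕 (hf2.toLp f) : Lp ℂ 2 (volume : Measure ℝ)) : ℝ → ℂ) x := by
    rfl
  rw [e1, ← h1]
  have e2 : ∫ x, (𝓕 φ) x • (hf2.toLp f : ℝ → ℂ) x = ∫ x, (𝓕 φ) x • f x := by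
    apply integral_congr_ae
    filter_upwards [hf2.coeFn_toLp] with x hx
    rw [hx]
  rw [e2]
  have h2 := VectorFourier.integral_fourierIntegral_smul_eq_flip (L := innerₗ ℝ)
    Real.continuous_fourierChar (by exact continuous_inner) (φ.integrable (μ := volume)) hf
  have h3 : (innerₗ ℝ).flip = innerₗ ℝ := by
    ext; simp
  rw [h3] at h2
  exact h2

theorem memLp_fourier {f : ℝ → ℂ} (hf : Integrable f) (hf2 : MemLp f 2) :
    MemLp (𝓕 f) 2 :=
  (memLp_congr_ae (fourier_toLp_ae_eq hf hf2)).1 (Lp.memLp _)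

theorem integral_norm_sq_eq_toReal_sq {f : ℝ → ℂ} (hf : MemLp f 2) :
    ∫ x, ‖f x‖ ^ 2 = (eLpNorm f 2 volume).toReal ^ 2 := by
  rw [hf.eLpNorm_eq_integral_rpow_norm (by norm_num) (by norm_num), ENNReal.toReal_ofReal (by positivity)]
  simp only [ENNReal.toReal_ofNat, Real.rpow_ofNat]
  rw [← Real.rpow_natCast, ← Real.rpow_mul (integral_nonneg fun _ => by positivity)]
  norm_num

/-- Plancherel's theorem for functions in `L¹ ∩ L²`. -/
theorem integral_norm_sq_fourier_eq {f : ℝ → ℂ} (hf : Integrable f) (hf2 : MemLp f 2) :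
    ∫ ξ, ‖𝓕 f ξ‖ ^ 2 = ∫ x, ‖f x‖ ^ 2 := by
  rw [integral_norm_sq_eq_toReal_sq hf2, integral_norm_sq_eq_toReal_sq (memLp_fourier hf hf2),
    ← eLpNorm_congr_ae (fourier_toLp_ae_eq hf hf2), ← Lp.norm_def, Lp.norm_fourier_eq,
    Lp.norm_def, eLpNorm_congr_ae hf2.coeFn_toLp]

end Plancherel

section ExpSeries

open Filter Topology Asymptotics

/-- The exponential series `∑ aₙ e^{-nz}`. -/
noncomputable def expSeries (a : ℕ → ℂ) (z : ℂ) : ℂ := ∑' n : ℕ, a n * Complex.exp (-(n * z))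

variable {a : ℕ → ℂ}

theorem norm_expSeries_term_le (ha : ∀ n, ‖a n‖ ≤ n) (n : ℕ) (z : ℂ) :
    ‖a n * Complex.exp (-(n * z))‖ ≤ n * Real.exp (-(n * z.re)) := by
  rw [norm_mul, Complex.norm_exp]
  simpa using mul_le_mul_of_nonneg_right (ha n) (Real.exp_pos _).le

theorem nat_mul_exp_neg_le (n : ℕ) {y : ℝ} (hy : 0 < y) :
    n * Real.exp (-(n * y)) ≤ 6 / y ^ 3 * (1 / (n : ℝ) ^ 2) := by
  rcases Nat.eq_zero_or_pos n with rfl | hn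
  · simp
  have hn' : (0 : ℝ) < n := by exact_mod_cast hn
  have h := Real.pow_div_factorial_le_exp (n * y) (by positivity) 3
  rw [Real.exp_neg]
  have h6 : ((Nat.factorial 3 : ℕ) : ℝ) = 6 := by norm_num [Nat.factorial]
  rw [h6] at h
  have : (Real.exp (n * y))⁻¹ ≤ ((n * y) ^ 3 / 6)⁻¹ := inv_anti₀ (by positivity) h
  calc (n : ℝ) * (Real.exp (n * y))⁻¹ ≤ n * ((n * y) ^ 3 / 6)⁻¹ := by gcongr
    _ = _ := by field_simp

theorem summable_nat_mul_exp_neg {y : ℝ} (hy : 0 < y) :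
    Summable fun n : ℕ => n * Real.exp (-(n * y)) :=
  Summable.of_nonneg_of_le (fun _ => by positivity) (fun n => nat_mul_exp_neg_le n hy)
    ((Real.summable_one_div_nat_pow.2 (by norm_num)).mul_left _)

theorem summable_expSeries (ha : ∀ n, ‖a n‖ ≤ n) {z : ℂ} (hz : 0 < z.re) :
    Summable fun n : ℕ => a n * Complex.exp (-(n * z)) :=
  Summable.of_norm_bounded (summable_nat_mul_exp_neg hz) fun n => norm_expSeries_term_le ha n z

theorem norm_expSeries_le (ha : ∀ n, ‖a n‖ ≤ n) {z : ℂ} (hz : 0 < z.re) :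
    ‖expSeries a z‖ ≤ ∑' n : ℕ, n * Real.exp (-(n * z.re)) :=
  tsum_of_norm_bounded (summable_nat_mul_exp_neg hz).hasSum fun n => norm_expSeries_term_le ha n z

theorem continuousOn_expSeries (ha : ∀ n, ‖a n‖ ≤ n) {c : ℂ} (hc : 0 < c.re) :
    ContinuousOn (fun x : ℝ => expSeries a (x * c)) (Set.Ioi 0) := by
  intro x hx
  have hx : 0 < x := hx
  have h : ContinuousOn (fun x : ℝ => expSeries a (x * c)) (Set.Ioi (x / 2)) := by
    apply continuousOn_tsum (u := fun n : ℕ => n * Real.exp (-(n * (x / 2 * c.re))))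
    · intro n
      fun_prop
    · exact summable_nat_mul_exp_neg (by positivity)
    · intro n y hy
      have hy : x / 2 < y := hy
      refine (norm_expSeries_term_le ha n _).trans ?_
      have : ((y : ℂ) * c).re = y * c.re := by simp
      rw [this]
      gcongr
  exact (h.continuousAt (Ioi_mem_nhds (by linarith))).continuousWithinAt

theorem norm_expSeries_le_exp (ha : ∀ n, ‖a n‖ ≤ n) {z : ℂ} {r : ℝ} (hr : 0 < r) (hz : r ≤ z.re) :
    ‖expSeries a z‖ ≤ (∑' n : ℕ, n * Real.exp (-(n * (r / 2)))) * Real.exp (-(z.re / 2)) := by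
  refine (norm_expSeries_le ha (by linarith)).trans ?_
  rw [← tsum_mul_right]
  refine (summable_nat_mul_exp_neg (by linarith)).tsum_le_tsum ?_
    ((summable_nat_mul_exp_neg (by linarith)).mul_right _)
  intro n
  rcases Nat.eq_zero_or_pos n with rfl | hn
  · simp
  have hn' : (1 : ℝ) ≤ n := by exact_mod_cast hn
  rw [mul_assoc, ← Real.exp_add]
  gcongr
  nlinarith

theorem norm_expSeries_le_inv_pow (ha : ∀ n, ‖a n‖ ≤ n) {z : ℂ} (hz : 0 < z.re) :
    ‖expSeries a z‖ ≤ 6 / z.re ^ 3 * ∑' n : ℕ, 1 / (n : ℝ) ^ 2 := by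
  refine (norm_expSeries_le ha hz).trans ?_
  rw [← tsum_mul_left]
  exact (summable_nat_mul_exp_neg hz).tsum_le_tsum (fun n => nat_mul_exp_neg_le n hz)
    ((Real.summable_one_div_nat_pow.2 (by norm_num)).mul_left _)

theorem expSeries_isBigO_atTop (ha : ∀ n, ‖a n‖ ≤ n) {c : ℂ} (hc : 0 < c.re) :
    (fun x : ℝ => expSeries a (x * c)) =O[atTop] fun x => Real.exp (-(c.re / 2) * x) := by
  refine IsBigO.of_bound (∑' n : ℕ, n * Real.exp (-(n * (c.re / 2)))) ?_
  filter_upwards [eventually_ge_atTop 1] with x hx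
  have h := norm_expSeries_le_exp (z := x * c) ha hc (by simp; nlinarith)
  rw [Real.norm_of_nonneg (Real.exp_pos _).le]
  convert h using 3
  simp; ring

theorem expSeries_isBigO_zero (ha : ∀ n, ‖a n‖ ≤ n) {c : ℂ} (hc : 0 < c.re) :
    (fun x : ℝ => expSeries a (x * c)) =O[𝓝[>] 0] fun x => x ^ (-3 : ℝ) := by
  refine IsBigO.of_bound (6 / c.re ^ 3 * ∑' n : ℕ, 1 / (n : ℝ) ^ 2) ?_
  filter_upwards [self_mem_nhdsWithin] with x hx
  have hx : 0 < x := hx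
  have h := norm_expSeries_le_inv_pow (z := x * c) ha (by simp; positivity)
  refine h.trans (le_of_eq ?_)
  rw [Real.rpow_neg hx.le, Real.norm_of_nonneg (by positivity)]
  have : ((x : ℂ) * c).re = x * c.re := by simp
  rw [this]
  norm_cast
  field_simp

theorem mellinConvergent_expSeries (ha : ∀ n, ‖a n‖ ≤ n) {c : ℂ} (hc : 0 < c.re) {s : ℂ}
    (hs : 3 < s.re) : MellinConvergent (fun x : ℝ => expSeries a (x * c)) s :=
  mellinConvergent_of_isBigO_rpow_exp (half_pos hc)
    ((continuousOn_expSeries ha hc).locallyIntegrableOn measurableSet_Ioi)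
    (expSeries_isBigO_atTop ha hc) (expSeries_isBigO_zero ha hc) hs

end ExpSeries

section GammaRay

open Filter Topology

theorem norm_cpow_mul_exp {s c : ℂ} {t : ℝ} (ht : 0 < t) :
    ‖(t : ℂ) ^ (s - 1) * Complex.exp (-(c * t))‖ = t ^ (s.re - 1) * Real.exp (-(c.re * t)) := by
  rw [norm_mul, Complex.norm_cpow_eq_rpow_re_of_pos ht, Complex.norm_exp]
  simp

theorem integrableOn_rpow_mul_exp_neg_mul {σ r : ℝ} (hσ : 0 < σ) (hr : 0 < r) :
    IntegrableOn (fun t : ℝ => t ^ (σ - 1) * Real.exp (-(r * t))) (Set.Ioi 0) := by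
  have := integrableOn_rpow_mul_exp_neg_mul_rpow (s := σ - 1) (p := 1) (by linarith) one_pos hr
  simpa using this

theorem aestronglyMeasurable_cpow_mul_exp (s c : ℂ) :
    AEStronglyMeasurable (fun t : ℝ => (t : ℂ) ^ (s - 1) * Complex.exp (-(c * t)))
      (volume.restrict (Set.Ioi 0)) := by
  apply Measurable.aestronglyMeasurable
  fun_prop

theorem integrableOn_cpow_mul_exp {s c : ℂ} (hs : 0 < s.re) (hc : 0 < c.re) :
    IntegrableOn (fun t : ℝ => (t : ℂ) ^ (s - 1) * Complex.exp (-(c * t))) (Set.Ioi 0) := by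
  refine Integrable.mono' (integrableOn_rpow_mul_exp_neg_mul hs hc)
    (aestronglyMeasurable_cpow_mul_exp s c) ?_
  filter_upwards [self_mem_ae_restrict measurableSet_Ioi] with t ht
  exact (norm_cpow_mul_exp ht).le

/-- The Gamma integral along a complex ray. -/
theorem integral_cpow_mul_exp_neg_ray {s c : ℂ} (hs : 0 < s.re) (hc : 0 < c.re) :
    ∫ t in Set.Ioi (0 : ℝ), (t : ℂ) ^ (s - 1) * Complex.exp (-(c * t))
      = Complex.Gamma s * c ^ (-s) := by
  let U : Set ℂ := {z | 0 < z.re}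
  have hU : IsOpen U := isOpen_lt continuous_const Complex.continuous_re
  let J : ℂ → ℂ := fun z => ∫ t in Set.Ioi (0 : ℝ), (t : ℂ) ^ (s - 1) * Complex.exp (-(z * t))
  have hJ : DifferentiableOn ℂ J U := by
    intro z hz
    have hz : 0 < z.re := hz
    have hb : ∀ w ∈ Metric.ball z (z.re / 2), z.re / 2 < w.re := by
      intro w hw
      have := (Complex.abs_re_le_norm (w - z)).trans_lt (mem_ball_iff_norm.1 hw)
      rw [Complex.sub_re, abs_lt] at this
      linarith
    have := hasDerivAt_integral_of_dominated_loc_of_deriv_le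
      (μ := volume.restrict (Set.Ioi (0 : ℝ)))
      (F := fun (w : ℂ) (t : ℝ) => (t : ℂ) ^ (s - 1) * Complex.exp (-(w * t)))
      (F' := fun (w : ℂ) (t : ℝ) => (t : ℂ) ^ (s - 1) * (Complex.exp (-(w * t)) * (-(t : ℂ))))
      (bound := fun t => t ^ (s.re + 1 - 1) * Real.exp (-(z.re / 2 * t)))
      (Metric.ball_mem_nhds z (half_pos hz))
      (Eventually.of_forall fun w => aestronglyMeasurable_cpow_mul_exp s w)
      (integrableOn_cpow_mul_exp hs hz)
      (by apply Measurable.aestronglyMeasurable; fun_prop)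
      ?_ (integrableOn_rpow_mul_exp_neg_mul (by linarith) (half_pos hz)) ?_
    · exact this.2.differentiableAt.differentiableWithinAt
    · filter_upwards [self_mem_ae_restrict measurableSet_Ioi] with t ht w hw
      have ht : 0 < t := ht
      rw [← mul_assoc, norm_mul, norm_cpow_mul_exp ht, norm_neg, Complex.norm_real,
        Real.norm_of_nonneg ht.le, mul_right_comm, ← Real.rpow_add_one ht.ne',
        show s.re - 1 + 1 = s.re + 1 - 1 by ring]
      have := hb w hw
      gcongr
    · filter_upwards with t w hw
      have h1 : HasDerivAt (fun w : ℂ => -(w * t)) (-(t : ℂ)) w := by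
        simpa using! ((hasDerivAt_id w).mul_const (t : ℂ)).neg
      exact (h1.cexp).const_mul _
  have hK : DifferentiableOn ℂ (fun z => Complex.Gamma s * z ^ (-s)) U := by
    intro z hz
    exact ((differentiableAt_id.cpow_const (Or.inl hz)).const_mul _).differentiableWithinAt
  have hpre : IsPreconnected U := (convex_halfSpace_re_gt 0).isPreconnected
  have h1 : (1 : ℂ) ∈ U := by simp [U]
  refine (hJ.analyticOnNhd hU).eqOn_of_preconnected_of_frequently_eq (hK.analyticOnNhd hU)
    hpre h1 ?_ hc
  have hseq : Tendsto (fun n : ℕ => (((1 + 1 / ((n : ℝ) + 1) : ℝ)) : ℂ)) atTop (𝓝[≠] 1) := by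
    rw [tendsto_nhdsWithin_iff]
    constructor
    · have := (tendsto_one_div_add_atTop_nhds_zero_nat (𝕜 := ℝ)).const_add 1
      rw [add_zero] at this
      exact_mod_cast (Complex.continuous_ofReal.tendsto 1).comp this
    · refine Eventually.of_forall fun n => ?_
      have : (1 / ((n : ℝ) + 1)) ≠ 0 := by positivity
      simp only [Set.mem_compl_iff, Set.mem_singleton_iff]
      intro h
      apply this
      have h' : ((1 + 1 / ((n : ℝ) + 1) : ℝ)) = 1 := by exact_mod_cast h
      linarith
  refine hseq.frequently (Frequently.of_forall fun n => ?_)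
  have hr : 0 < 1 + 1 / ((n : ℝ) + 1) := by positivity
  have := Complex.integral_cpow_mul_exp_neg_mul_Ioi hs hr
  simp only [J]
  rw [this, one_div, Complex.inv_cpow _ _ (by
    rw [Complex.arg_ofReal_of_nonneg hr.le]; exact Real.pi_pos.ne), Complex.cpow_neg, mul_comm]

theorem ofReal_mul_cpow {r : ℝ} {z : ℂ} (hr : 0 < r) (hz : z ≠ 0) (s : ℂ) :
    ((r : ℂ) * z) ^ s = (r : ℂ) ^ s * z ^ s := by
  have hr' : (r : ℂ) ≠ 0 := by exact_mod_cast hr.ne'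
  rw [Complex.cpow_def_of_ne_zero (mul_ne_zero hr' hz), Complex.cpow_def_of_ne_zero hr',
    Complex.cpow_def_of_ne_zero hz, Complex.log_ofReal_mul hr hz, Complex.ofReal_log hr.le, add_mul,
    Complex.exp_add]

variable {a : ℕ → ℂ}

theorem mellin_expSeries (ha : ∀ n, ‖a n‖ ≤ n) {c : ℂ} (hc : 0 < c.re) {s : ℂ}
    (hs : 3 < s.re) :
    mellin (fun x : ℝ => expSeries a (x * c)) s = Complex.Gamma s * c ^ (-s) * LSeries a s := by
  have ha0 : a 0 = 0 := by simpa using ha 0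
  have hs0 : s ≠ 0 := by rintro rfl; norm_num at hs
  let F : ℕ → ℝ → ℂ := fun n x => (x : ℂ) ^ (s - 1) * (a n * Complex.exp (-(n * (x * c))))
  have e : ∀ (n : ℕ) (x : ℝ), F n x
      = a n * ((x : ℂ) ^ (s - 1) * Complex.exp (-(n * c * x))) := by
    intro n x
    simp only [F]
    rw [show ((n : ℂ) * (x * c)) = n * c * x by ring]
    ring
  have hre : ∀ {n : ℕ}, 0 < n → 0 < ((n : ℂ) * c).re := by
    intro n hn
    have hn' : (0 : ℝ) < n := by exact_mod_cast hn
    simpa using mul_pos hn' hc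
  have hint : ∀ n : ℕ, IntegrableOn (F n) (Set.Ioi 0) := by
    intro n
    rcases Nat.eq_zero_or_pos n with rfl | hn
    · simp [F, ha0]
    · simp only [funext (e n)]
      exact (integrableOn_cpow_mul_exp (by linarith) (hre hn)).const_mul _
  have hterm : ∀ n : ℕ, ∫ x in Set.Ioi (0 : ℝ), F n x
      = Complex.Gamma s * c ^ (-s) * LSeries.term a s n := by
    intro n
    rcases Nat.eq_zero_or_pos n with rfl | hn
    · simp [F, ha0]
    have h := integral_cpow_mul_exp_neg_ray (s := s) (by linarith) (hre hn)
    simp_rw [e]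
    rw [integral_const_mul, h, LSeries.term_of_ne_zero hn.ne']
    have h1 : ((n : ℂ) * c) ^ (-s) = ((n : ℂ) ^ s)⁻¹ * c ^ (-s) := by
      rw [← Complex.ofReal_natCast, ofReal_mul_cpow (by exact_mod_cast hn) (by rintro rfl; simp at hc),
        Complex.cpow_neg, Complex.ofReal_natCast]
    rw [h1]
    field_simp
  have hnorm : ∀ n : ℕ, ∫ x in Set.Ioi (0 : ℝ), ‖F n x‖
      ≤ Real.Gamma s.re * c.re ^ (-s.re) * (1 / (n : ℝ) ^ 2) := by
    intro n
    rcases Nat.eq_zero_or_pos n with rfl | hn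
    · simp [F, ha0]
    have hn' : (1 : ℝ) ≤ n := by exact_mod_cast hn
    have h := Real.integral_rpow_mul_exp_neg_mul_Ioi (a := s.re) (r := n * c.re) (by linarith)
      (by positivity)
    have h2 : ∫ x in Set.Ioi (0 : ℝ), ‖F n x‖
        = ‖a n‖ * ((1 / (n * c.re)) ^ s.re * Real.Gamma s.re) := by
      rw [← h, ← integral_const_mul]
      refine setIntegral_congr_fun measurableSet_Ioi fun x hx => ?_
      simp only [e]
      rw [norm_mul, norm_cpow_mul_exp hx]
      simp
    rw [h2, one_div, Real.inv_rpow (by positivity), Real.mul_rpow (by positivity) hc.le,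
      Real.rpow_neg hc.le]
    have hG : 0 < Real.Gamma s.re := Real.Gamma_pos_of_pos (by linarith)
    have h3 : ‖a n‖ * ((n : ℝ) ^ s.re)⁻¹ ≤ 1 / (n : ℝ) ^ 2 := by
      have : (n : ℝ) ^ (3 : ℝ) ≤ (n : ℝ) ^ s.re := Real.rpow_le_rpow_of_exponent_le hn' hs.le
      calc ‖a n‖ * ((n : ℝ) ^ s.re)⁻¹ ≤ n * ((n : ℝ) ^ (3 : ℝ))⁻¹ := by
            gcongr
            exact ha n
        _ = 1 / (n : ℝ) ^ 2 := by
            norm_cast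
            push_cast
            field_simp
    calc _ = Real.Gamma s.re * (c.re ^ s.re)⁻¹ * (‖a n‖ * ((n : ℝ) ^ s.re)⁻¹) := by
          rw [mul_inv]; ring
      _ ≤ _ := by gcongr
  have hsum : Summable fun n : ℕ => ∫ x in Set.Ioi (0 : ℝ), ‖F n x‖ :=
    Summable.of_nonneg_of_le (fun n => integral_nonneg fun _ => norm_nonneg _) hnorm
      ((Real.summable_one_div_nat_pow.2 (by norm_num)).mul_left _)
  have key := hasSum_integral_of_summable_integral_norm hint hsum
  rw [mellin, LSeries, ← tsum_mul_left, ← tsum_congr hterm, key.tsum_eq]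
  refine setIntegral_congr_fun measurableSet_Ioi fun x hx => ?_
  simp only [F, expSeries, smul_eq_mul, tsum_mul_left]

end GammaRay

section MeanSquare

open Filter Topology Finset ComplexConjugate

theorem sum_exp_neg_div_le {η : ℝ} (hη : 0 < η) (N : ℕ) :
    ∑ k ∈ range N, Real.exp (-(k * η)) / k ≤ -Real.log (1 - Real.exp (-η)) := by
  have hx : |Real.exp (-η)| < 1 := by
    rw [abs_of_pos (Real.exp_pos _)]
    exact Real.exp_lt_one_iff.2 (by linarith)
  have h := Real.hasSum_pow_div_log_of_abs_lt_one hx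
  rcases N with _ | N
  · simpa using h.nonneg fun n => by positivity
  rw [sum_range_succ', ← h.tsum_eq]
  simp only [Nat.cast_zero, div_zero, add_zero]
  refine le_trans (le_of_eq ?_) (h.summable.sum_le_tsum (range N) fun n _ => by positivity)
  refine sum_congr rfl fun k _ => ?_
  rw [← Real.exp_nat_mul]
  push_cast
  ring_nf

theorem sum_dist_le {f : ℕ → ℝ} (hf : ∀ k, 0 ≤ f k) {N m : ℕ} (hm : m < N) :
    ∑ n ∈ range N, f (Nat.dist m n) ≤ 2 * ∑ k ∈ range N, f k := by
  have hsplit := sum_filter_add_sum_filter_not (range N) (fun n => n ≤ m)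
    (fun n => f (Nat.dist m n))
  rw [← hsplit, two_mul]
  gcongr ?_ + ?_
  · have h1 : ∑ n ∈ range N with n ≤ m, f (Nat.dist m n)
        = ∑ k ∈ ((range N).filter (fun n => n ≤ m)).image (fun n => m - n), f k := by
      rw [sum_image]
      · refine sum_congr rfl fun n hn => ?_
        rw [Nat.dist_eq_sub_of_le_right (mem_filter.1 hn).2]
      · intro x hx y hy hxy
        have := (mem_filter.1 hx).2
        have := (mem_filter.1 hy).2
        simp only at hxy
        omega
    rw [h1]
    refine sum_le_sum_of_subset_of_nonneg ?_ fun k _ _ => hf k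
    intro k hk
    obtain ⟨n, -, rfl⟩ := mem_image.1 hk
    exact mem_range.2 (by omega)
  · have h1 : ∑ n ∈ range N with ¬ n ≤ m, f (Nat.dist m n)
        = ∑ k ∈ ((range N).filter (fun n => ¬ n ≤ m)).image (fun n => n - m), f k := by
      rw [sum_image]
      · refine sum_congr rfl fun n hn => ?_
        rw [Nat.dist_eq_sub_of_le (by have := (mem_filter.1 hn).2; omega)]
      · intro x hx y hy hxy
        have := (mem_filter.1 hx).2
        have := (mem_filter.1 hy).2
        simp only at hxy
        omega
    rw [h1]
    refine sum_le_sum_of_subset_of_nonneg ?_ fun k _ _ => hf k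
    intro k hk
    obtain ⟨n, hn, rfl⟩ := mem_image.1 hk
    have := mem_range.1 (mem_filter.1 hn).1
    exact mem_range.2 (by omega)

variable {a : ℕ → ℂ}

theorem norm_integral_exp_neg_le {w : ℂ} (hw : 0 < w.re) (x₀ : ℝ) :
    ‖∫ x in Set.Ioi x₀, Complex.exp (-w * x)‖ ≤ Real.exp (-(w.re * x₀)) / ‖w‖ := by
  rw [integral_exp_mul_complex_Ioi (by simpa using hw)]
  rw [norm_div, norm_neg, norm_neg, Complex.norm_exp]
  simp

theorem norm_pair_integral_le (ha : ∀ n, ‖a n‖ ≤ n) {c : ℂ} (hre : 0 < c.re) (him : 0 < c.im)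
    {x₀ : ℝ} (hx₀ : 0 < x₀) (m n : ℕ) :
    ‖a m * conj (a n) * ∫ x in Set.Ioi x₀, Complex.exp (-(m * c + n * conj c) * x)‖
      ≤ (if m = n then ‖a m‖ ^ 2 * Real.exp (-(m * (x₀ * c.re / 2))) / m / c.re else 0)
        + (‖a m‖ ^ 2 * Real.exp (-(m * (x₀ * c.re / 2))) +
            ‖a n‖ ^ 2 * Real.exp (-(n * (x₀ * c.re / 2)))) / (2 * c.im) *
          (Real.exp (-(Nat.dist m n * (x₀ * c.re / 2))) / Nat.dist m n) := by
  have ha0 : a 0 = 0 := by simpa using ha 0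
  set η := x₀ * c.re / 2 with hη
  have hηpos : 0 < η := by positivity
  rcases Nat.eq_zero_or_pos m with rfl | hm
  · rw [ha0]; simp; positivity
  have hm' : (0 : ℝ) < m := by exact_mod_cast hm
  have hwre : ((m : ℂ) * c + n * conj c).re = (m + n) * c.re := by simp; ring
  have hwim : ((m : ℂ) * c + n * conj c).im = ((m : ℝ) - n) * c.im := by simp; ring
  have hpos : 0 < ((m : ℂ) * c + n * conj c).re := by rw [hwre]; positivity
  have h1 := norm_integral_exp_neg_le hpos x₀
  rw [norm_mul, norm_mul, Complex.norm_conj]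
  split_ifs with hmn
  · subst hmn
    have h2 : (m + m) * c.re ≤ ‖(m : ℂ) * c + m * conj c‖ := by
      rw [← hwre]; exact Complex.re_le_norm _
    have h3 : Real.exp (-(((m : ℂ) * c + m * conj c).re * x₀)) ≤ Real.exp (-(m * η)) := by
      rw [hwre, hη]
      refine Real.exp_le_exp.2 ?_
      have : 0 ≤ m * (x₀ * c.re) := by positivity
      nlinarith
    have h4 : Real.exp (-(((m : ℂ) * c + m * conj c).re * x₀)) / ‖(m : ℂ) * c + m * conj c‖
        ≤ Real.exp (-(m * η)) / (m * c.re) := by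
      have h5 : m * c.re ≤ ‖(m : ℂ) * c + m * conj c‖ := by
        refine le_trans ?_ h2
        nlinarith [mul_pos hm' hre]
      exact div_le_div₀ (Real.exp_pos _).le h3 (by positivity) h5
    simp only [Nat.dist_self, Nat.cast_zero, div_zero, mul_zero, add_zero]
    calc _ ≤ ‖a m‖ * ‖a m‖ * (Real.exp (-(m * η)) / (m * c.re)) := by gcongr; exact h1.trans h4
      _ = _ := by field_simp
  · have hd : 0 < Nat.dist m n := Nat.dist_pos_of_ne hmn
    have hd' : (0 : ℝ) < Nat.dist m n := by exact_mod_cast hd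
    have habs : (Nat.dist m n : ℝ) = |(m : ℝ) - n| := by
      rcases le_total m n with h | h
      · rw [Nat.dist_eq_sub_of_le h, Nat.cast_sub h, abs_sub_comm, abs_of_nonneg]
        have : (m : ℝ) ≤ n := by exact_mod_cast h
        linarith
      · rw [Nat.dist_eq_sub_of_le_right h, Nat.cast_sub h, abs_of_nonneg]
        have : (n : ℝ) ≤ m := by exact_mod_cast h
        linarith
    have h2 : Nat.dist m n * c.im ≤ ‖(m : ℂ) * c + n * conj c‖ := by
      have := Complex.abs_im_le_norm ((m : ℂ) * c + n * conj c)
      rwa [hwim, abs_mul, abs_of_pos him, ← habs] at this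
    have hn0 : (0 : ℝ) ≤ n := by positivity
    have hdle : (Nat.dist m n : ℝ) ≤ m + n := by
      rw [habs, abs_le]; constructor <;> linarith
    set E := Real.exp (-(Nat.dist m n * η)) with hE
    have h3 : Real.exp (-(((m : ℂ) * c + n * conj c).re * x₀))
        = Real.exp (-((m + n) * (2 * η))) := by
      rw [hwre, hη]; ring_nf
    have h5 : Real.exp (-((m + n) * (2 * η))) ≤ Real.exp (-(m * η)) * E := by
      rw [hE, ← Real.exp_add]
      gcongr
      nlinarith [mul_nonneg hn0 hηpos.le, mul_le_mul_of_nonneg_right hdle hηpos.le]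
    have h6 : Real.exp (-((m + n) * (2 * η))) ≤ Real.exp (-(n * η)) * E := by
      rw [hE, ← Real.exp_add]
      gcongr
      nlinarith [mul_nonneg hm'.le hηpos.le, mul_le_mul_of_nonneg_right hdle hηpos.le]
    rw [zero_add]
    calc _ ≤ ‖a m‖ * ‖a n‖ * (Real.exp (-((m + n) * (2 * η))) / (Nat.dist m n * c.im)) := by
          gcongr
          refine h1.trans ?_
          rw [h3]
          gcongr
      _ ≤ ((‖a m‖ ^ 2 + ‖a n‖ ^ 2) / 2) *
            (Real.exp (-((m + n) * (2 * η))) / (Nat.dist m n * c.im)) := by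
          gcongr
          nlinarith [sq_nonneg (‖a m‖ - ‖a n‖)]
      _ = (‖a m‖ ^ 2 * Real.exp (-((m + n) * (2 * η))) +
            ‖a n‖ ^ 2 * Real.exp (-((m + n) * (2 * η)))) / (2 * c.im) / Nat.dist m n := by
          field_simp
      _ ≤ (‖a m‖ ^ 2 * (Real.exp (-(m * η)) * E) +
            ‖a n‖ ^ 2 * (Real.exp (-(n * η)) * E)) / (2 * c.im) / Nat.dist m n := by
          gcongr
      _ = _ := by ring

/-- The bound for the mean square of a truncated exponential series along a ray. -/
noncomputable def meanSquareBound (a : ℕ → ℂ) (c : ℂ) (x₀ : ℝ) (N : ℕ) : ℝ :=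
  (∑ n ∈ range N, ‖a n‖ ^ 2 * Real.exp (-(n * (x₀ * c.re / 2))) / n) / c.re +
    2 * -Real.log (1 - Real.exp (-(x₀ * c.re / 2))) / c.im *
      ∑ n ∈ range N, ‖a n‖ ^ 2 * Real.exp (-(n * (x₀ * c.re / 2)))

theorem integral_norm_sq_partial_sum_le (ha : ∀ n, ‖a n‖ ≤ n) {c : ℂ} (hre : 0 < c.re)
    (him : 0 < c.im) {x₀ : ℝ} (hx₀ : 0 < x₀) (N : ℕ) :
    IntegrableOn (fun x : ℝ => ‖∑ n ∈ range N, a n * Complex.exp (-(n * (x * c)))‖ ^ 2)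
      (Set.Ioi x₀) ∧
    ∫ x in Set.Ioi x₀, ‖∑ n ∈ range N, a n * Complex.exp (-(n * ((x : ℝ) * c)))‖ ^ 2
      ≤ meanSquareBound a c x₀ N := by
  have ha0 : a 0 = 0 := by simpa using ha 0
  have hexpand : ∀ x : ℝ,
      ((‖∑ n ∈ range N, a n * Complex.exp (-(n * (x * c)))‖ ^ 2 : ℝ) : ℂ)
      = ∑ m ∈ range N, ∑ n ∈ range N,
          a m * conj (a n) * Complex.exp (-(m * c + n * conj c) * x) := by
    intro x
    rw [Complex.ofReal_pow, ← Complex.mul_conj', map_sum, sum_mul_sum]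
    refine sum_congr rfl fun m _ => sum_congr rfl fun n _ => ?_
    rw [map_mul, ← Complex.exp_conj]
    simp only [map_neg, map_mul, Complex.conj_natCast, Complex.conj_ofReal]
    rw [mul_mul_mul_comm, ← Complex.exp_add]
    ring_nf
  have hint : ∀ m n : ℕ, IntegrableOn
      (fun x : ℝ => a m * conj (a n) * Complex.exp (-(m * c + n * conj c) * x)) (Set.Ioi x₀) := by
    intro m n
    rcases Nat.eq_zero_or_pos m with rfl | hm
    · simp [ha0]
    have hm' : (0 : ℝ) < m := by exact_mod_cast hm
    refine (integrableOn_exp_mul_complex_Ioi ?_ x₀).const_mul _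
    have hwre : ((m : ℂ) * c + n * conj c).re = (m + n) * c.re := by simp; ring
    rw [Complex.neg_re, hwre, neg_lt_zero]
    positivity
  have hint2 : IntegrableOn (fun x : ℝ =>
      ((‖∑ n ∈ range N, a n * Complex.exp (-(n * (x * c)))‖ ^ 2 : ℝ) : ℂ)) (Set.Ioi x₀) := by
    simp_rw [hexpand]
    exact integrable_finsetSum _ fun m _ => integrable_finsetSum _ fun n _ => hint m n
  refine ⟨by simpa only [RCLike.re_to_complex, Complex.ofReal_re] using! hint2.re, ?_⟩
  have heq : ((∫ x in Set.Ioi x₀,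
      ‖∑ n ∈ range N, a n * Complex.exp (-(n * ((x : ℝ) * c)))‖ ^ 2 : ℝ) : ℂ)
      = ∑ m ∈ range N, ∑ n ∈ range N, a m * conj (a n) *
          ∫ x in Set.Ioi x₀, Complex.exp (-(m * c + n * conj c) * x) := by
    rw [← integral_complex_ofReal]
    simp_rw [hexpand]
    rw [integral_finsetSum _ fun m _ => integrable_finsetSum _ fun n _ => hint m n]
    refine sum_congr rfl fun m _ => ?_
    rw [integral_finsetSum _ fun n _ => hint m n]
    exact sum_congr rfl fun n _ => integral_const_mul _ _
  have hle := (le_abs_self _).trans_eq (Complex.norm_real (∫ x in Set.Ioi x₀,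
      ‖∑ n ∈ range N, a n * Complex.exp (-(n * ((x : ℝ) * c)))‖ ^ 2)).symm
  rw [heq] at hle
  refine hle.trans <| (norm_sum_le _ _).trans <| (sum_le_sum fun m _ => norm_sum_le _ _).trans <|
    (sum_le_sum fun m _ => sum_le_sum fun n _ => norm_pair_integral_le ha hre him hx₀ m n).trans ?_
  set η := x₀ * c.re / 2 with hη
  have hηpos : 0 < η := by positivity
  set q : ℕ → ℝ := fun n => ‖a n‖ ^ 2 * Real.exp (-(n * η)) with hq
  have hq0 : ∀ n, 0 ≤ q n := fun n => by positivity
  set K : ℕ → ℝ := fun k => Real.exp (-(k * η)) / k with hK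
  have hK0 : ∀ n, 0 ≤ K n := fun n => by positivity
  have hdiag : ∑ m ∈ range N, ∑ n ∈ range N, (if m = n then q m / m / c.re else 0)
      = (∑ n ∈ range N, q n / n) / c.re := by
    rw [sum_div]
    refine sum_congr rfl fun m hm => ?_
    rw [sum_ite_eq, if_pos hm]
  have hsymm : ∑ m ∈ range N, ∑ n ∈ range N, (q m + q n) / (2 * c.im) * K (Nat.dist m n)
      = (∑ m ∈ range N, q m * ∑ n ∈ range N, K (Nat.dist m n)) / c.im := by
    have e1 : ∑ m ∈ range N, ∑ n ∈ range N, q n * K (Nat.dist m n)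
        = ∑ m ∈ range N, ∑ n ∈ range N, q m * K (Nat.dist m n) := by
      rw [sum_comm]
      simp_rw [Nat.dist_comm]
    have e2 : ∀ m n, (q m + q n) / (2 * c.im) * K (Nat.dist m n)
        = (q m * K (Nat.dist m n) + q n * K (Nat.dist m n)) / (2 * c.im) := fun m n => by ring
    simp_rw [e2, ← sum_div, sum_add_distrib, e1, mul_sum]
    field_simp
    ring
  have hoff : ∑ m ∈ range N, q m * ∑ n ∈ range N, K (Nat.dist m n)
      ≤ ∑ m ∈ range N, q m * (2 * -Real.log (1 - Real.exp (-η))) := by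
    refine sum_le_sum fun m hm => mul_le_mul_of_nonneg_left ?_ (hq0 m)
    refine (sum_dist_le hK0 (mem_range.1 hm)).trans ?_
    have := sum_exp_neg_div_le hηpos N
    linarith
  calc _ = (∑ n ∈ range N, q n / n) / c.re
        + (∑ m ∈ range N, q m * ∑ n ∈ range N, K (Nat.dist m n)) / c.im := by
        rw [← hdiag, ← hsymm, ← sum_add_distrib]
        exact sum_congr rfl fun m _ => sum_add_distrib
    _ ≤ (∑ n ∈ range N, q n / n) / c.re
        + (∑ m ∈ range N, q m * (2 * -Real.log (1 - Real.exp (-η)))) / c.im := by gcongr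
    _ = _ := by
        rw [← sum_mul, meanSquareBound]
        ring

theorem lintegral_norm_sq_expSeries_le (ha : ∀ n, ‖a n‖ ≤ n) {c : ℂ} (hre : 0 < c.re)
    (him : 0 < c.im) {x₀ : ℝ} (hx₀ : 0 < x₀) {B : ℝ} (hB : ∀ N, meanSquareBound a c x₀ N ≤ B) :
    ∫⁻ x in Set.Ioi x₀, ENNReal.ofReal (‖expSeries a ((x : ℝ) * c)‖ ^ 2) ≤ ENNReal.ofReal B := by
  have hlim : ∀ x ∈ Set.Ioi x₀, Tendsto (fun N : ℕ => ENNReal.ofReal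
      (‖∑ n ∈ range N, a n * Complex.exp (-(n * ((x : ℝ) * c)))‖ ^ 2)) atTop
      (𝓝 (ENNReal.ofReal (‖expSeries a ((x : ℝ) * c)‖ ^ 2))) := by
    intro x hx
    have hx : x₀ < x := hx
    have hs := (summable_expSeries (z := x * c) ha
      (by simpa using mul_pos (hx₀.trans hx) hre)).hasSum.tendsto_sum_nat
    exact (ENNReal.continuous_ofReal.tendsto _).comp (hs.norm.pow 2)
  calc _ = ∫⁻ x in Set.Ioi x₀, liminf (fun N : ℕ => ENNReal.ofReal
          (‖∑ n ∈ range N, a n * Complex.exp (-(n * ((x : ℝ) * c)))‖ ^ 2)) atTop :=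
        setLIntegral_congr_fun measurableSet_Ioi fun x hx => (hlim x hx).liminf_eq.symm
    _ ≤ liminf (fun N : ℕ => ∫⁻ x in Set.Ioi x₀, ENNReal.ofReal
          (‖∑ n ∈ range N, a n * Complex.exp (-(n * ((x : ℝ) * c)))‖ ^ 2)) atTop :=
        lintegral_liminf_le fun N => by fun_prop
    _ ≤ ENNReal.ofReal B := by
        refine liminf_le_of_le (by isBoundedDefault) fun b hb => ?_
        obtain ⟨N, hN⟩ := hb.exists
        refine hN.trans ?_
        obtain ⟨h1, h2⟩ := integral_norm_sq_partial_sum_le ha hre him hx₀ N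
        rw [← ofReal_integral_eq_lintegral_ofReal h1 (ae_of_all _ fun x => by positivity)]
        exact ENNReal.ofReal_le_ofReal (h2.trans (hB N))

theorem integral_norm_sq_expSeries_le (ha : ∀ n, ‖a n‖ ≤ n) {c : ℂ} (hre : 0 < c.re)
    (him : 0 < c.im) {x₀ : ℝ} (hx₀ : 0 < x₀) {B : ℝ} (hB : ∀ N, meanSquareBound a c x₀ N ≤ B) :
    IntegrableOn (fun x : ℝ => ‖expSeries a (x * c)‖ ^ 2) (Set.Ioi x₀) ∧
      ∫ x in Set.Ioi x₀, ‖expSeries a ((x : ℝ) * c)‖ ^ 2 ≤ B := by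
  have h := lintegral_norm_sq_expSeries_le ha hre him hx₀ hB
  have hm : AEStronglyMeasurable (fun x : ℝ => ‖expSeries a (x * c)‖ ^ 2)
      (volume.restrict (Set.Ioi x₀)) :=
    (((continuousOn_expSeries ha hre).mono (Set.Ioi_subset_Ioi hx₀.le)).norm.pow 2).aestronglyMeasurable
      measurableSet_Ioi
  have hnn : 0 ≤ᵐ[volume.restrict (Set.Ioi x₀)] fun x : ℝ => ‖expSeries a (x * c)‖ ^ 2 :=
    ae_of_all _ fun x => by positivity
  have hB0 : 0 ≤ B := by simpa [meanSquareBound] using hB 0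
  refine ⟨⟨hm, ?_⟩, ?_⟩
  · rw [hasFiniteIntegral_iff_ofReal hnn]
    exact h.trans_lt ENNReal.ofReal_lt_top
  · rw [integral_eq_lintegral_of_nonneg_ae hnn hm]
    exact ENNReal.toReal_le_of_le_ofReal hB0 h

end MeanSquare

section DivisorSums

open Finset

theorem card_divisors_mul_le (m n : ℕ) :
    #(m * n).divisors ≤ #m.divisors * #n.divisors := by
  rw [Nat.divisors_mul]
  exact card_mul_le

theorem sum_card_divisors_mul_le {f : ℕ → ℝ} (hf : ∀ n, 0 ≤ f n) (N : ℕ) :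
    ∑ n ∈ Ico 1 N, (#n.divisors : ℝ) * f n ≤ ∑ i ∈ Ico 1 N, ∑ j ∈ Ico 1 N, f (i * j) := by
  rw [← sum_product']
  have hsub : ∀ n ∈ Ico 1 N, (#n.divisors : ℝ) * f n
      ≤ ∑ p ∈ (Ico 1 N ×ˢ Ico 1 N) with p.1 * p.2 = n, f (p.1 * p.2) := by
    intro n hn
    have hn' := mem_Ico.1 hn
    have hcard : #n.divisors ≤ #{p ∈ Ico 1 N ×ˢ Ico 1 N | p.1 * p.2 = n} := by
      refine card_le_card_of_injOn (fun d => (d, n / d)) (fun d hd => ?_)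
        fun d _ e _ h => (Prod.ext_iff.1 h).1
      have hd := Nat.dvd_of_mem_divisors hd
      have hpos := Nat.div_pos (Nat.le_of_dvd hn'.1 hd) (Nat.pos_of_dvd_of_pos hd hn'.1)
      have hle := Nat.le_of_dvd hn'.1 hd
      have := Nat.div_le_self n d
      have := Nat.pos_of_dvd_of_pos hd hn'.1
      simp only [coe_filter, Set.mem_ofPred_eq, mem_product, mem_Ico]
      exact ⟨⟨⟨by omega, by omega⟩, by omega, by omega⟩, Nat.mul_div_cancel' hd⟩
    have h2 : ∑ p ∈ (Ico 1 N ×ˢ Ico 1 N) with p.1 * p.2 = n, f (p.1 * p.2)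
        = #{p ∈ Ico 1 N ×ˢ Ico 1 N | p.1 * p.2 = n} * f n := by
      rw [← nsmul_eq_mul, ← sum_const]
      exact sum_congr rfl fun p hp => by rw [(mem_filter.1 hp).2]
    rw [h2]
    have := hf n
    gcongr
  refine (sum_le_sum hsub).trans ?_
  exact sum_fiberwise_le_sum_of_sum_fiber_nonneg fun n _ => sum_nonneg fun p _ => hf _

theorem sum_card_divisors_sq_mul_le {f : ℕ → ℝ} (hf : ∀ n, 0 ≤ f n) (N : ℕ) :
    ∑ n ∈ Ico 1 N, (#n.divisors : ℝ) ^ 2 * f n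
      ≤ ∑ i ∈ Ico 1 N, ∑ j ∈ Ico 1 N, ∑ k ∈ Ico 1 N, ∑ l ∈ Ico 1 N, f (i * j * (k * l)) := by
  calc ∑ n ∈ Ico 1 N, (#n.divisors : ℝ) ^ 2 * f n
      = ∑ n ∈ Ico 1 N, (#n.divisors : ℝ) * (#n.divisors * f n) :=
        sum_congr rfl fun n _ => by ring
    _ ≤ ∑ i ∈ Ico 1 N, ∑ j ∈ Ico 1 N, (#(i * j).divisors : ℝ) * f (i * j) :=
        sum_card_divisors_mul_le (fun n => mul_nonneg (by positivity) (hf n)) N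
    _ ≤ ∑ i ∈ Ico 1 N, ∑ j ∈ Ico 1 N, (#i.divisors * #j.divisors : ℝ) * f (i * j) := by
        refine sum_le_sum fun i _ => sum_le_sum fun j _ =>
          mul_le_mul_of_nonneg_right ?_ (hf _)
        exact_mod_cast card_divisors_mul_le i j
    _ = ∑ i ∈ Ico 1 N, (#i.divisors : ℝ) * ∑ j ∈ Ico 1 N, #j.divisors * f (i * j) := by
        simp_rw [mul_sum, mul_assoc]
    _ ≤ ∑ i ∈ Ico 1 N, ∑ j ∈ Ico 1 N,
          ∑ k ∈ Ico 1 N, (#k.divisors : ℝ) * f (i * j * k) :=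
        sum_card_divisors_mul_le
          (f := fun n => ∑ k ∈ Ico 1 N, (#k.divisors : ℝ) * f (n * k))
          (fun n => sum_nonneg fun k _ => mul_nonneg (by positivity) (hf _)) N
    _ ≤ _ := sum_le_sum fun i _ => sum_le_sum fun j _ =>
        sum_card_divisors_mul_le (f := fun n => f (i * j * n)) (fun n => hf _) N

theorem sum_Ico_exp_neg_le {η : ℝ} (hη : 0 < η) (N : ℕ) :
    ∑ k ∈ Ico 1 N, Real.exp (-(k * η)) ≤ 1 / η := by
  have key : ∀ M : ℕ, ∑ k ∈ range M, Real.exp (-((k + 1 : ℕ) * η)) * η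
      ≤ 1 - Real.exp (-(M * η)) := by
    intro M
    induction M with
    | zero => simp
    | succ M ih =>
      rw [sum_range_succ]
      have h1 : Real.exp (-(M * η)) = Real.exp (-((M + 1 : ℕ) * η)) * Real.exp η := by
        rw [← Real.exp_add]; push_cast; ring_nf
      have h2 := Real.add_one_le_exp η
      have h3 := Real.exp_pos (-((M + 1 : ℕ) * η))
      nlinarith
  rw [le_div_iff₀ hη, sum_mul, sum_Ico_eq_sum_range]
  have := key (N - 1)
  simp only [add_comm 1]
  linarith [Real.exp_pos (-((N - 1 : ℕ) * η))]

theorem sum_Ico_exp_neg_div_le {η : ℝ} (hη : 0 < η) (N : ℕ) :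
    ∑ k ∈ Ico 1 N, Real.exp (-(k * η)) / k ≤ -Real.log (1 - Real.exp (-η)) :=
  (sum_le_sum_of_subset_of_nonneg (fun k hk => mem_range.2 (mem_Ico.1 hk).2)
    fun k _ _ => by positivity).trans (sum_exp_neg_div_le hη N)

theorem sum_card_divisors_sq_exp_div_le {η : ℝ} (hη : 0 < η) (N : ℕ) :
    ∑ n ∈ Ico 1 N, (#n.divisors : ℝ) ^ 2 * (Real.exp (-(n * η)) / n)
      ≤ (-Real.log (1 - Real.exp (-(η / 4)))) ^ 4 := by
  refine (sum_card_divisors_sq_mul_le (f := fun n => Real.exp (-(n * η)) / n)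
    (fun n => by positivity) N).trans ?_
  set g : ℕ → ℝ := fun n => Real.exp (-(n * (η / 4))) / n with hg
  have hg0 : ∀ n, 0 ≤ g n := fun n => by positivity
  calc _ ≤ ∑ i ∈ Ico 1 N, ∑ j ∈ Ico 1 N, ∑ k ∈ Ico 1 N, ∑ l ∈ Ico 1 N,
        g i * (g j * (g k * g l)) := by
        refine sum_le_sum fun i hi => sum_le_sum fun j hj => sum_le_sum fun k hk =>
          sum_le_sum fun l hl => ?_
        have hi : (1 : ℝ) ≤ i := by exact_mod_cast (mem_Ico.1 hi).1
        have hj : (1 : ℝ) ≤ j := by exact_mod_cast (mem_Ico.1 hj).1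
        have hk : (1 : ℝ) ≤ k := by exact_mod_cast (mem_Ico.1 hk).1
        have hl : (1 : ℝ) ≤ l := by exact_mod_cast (mem_Ico.1 hl).1
        have h1 : (i + j : ℝ) ≤ 2 * (i * j) := by nlinarith
        have h2 : (k + l : ℝ) ≤ 2 * (k * l) := by nlinarith
        have h3 : (i * j + k * l : ℝ) ≤ 2 * (i * j * (k * l)) := by
          have : (1 : ℝ) ≤ i * j := one_le_mul_of_one_le_of_one_le hi hj
          have : (1 : ℝ) ≤ k * l := one_le_mul_of_one_le_of_one_le hk hl
          nlinarith
        have h4 : g i * (g j * (g k * g l))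
            = Real.exp (-((i + j + k + l) * (η / 4))) / (i * j * (k * l)) := by
          have : -((i + j + k + l : ℝ) * (η / 4)) = -(i * (η / 4)) + (-(j * (η / 4)) +
            (-(k * (η / 4)) + -(l * (η / 4)))) := by ring
          rw [this, Real.exp_add, Real.exp_add, Real.exp_add]
          simp only [hg]
          field_simp
        rw [h4]
        push_cast
        refine div_le_div_of_nonneg_right (Real.exp_le_exp.2 ?_) (by positivity)
        nlinarith
    _ = (∑ i ∈ Ico 1 N, g i) ^ 4 := by
        simp_rw [← mul_sum, ← sum_mul]
        ring
    _ ≤ _ := pow_le_pow_left₀ (sum_nonneg fun i _ => hg0 i)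
        (sum_Ico_exp_neg_div_le (by positivity) N) 4

theorem sum_card_divisors_sq_exp_le {η : ℝ} (hη : 0 < η) (N : ℕ) :
    ∑ n ∈ Ico 1 N, (#n.divisors : ℝ) ^ 2 * Real.exp (-(n * η))
      ≤ 2 / η * (-Real.log (1 - Real.exp (-(η / 6)))) ^ 3 := by
  refine (sum_card_divisors_sq_mul_le (f := fun n => Real.exp (-(n * η)))
    (fun n => by positivity) N).trans ?_
  set g : ℕ → ℝ := fun n => Real.exp (-(n * (η / 6))) / n with hg
  have hg0 : ∀ n, 0 ≤ g n := fun n => by positivity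
  calc _ ≤ ∑ i ∈ Ico 1 N, ∑ j ∈ Ico 1 N, ∑ k ∈ Ico 1 N,
        2 / η * (g i * (g j * g k)) := by
        refine sum_le_sum fun i hi => sum_le_sum fun j hj => sum_le_sum fun k hk => ?_
        have hi : (1 : ℝ) ≤ i := by exact_mod_cast (mem_Ico.1 hi).1
        have hj : (1 : ℝ) ≤ j := by exact_mod_cast (mem_Ico.1 hj).1
        have hk : (1 : ℝ) ≤ k := by exact_mod_cast (mem_Ico.1 hk).1
        have hij : (1 : ℝ) ≤ i * j := one_le_mul_of_one_le_of_one_le hi hj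
        have h1 : (i + j : ℝ) ≤ 2 * (i * j) := by nlinarith
        have h3 : (i + j + k : ℝ) ≤ 3 * (i * j * k) := by nlinarith
        have hpos : (0 : ℝ) < i * j * k := by positivity
        have h4 : 2 / η * (g i * (g j * g k))
            = Real.exp (-((i + j + k) * (η / 6))) * (1 / (i * j * k * (η / 2))) := by
          have : -((i + j + k : ℝ) * (η / 6)) = -(i * (η / 6)) + (-(j * (η / 6)) +
            -(k * (η / 6))) := by ring
          rw [this, Real.exp_add, Real.exp_add]
          simp only [hg]
          field_simp
        rw [h4]
        calc ∑ l ∈ Ico 1 N, Real.exp (-((i * j * (k * l) : ℕ) * η))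
            ≤ ∑ l ∈ Ico 1 N, Real.exp (-((i + j + k) * (η / 6))) *
                Real.exp (-(l * (i * j * k * (η / 2)))) := by
              refine sum_le_sum fun l hl => ?_
              have hl : (1 : ℝ) ≤ l := by exact_mod_cast (mem_Ico.1 hl).1
              rw [← Real.exp_add]
              refine Real.exp_le_exp.2 ?_
              push_cast
              have h5 : (i + j + k : ℝ) ≤ 3 * (i * j * k * l) := by nlinarith
              nlinarith [mul_le_mul_of_nonneg_right h5 hη.le]
          _ ≤ _ := by
              rw [← mul_sum]
              gcongr
              exact sum_Ico_exp_neg_le (by positivity) N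
    _ = 2 / η * (∑ i ∈ Ico 1 N, g i) ^ 3 := by
        simp_rw [← mul_sum, ← sum_mul]
        ring
    _ ≤ _ := by
        gcongr
        exact sum_Ico_exp_neg_div_le (by positivity) N

theorem neg_log_one_sub_exp_nonneg {η : ℝ} (hη : 0 < η) :
    0 ≤ -Real.log (1 - Real.exp (-η)) := by
  have := sum_Ico_exp_neg_div_le hη 0
  simpa using this

theorem neg_log_one_sub_exp_antitone {η₁ η₂ : ℝ} (hη : 0 < η₁) (h : η₁ ≤ η₂) :
    -Real.log (1 - Real.exp (-η₂)) ≤ -Real.log (1 - Real.exp (-η₁)) := by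
  have h1 : Real.exp (-η₁) < 1 := Real.exp_lt_one_iff.2 (by linarith)
  have h2 : Real.exp (-η₂) ≤ Real.exp (-η₁) := Real.exp_le_exp.2 (by linarith)
  exact neg_le_neg (Real.log_le_log (by linarith) (by linarith))

theorem neg_log_one_sub_exp_le {η : ℝ} (hη : 0 < η) (h1 : η ≤ 1) :
    -Real.log (1 - Real.exp (-η)) ≤ Real.log (2 / η) := by
  rw [← Real.log_inv]
  have h2 : η / 2 ≤ 1 - Real.exp (-η) := by
    have h3 : Real.exp (-η) * Real.exp η = 1 := by rw [← Real.exp_add]; simp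
    have h4 : Real.exp (-η) * (η + 1) ≤ 1 := by
      refine le_trans ?_ h3.le
      exact mul_le_mul_of_nonneg_left (Real.add_one_le_exp η) (Real.exp_pos _).le
    nlinarith
  refine Real.log_le_log (inv_pos.2 (by linarith)) ?_
  rw [inv_le_comm₀ (by linarith) (by positivity), inv_div]
  exact h2

theorem meanSquareBound_le_of_norm_le_one {a : ℕ → ℂ} (ha : ∀ n, ‖a n‖ ≤ n)
    (ha1 : ∀ n, ‖a n‖ ≤ 1) {c : ℂ} (hre : 0 < c.re) (him : 0 < c.im) {x₀ : ℝ} (hx₀ : 0 < x₀)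
    (N : ℕ) :
    meanSquareBound a c x₀ N ≤ -Real.log (1 - Real.exp (-(x₀ * c.re / 2))) *
      (1 / c.re + 4 / (x₀ * c.re * c.im)) := by
  have ha0 : a 0 = 0 := by simpa using ha 0
  have hη : 0 < x₀ * c.re / 2 := by positivity
  have hℓ := neg_log_one_sub_exp_nonneg hη
  rw [meanSquareBound]
  set η := x₀ * c.re / 2 with hηdef
  have hsq : ∀ n, ‖a n‖ ^ 2 ≤ 1 := fun n => pow_le_one₀ (norm_nonneg _) (ha1 n)
  have h1 : ∑ n ∈ range N, ‖a n‖ ^ 2 * Real.exp (-(n * η)) / n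
      ≤ -Real.log (1 - Real.exp (-η)) := by
    refine (sum_le_sum fun n _ => ?_).trans (sum_exp_neg_div_le hη N)
    gcongr
    exact mul_le_of_le_one_left (Real.exp_pos _).le (hsq n)
  have h2 : ∑ n ∈ range N, ‖a n‖ ^ 2 * Real.exp (-(n * η)) ≤ 1 / η := by
    refine le_trans ?_ (sum_Ico_exp_neg_le hη N)
    rcases N with _ | N
    · simp
    rw [range_eq_Ico, sum_eq_sum_Ico_succ_bot (by omega)]
    simp only [ha0]
    norm_num
    exact sum_le_sum fun n _ => mul_le_of_le_one_left (Real.exp_pos _).le (hsq n)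
  calc _ ≤ -Real.log (1 - Real.exp (-η)) / c.re
        + 2 * -Real.log (1 - Real.exp (-η)) / c.im * (1 / η) := by gcongr
    _ = _ := by rw [hηdef]; field_simp; ring

theorem meanSquareBound_card_divisors_le {c : ℂ} (hre : 0 < c.re) (him : 0 < c.im) {x₀ : ℝ}
    (hx₀ : 0 < x₀) (N : ℕ) :
    meanSquareBound (fun n => (#n.divisors : ℂ)) c x₀ N
      ≤ (-Real.log (1 - Real.exp (-(x₀ * c.re / 12)))) ^ 4 *
      (1 / c.re + 8 / (x₀ * c.re * c.im)) := by
  have hη : 0 < x₀ * c.re / 2 := by positivity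
  have hℓ := neg_log_one_sub_exp_nonneg hη
  rw [meanSquareBound]
  set η := x₀ * c.re / 2 with hηdef
  have e : x₀ * c.re / 12 = η / 6 := by rw [hηdef]; ring
  rw [e]
  set L := -Real.log (1 - Real.exp (-(η / 6))) with hL
  have hL0 : 0 ≤ L := neg_log_one_sub_exp_nonneg (by positivity)
  have hconv : ∀ f : ℕ → ℝ, ∑ n ∈ range N, ‖(#n.divisors : ℂ)‖ ^ 2 * f n
      = ∑ n ∈ Ico 1 N, (#n.divisors : ℝ) ^ 2 * f n := by
    intro f
    rcases N with _ | N
    · simp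
    rw [range_eq_Ico, sum_eq_sum_Ico_succ_bot (by omega)]
    simp
  have h1 : ∑ n ∈ range N, ‖(#n.divisors : ℂ)‖ ^ 2 * Real.exp (-(n * η)) / n ≤ L ^ 4 := by
    simp_rw [mul_div_assoc]
    rw [hconv]
    refine (sum_card_divisors_sq_exp_div_le hη N).trans ?_
    exact pow_le_pow_left₀ (neg_log_one_sub_exp_nonneg (by positivity))
      (neg_log_one_sub_exp_antitone (by positivity) (by linarith)) 4
  have h2 : ∑ n ∈ range N, ‖(#n.divisors : ℂ)‖ ^ 2 * Real.exp (-(n * η)) ≤ 2 / η * L ^ 3 := by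
    rw [hconv]
    exact sum_card_divisors_sq_exp_le hη N
  have h3 : -Real.log (1 - Real.exp (-η)) ≤ L :=
    neg_log_one_sub_exp_antitone (by positivity) (by linarith)
  calc _ ≤ L ^ 4 / c.re + 2 * L / c.im * (2 / η * L ^ 3) := by gcongr
    _ = _ := by rw [hηdef]; field_simp; ring

end DivisorSums

section Continuation

open Filter Topology Asymptotics

theorem mellin_eq_of_eqOn_re_gt {G : ℝ → ℂ} {R : ℂ → ℂ} {b : ℝ} (hb : 0 < b)
    (hloc : LocallyIntegrableOn G (Set.Ioi 0))
    (htop : G =O[atTop] fun x => Real.exp (-b * x)) (hbot : G =O[𝓝[>] 0] fun _ => (1 : ℝ))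
    (hR : ∀ s : ℂ, 0 < s.re → s.im ≠ 0 → DifferentiableAt ℂ R s) {σ : ℝ}
    (hσ : ∀ s : ℂ, σ < s.re → mellin G s = R s)
    {s : ℂ} (hs : 0 < s.re) (hs' : s.im ≠ 0) : mellin G s = R s := by
  have hbot' : G =O[𝓝[>] 0] (· ^ (-0 : ℝ)) := by simpa using hbot
  have hM : ∀ z : ℂ, 0 < z.re → DifferentiableAt ℂ (mellin G) z := fun z hz =>
    mellin_differentiableAt_of_isBigO_rpow_exp hb hloc htop hbot' hz
  have main : ∀ U : Set ℂ, IsOpen U → Convex ℝ U → (∀ z ∈ U, 0 < z.re ∧ z.im ≠ 0) →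
      (∃ z₀ ∈ U, σ < z₀.re) → Set.EqOn (mellin G) R U := by
    intro U hU hc hz ⟨z₀, hz₀, hσ₀⟩
    refine AnalyticOnNhd.eqOn_of_preconnected_of_eventuallyEq
      (DifferentiableOn.analyticOnNhd (fun z hzU => (hM z (hz z hzU).1).differentiableWithinAt) hU)
      (DifferentiableOn.analyticOnNhd
        (fun z hzU => (hR z (hz z hzU).1 (hz z hzU).2).differentiableWithinAt) hU)
      hc.isPreconnected hz₀ ?_
    filter_upwards [(isOpen_lt continuous_const Complex.continuous_re).mem_nhds hσ₀] with z h
    exact hσ z h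
  have hre : IsOpen {z : ℂ | 0 < z.re} := isOpen_lt continuous_const Complex.continuous_re
  rcases lt_or_gt_of_ne hs' with h | h
  · refine main ({z | 0 < z.re} ∩ {z | z.im < 0})
      (hre.inter (isOpen_lt Complex.continuous_im continuous_const))
      ((convex_halfSpace_re_gt 0).inter (convex_halfSpace_im_lt 0))
      (fun z hz => ⟨hz.1, ne_of_lt hz.2⟩) ⟨⟨max σ 0 + 1, -1⟩, ⟨?_, ?_⟩, ?_⟩ ⟨hs, h⟩
    · show (0 : ℝ) < max σ 0 + 1
      positivity
    · show (-1 : ℝ) < 0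
      norm_num
    · show σ < max σ 0 + 1
      linarith [le_max_left σ 0]
  · refine main ({z | 0 < z.re} ∩ {z | 0 < z.im})
      (hre.inter (isOpen_lt continuous_const Complex.continuous_im))
      ((convex_halfSpace_re_gt 0).inter (convex_halfSpace_im_gt 0))
      (fun z hz => ⟨hz.1, ne_of_gt hz.2⟩) ⟨⟨max σ 0 + 1, 1⟩, ⟨?_, ?_⟩, ?_⟩ ⟨hs, h⟩
    · show (0 : ℝ) < max σ 0 + 1
      positivity
    · show (0 : ℝ) < 1
      norm_num
    · show σ < max σ 0 + 1
      linarith [le_max_left σ 0]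

/-- Finite linear combinations of dilations of an exponential series along a ray. -/
noncomputable def dilationSum {ι : Type*} (J : Finset ι) (κ r : ι → ℝ) (a : ℕ → ℂ) (c : ℂ)
    (x : ℝ) : ℂ :=
  ∑ j ∈ J, (κ j : ℂ) * expSeries a ((r j * x : ℝ) * c)

variable {a : ℕ → ℂ} {ι : Type*} {J : Finset ι} {κ r : ι → ℝ}

theorem continuousOn_dilationSum (ha : ∀ n, ‖a n‖ ≤ n) {c : ℂ} (hc : 0 < c.re)
    (hr : ∀ j, 0 < r j) : ContinuousOn (dilationSum J κ r a c) (Set.Ioi 0) := by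
  refine continuousOn_finsetSum _ fun j _ => continuousOn_const.mul ?_
  refine (continuousOn_expSeries ha hc).comp (f := fun x : ℝ => r j * x)
    (by fun_prop) fun x hx => ?_
  exact mul_pos (hr j) hx

theorem dilationSum_isBigO_atTop (ha : ∀ n, ‖a n‖ ≤ n) {c : ℂ} (hc : 0 < c.re) {r₀ : ℝ}
    (hr₀ : 0 < r₀) (hr : ∀ j, r₀ ≤ r j) :
    dilationSum J κ r a c =O[atTop] fun x => Real.exp (-(r₀ * c.re / 2) * x) := by
  refine IsBigO.fun_sum fun j _ => IsBigO.const_mul_left ?_ _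
  have h := (expSeries_isBigO_atTop ha hc).comp_tendsto
    (tendsto_id.const_mul_atTop (hr₀.trans_le (hr j)))
  refine h.trans (IsBigO.of_bound 1 ?_)
  filter_upwards [eventually_ge_atTop 0] with x hx
  simp only [Function.comp, id, Real.norm_eq_abs, Real.abs_exp, one_mul]
  refine Real.exp_le_exp.2 ?_
  have := mul_le_mul_of_nonneg_right (hr j) (mul_nonneg hx hc.le)
  nlinarith

theorem mellin_dilationSum (ha : ∀ n, ‖a n‖ ≤ n) {c : ℂ} (hc : 0 < c.re)
    (hr : ∀ j, 0 < r j) {s : ℂ} (hs : 3 < s.re) :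
    mellin (dilationSum J κ r a c) s
      = Complex.Gamma s * c ^ (-s) * LSeries a s * ∑ j ∈ J, (κ j : ℂ) * (r j : ℂ) ^ (-s) := by
  have hconv : ∀ j, MellinConvergent (fun x : ℝ => expSeries a ((r j * x : ℝ) * c)) s := fun j =>
    (MellinConvergent.comp_mul_left (f := fun x : ℝ => expSeries a (x * c)) (hr j)).2
      (mellinConvergent_expSeries ha hc hs)
  have h1 : mellin (dilationSum J κ r a c) s
      = ∑ j ∈ J, (κ j : ℂ) * mellin (fun x : ℝ => expSeries a ((r j * x : ℝ) * c)) s := by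
    simp only [mellin, dilationSum, smul_eq_mul, Finset.mul_sum]
    rw [integral_finsetSum]
    · refine Finset.sum_congr rfl fun j _ => ?_
      rw [← integral_const_mul]
      congr 1
      ext x
      ring
    · intro j _
      refine ((hconv j).const_mul (κ j : ℂ)).congr (ae_of_all _ fun x => ?_)
      simp only [smul_eq_mul]
      ring
  rw [h1, Finset.mul_sum]
  refine Finset.sum_congr rfl fun j _ => ?_
  rw [mellin_comp_mul_left (fun x : ℝ => expSeries a (x * c)) s (hr j), mellin_expSeries ha hc hs,
    smul_eq_mul]
  ring

theorem dilationSum_mellin_eq (ha : ∀ n, ‖a n‖ ≤ n) {c : ℂ} (hc : 0 < c.re) {r₀ : ℝ}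
    (hr₀ : 0 < r₀) (hr : ∀ j, r₀ ≤ r j)
    (hbot : dilationSum J κ r a c =O[𝓝[>] 0] fun _ => (1 : ℝ)) {L : ℂ → ℂ}
    (hL : ∀ s : ℂ, s ≠ 1 → DifferentiableAt ℂ L s) (hLa : ∀ s : ℂ, 1 < s.re → LSeries a s = L s)
    {s : ℂ} (hs : 0 < s.re) (hs' : s.im ≠ 0) :
    mellin (dilationSum J κ r a c) s
      = Complex.Gamma s * c ^ (-s) * L s * ∑ j ∈ J, (κ j : ℂ) * (r j : ℂ) ^ (-s) := by
  have hrpos : ∀ j, 0 < r j := fun j => hr₀.trans_le (hr j)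
  have hc0 : c ≠ 0 := by rintro rfl; simp at hc
  refine mellin_eq_of_eqOn_re_gt (b := r₀ * c.re / 2) (by positivity)
    ((continuousOn_dilationSum ha hc hrpos).locallyIntegrableOn measurableSet_Ioi)
    (dilationSum_isBigO_atTop ha hc hr₀ hr) hbot (fun z hz hz' => ?_)
    (fun z hz => (mellin_dilationSum ha hc hrpos hz).trans
      (by rw [hLa z (by linarith)])) hs hs'
  have hz1 : z ≠ 1 := by rintro rfl; simp at hz'
  have hG : DifferentiableAt ℂ Complex.Gamma z := Complex.differentiableAt_Gamma z fun m hm => by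
    rw [hm] at hz; simp at hz; linarith [Nat.cast_nonneg (α := ℝ) m]
  refine ((hG.mul ?_).mul (hL z hz1)).mul ?_
  · exact DifferentiableAt.const_cpow (by fun_prop) (Or.inl hc0)
  · refine DifferentiableAt.fun_sum fun j _ => (DifferentiableAt.const_cpow (by fun_prop)
      (Or.inl ?_)).const_mul _
    exact_mod_cast (hrpos j).ne'

end Continuation

section Kernels

open Filter Topology Asymptotics

/-- The coefficients `uⁿ` for `n ≥ 1`, and `0` for `n = 0`. -/
noncomputable def powCoeff (u : ℂ) (n : ℕ) : ℂ := if n = 0 then 0 else u ^ n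

theorem norm_powCoeff_le_one {u : ℂ} (hu : ‖u‖ = 1) (n : ℕ) : ‖powCoeff u n‖ ≤ 1 := by
  rw [powCoeff]; split_ifs <;> simp [hu]

theorem norm_powCoeff_le {u : ℂ} (hu : ‖u‖ = 1) (n : ℕ) : ‖powCoeff u n‖ ≤ n := by
  rcases Nat.eq_zero_or_pos n with rfl | hn
  · simp [powCoeff]
  · exact (norm_powCoeff_le_one hu n).trans (by exact_mod_cast hn)

theorem norm_exp_neg_lt_one {z : ℂ} (hz : 0 < z.re) : ‖Complex.exp (-z)‖ < 1 := by
  rw [Complex.norm_exp, Real.exp_lt_one_iff, Complex.neg_re]; linarith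

theorem expSeries_powCoeff {u : ℂ} (hu : ‖u‖ = 1) {z : ℂ} (hz : 0 < z.re) :
    expSeries (powCoeff u) z = u * Complex.exp (-z) / (1 - u * Complex.exp (-z)) := by
  have hq : ‖u * Complex.exp (-z)‖ < 1 := by
    rw [norm_mul, hu, one_mul]; exact norm_exp_neg_lt_one hz
  rw [expSeries, (summable_expSeries (norm_powCoeff_le hu) hz).tsum_eq_zero_add]
  have : ∀ n : ℕ, powCoeff u (n + 1) * Complex.exp (-((n + 1 : ℕ) * z))
      = u * Complex.exp (-z) * (u * Complex.exp (-z)) ^ n := by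
    intro n
    rw [← pow_succ', mul_pow, ← Complex.exp_nat_mul, powCoeff, if_neg n.succ_ne_zero]
    ring_nf
  simp_rw [this]
  rw [tsum_mul_left, tsum_geometric_of_norm_lt_one hq]
  simp [powCoeff, div_eq_mul_inv]

theorem one_add_exp_neg_ne_zero {z : ℂ} (hz : 0 < z.re) : 1 + Complex.exp (-z) ≠ 0 := by
  intro h
  have h1 : Complex.exp (-z) = -1 := by linear_combination h
  have h2 := norm_exp_neg_lt_one hz
  rw [h1] at h2
  simp at h2

theorem one_sub_exp_neg_ne_zero {z : ℂ} (hz : 0 < z.re) : 1 - Complex.exp (-z) ≠ 0 := by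
  intro h
  have h1 : Complex.exp (-z) = 1 := by linear_combination -h
  have h2 := norm_exp_neg_lt_one hz
  rw [h1] at h2
  simp at h2

theorem geometric_sub_two_mul {z : ℂ} (hz : 0 < z.re) :
    Complex.exp (-z) / (1 - Complex.exp (-z)) -
      2 * (Complex.exp (-(2 * z)) / (1 - Complex.exp (-(2 * z))))
      = Complex.exp (-z) / (1 + Complex.exp (-z)) := by
  have e : Complex.exp (-(2 * z)) = Complex.exp (-z) ^ 2 := by
    rw [← Complex.exp_nat_mul]; push_cast; ring_nf
  have h1 := one_sub_exp_neg_ne_zero hz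
  have h2 := one_add_exp_neg_ne_zero hz
  rw [e]
  have h3 : 1 - Complex.exp (-z) ^ 2 = (1 - Complex.exp (-z)) * (1 + Complex.exp (-z)) := by ring
  rw [h3]
  field_simp
  ring

theorem one_le_norm_one_add_exp_neg {z : ℂ} (h0 : 0 ≤ z.im) (h1 : z.im ≤ Real.pi / 2) :
    1 ≤ ‖1 + Complex.exp (-z)‖ := by
  refine le_trans ?_ (Complex.re_le_norm _)
  have hcos : 0 ≤ Real.cos z.im := Real.cos_nonneg_of_mem_Icc ⟨by linarith [Real.pi_pos], h1⟩
  rw [Complex.add_re, Complex.exp_re]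
  simp
  positivity

theorem le_norm_one_add_exp_neg_ray {c : ℂ} (hre : 0 < c.re) (him : 0 < c.im) {x : ℝ}
    (hx : 0 < x) :
    1 - Real.exp (-(Real.pi / 2 * (c.re / c.im))) ≤ ‖1 + Complex.exp (-(x * c))‖ := by
  have hre' : ((x : ℂ) * c).re = x * c.re := by simp
  have him' : ((x : ℂ) * c).im = x * c.im := by simp
  rcases le_total (x * c.im) (Real.pi / 2) with h | h
  · refine le_trans ?_ (one_le_norm_one_add_exp_neg (by rw [him']; positivity) (by rwa [him']))
    linarith [Real.exp_pos (-(Real.pi / 2 * (c.re / c.im)))]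
  · have h1 : ‖Complex.exp (-(x * c))‖ ≤ Real.exp (-(Real.pi / 2 * (c.re / c.im))) := by
      rw [Complex.norm_exp, Complex.neg_re, hre']
      refine Real.exp_le_exp.2 (neg_le_neg ?_)
      rw [← mul_div_assoc, div_le_iff₀ him]
      nlinarith
    have h2 := norm_sub_norm_le (1 : ℂ) (-Complex.exp (-(x * c)))
    rw [sub_neg_eq_add, norm_neg, norm_one] at h2
    linarith

theorem norm_exp_div_one_add_exp_sub_le {κ : ℝ} (hκ : 0 < κ) {w z : ℂ}
    (h1 : κ ≤ ‖1 + Complex.exp (-w)‖) (h2 : κ ≤ ‖1 + Complex.exp (-(w + z))‖) :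
    ‖Complex.exp (-w) / (1 + Complex.exp (-w)) -
      Complex.exp (-(w + z)) / (1 + Complex.exp (-(w + z)))‖
      ≤ ‖Complex.exp z - 1‖ / κ ^ 2 * Real.exp (-(w + z).re) := by
  have h1' : 1 + Complex.exp (-w) ≠ 0 := norm_pos_iff.1 (hκ.trans_le h1)
  have h2' : 1 + Complex.exp (-(w + z)) ≠ 0 := norm_pos_iff.1 (hκ.trans_le h2)
  have e : Complex.exp (-w) = Complex.exp z * Complex.exp (-(w + z)) := by
    rw [← Complex.exp_add]; ring_nf
  have e2 : Complex.exp (-w) / (1 + Complex.exp (-w)) -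
      Complex.exp (-(w + z)) / (1 + Complex.exp (-(w + z)))
      = (Complex.exp z - 1) * Complex.exp (-(w + z)) /
        ((1 + Complex.exp (-w)) * (1 + Complex.exp (-(w + z)))) := by
    rw [div_sub_div _ _ h1' h2', e]
    ring
  rw [e2, norm_div, norm_mul, norm_mul, Complex.norm_exp (-(w + z)), Complex.neg_re]
  rw [div_mul_eq_mul_div]
  refine div_le_div_of_nonneg_left (by positivity) (by positivity) ?_
  rw [sq]
  exact mul_le_mul h1 h2 hκ.le (norm_nonneg _)

theorem norm_natCast_divisors_card_le (n : ℕ) : ‖(n.divisors.card : ℂ)‖ ≤ n := by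
  rw [Complex.norm_natCast]
  exact_mod_cast Nat.card_divisors_le_self n

theorem summable_geometric_ratio {z : ℂ} (hz : 0 < z.re) :
    Summable fun n : ℕ => Complex.exp (-(n * z)) / (1 - Complex.exp (-(n * z))) := by
  have hq := norm_exp_neg_lt_one hz
  refine Summable.of_norm_bounded
    ((summable_geometric_of_lt_one (norm_nonneg _) hq).mul_right (1 - ‖Complex.exp (-z)‖)⁻¹)
    fun n => ?_
  have e : Complex.exp (-(n * z)) = Complex.exp (-z) ^ n := by
    rw [← Complex.exp_nat_mul]; ring_nf
  rw [e, norm_div, norm_pow, div_eq_mul_inv]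
  rcases Nat.eq_zero_or_pos n with rfl | hn
  · simp [hq.le]
  · have h1 := norm_sub_norm_le (1 : ℂ) (Complex.exp (-z) ^ n)
    have h2 : ‖Complex.exp (-z)‖ ^ n ≤ ‖Complex.exp (-z)‖ :=
      pow_le_of_le_one (norm_nonneg _) hq.le hn.ne'
    rw [norm_one, norm_pow] at h1
    exact mul_le_mul_of_nonneg_left (inv_anti₀ (by linarith) (by linarith)) (by positivity)

theorem expSeries_card_divisors {z : ℂ} (hz : 0 < z.re) :
    expSeries (fun n => (n.divisors.card : ℂ)) z
      = ∑' n : ℕ, Complex.exp (-(n * z)) / (1 - Complex.exp (-(n * z))) := by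
  have h := tsum_pow_div_one_sub_eq_tsum_sigma (norm_exp_neg_lt_one hz) 0
  have e : ∀ n : ℕ, Complex.exp (-z) ^ n = Complex.exp (-(n * z)) := fun n => by
    rw [← Complex.exp_nat_mul]; ring_nf
  simp only [pow_zero, one_mul, e, ArithmeticFunction.sigma_zero_apply] at h
  rw [tsum_pnat_eq_tsum_succ
      (f := fun n : ℕ => Complex.exp (-(n * z)) / (1 - Complex.exp (-(n * z)))),
    tsum_pnat_eq_tsum_succ (f := fun n : ℕ => (n.divisors.card : ℂ) * Complex.exp (-(n * z)))] at h
  rw [expSeries, (summable_geometric_ratio hz).tsum_eq_zero_add,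
    (summable_expSeries norm_natCast_divisors_card_le hz).tsum_eq_zero_add, h]
  simp

theorem expSeries_card_divisors_combination {z : ℂ} (hz : 0 < z.re) :
    HasSum (fun k : ℕ =>
      Complex.exp (-((2 * k + 1 : ℕ) * z)) / (1 + Complex.exp (-((2 * k + 1 : ℕ) * z))) -
      Complex.exp (-((2 * k + 2 : ℕ) * z)) / (1 + Complex.exp (-((2 * k + 2 : ℕ) * z))))
    (expSeries (fun n => (n.divisors.card : ℂ)) z
      - 4 * expSeries (fun n => (n.divisors.card : ℂ)) (2 * z)
      + 4 * expSeries (fun n => (n.divisors.card : ℂ)) (4 * z)) := by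
  have h2 : 0 < (2 * z).re := by simpa using hz
  have h4 : 0 < (4 * z).re := by simpa using hz
  set g : ℂ → ℂ := fun w => Complex.exp (-w) / (1 - Complex.exp (-w)) with hg
  set p : ℕ → ℂ := fun n => g (n * z) - 2 * g (2 * (n * z)) with hp
  have hg2 : ∀ n : ℕ, g (2 * (n * z)) = g (n * (2 * z)) := fun n => by ring_nf
  have hsum : Summable fun n : ℕ => g (n * z) := summable_geometric_ratio hz
  have hsum2 : Summable fun n : ℕ => g (n * (2 * z)) := summable_geometric_ratio h2
  have hsum4 : Summable fun n : ℕ => g (n * (4 * z)) := summable_geometric_ratio h4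
  have hps : Summable p := by
    simp only [hp, hg2]
    exact hsum.sub (hsum2.mul_left 2)
  have hpn : ∀ n : ℕ, n ≠ 0 → p n = Complex.exp (-(n * z)) / (1 + Complex.exp (-(n * z))) := by
    intro n hn
    have hn' : (0 : ℝ) < n := by exact_mod_cast Nat.pos_of_ne_zero hn
    exact geometric_sub_two_mul (z := n * z) (by simp; positivity)
  have hp0 : p 0 = 0 := by simp [hp, hg]
  have hodd : Summable fun k : ℕ => p (2 * k + 1) :=
    hps.comp_injective fun x y h => by simpa using h
  have heven : Summable fun k : ℕ => p (2 * k) :=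
    hps.comp_injective fun x y h => by simpa using h
  have heven' : Summable fun k : ℕ => p (2 * k + 2) :=
    hps.comp_injective fun x y h => by simpa using h
  have e1 : ∑' n, p n = ∑' n : ℕ, g (n * z) - 2 * ∑' n : ℕ, g (n * (2 * z)) := by
    simp only [hp, hg2]
    rw [hsum.tsum_sub (hsum2.mul_left 2), tsum_mul_left]
  have e2 : ∑' n, p (2 * n) = ∑' n : ℕ, g (n * (2 * z)) - 2 * ∑' n : ℕ, g (n * (4 * z)) := by
    have : ∀ n : ℕ, p (2 * n) = g (n * (2 * z)) - 2 * g (n * (4 * z)) := fun n => by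
      simp only [hp]; push_cast; ring_nf
    simp_rw [this]
    rw [hsum2.tsum_sub (hsum4.mul_left 2), tsum_mul_left]
  have e3 := tsum_even_add_odd heven hodd
  have e4 : ∑' n, p (2 * n) = ∑' n, p (2 * n + 2) := by
    rw [heven.tsum_eq_zero_add]
    simp only [mul_zero, hp0, zero_add, mul_add, mul_one]
  have hfin := (hodd.sub heven').hasSum
  rw [hodd.tsum_sub heven', ← e4] at hfin
  rw [expSeries_card_divisors hz, expSeries_card_divisors h2, expSeries_card_divisors h4]
  have e5 : ∑' n : ℕ, g (n * z) - 4 * ∑' n : ℕ, g (n * (2 * z)) + 4 * ∑' n : ℕ, g (n * (4 * z))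
      = ∑' n, p (2 * n + 1) - ∑' n, p (2 * n) := by
    linear_combination -e1 - e3 + 2 * e2
  rw [← e5] at hfin
  refine hfin.congr_fun fun k => ?_
  rw [hpn _ (by omega), hpn _ (by omega)]

theorem norm_expSeries_card_divisors_combination_le {c : ℂ} (hre : 0 < c.re) (him : 0 < c.im)
    {x : ℝ} (hx : 0 < x) (hxc : x * ‖c‖ ≤ 1) :
    ‖expSeries (fun n => (n.divisors.card : ℂ)) (x * c)
      - 4 * expSeries (fun n => (n.divisors.card : ℂ)) (2 * (x * c))
      + 4 * expSeries (fun n => (n.divisors.card : ℂ)) (4 * (x * c))‖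
      ≤ ‖c‖ / ((1 - Real.exp (-(Real.pi / 2 * (c.re / c.im)))) ^ 2 * c.re) := by
  set κ := 1 - Real.exp (-(Real.pi / 2 * (c.re / c.im))) with hκdef
  have hκ : 0 < κ := by
    have : 0 < Real.pi / 2 * (c.re / c.im) := by positivity
    have := Real.exp_lt_one_iff.2 (neg_lt_zero.2 this)
    linarith
  have hre' : ((x : ℂ) * c).re = x * c.re := by simp
  have hz : 0 < ((x : ℂ) * c).re := by rw [hre']; positivity
  have hray : ∀ n : ℕ, n ≠ 0 → κ ≤ ‖1 + Complex.exp (-(n * (x * c)))‖ := fun n hn => by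
    have := le_norm_one_add_exp_neg_ray hre him (x := n * x)
      (mul_pos (by exact_mod_cast Nat.pos_of_ne_zero hn) hx)
    push_cast at this
    rwa [← mul_assoc]
  set y := x * c.re with hy
  have hy0 : 0 < y := by positivity
  have hq : Real.exp (-(2 * y)) < 1 := Real.exp_lt_one_iff.2 (by linarith)
  have hgeo : HasSum (fun k : ℕ => ‖Complex.exp (x * c) - 1‖ / κ ^ 2 *
      (Real.exp (-(2 * y)) * Real.exp (-(2 * y)) ^ k))
      (‖Complex.exp (x * c) - 1‖ / κ ^ 2 * (Real.exp (-(2 * y)) * (1 - Real.exp (-(2 * y)))⁻¹)) :=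
    ((hasSum_geometric_of_lt_one (Real.exp_pos _).le hq).mul_left _).mul_left _
  rw [← (expSeries_card_divisors_combination hz).tsum_eq]
  refine (tsum_of_norm_bounded hgeo fun k => ?_).trans ?_
  · have h := norm_exp_div_one_add_exp_sub_le hκ (w := (2 * k + 1 : ℕ) * (x * c)) (z := x * c)
      (hray _ (by omega)) (by
        have := hray (2 * k + 2) (by omega)
        convert this using 5
        push_cast; ring)
    have e : ((2 * k + 1 : ℕ) : ℂ) * (x * c) + x * c = (2 * k + 2 : ℕ) * (x * c) := by
      push_cast; ring
    rw [e] at h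
    refine h.trans (le_of_eq ?_)
    congr 1
    rw [← Real.exp_nat_mul, ← Real.exp_add]
    congr 1
    rw [hy]
    simp
    ring
  · have h1 : ‖Complex.exp (x * c) - 1‖ ≤ 2 * (x * ‖c‖) := by
      have h := Complex.norm_exp_sub_one_le (x := (x : ℂ) * c)
        (by rw [norm_mul, Complex.norm_of_nonneg hx.le]; exact hxc)
      rwa [norm_mul, Complex.norm_of_nonneg hx.le] at h
    have h2 : Real.exp (-(2 * y)) * (1 - Real.exp (-(2 * y)))⁻¹ ≤ 1 / (2 * y) := by
      rw [← div_eq_mul_inv, div_le_div_iff₀ (by linarith) (by positivity)]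
      have h3 : Real.exp (-(2 * y)) * Real.exp (2 * y) = 1 := by rw [← Real.exp_add]; simp
      have h4 := mul_le_mul_of_nonneg_left (Real.add_one_le_exp (2 * y)) (Real.exp_pos (-(2 * y))).le
      nlinarith
    calc _ ≤ 2 * (x * ‖c‖) / κ ^ 2 * (1 / (2 * y)) := by
          have : 0 ≤ Real.exp (-(2 * y)) * (1 - Real.exp (-(2 * y)))⁻¹ :=
            mul_nonneg (Real.exp_pos _).le (inv_nonneg.2 (by linarith))
          gcongr
      _ = _ := by rw [hy]; field_simp

theorem LSeries_powCoeff_one {s : ℂ} (hs : 1 < s.re) :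
    LSeries (powCoeff 1) s = riemannZeta s := by
  rw [← LSeries_one_eq_riemannZeta hs]
  exact LSeries_congr (fun {n} hn => by simp [powCoeff, hn]) s

theorem LSeries_card_divisors {s : ℂ} (hs : 1 < s.re) :
    LSeries (fun n => (n.divisors.card : ℂ)) s = riemannZeta s ^ 2 := by
  have h1 : LSeriesSummable 1 s := LSeriesSummable_one_iff.2 hs
  rw [← LSeries_one_eq_riemannZeta hs, sq, ← LSeries_convolution' h1 h1]
  refine LSeries_congr (fun {n} hn => ?_) s
  rw [LSeries.convolution_def]
  simpa using (Nat.sum_divisorsAntidiagonal (n := n) fun _ _ => (1 : ℂ)).symm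

end Kernels

section CriticalLine

open Filter Topology Asymptotics FourierTransform

/-- The function on `ℝ` whose Fourier transform is the Mellin transform of `G` on the critical
line. -/
noncomputable def logPullback (G : ℝ → ℂ) (u : ℝ) : ℂ :=
  Real.exp (-(1 / 2) * u) • G (Real.exp (-u))

theorem fourier_logPullback (G : ℝ → ℂ) (ξ : ℝ) :
    𝓕 (logPullback G) ξ = mellin G (1 / 2 + Complex.I * (2 * Real.pi * ξ : ℝ)) := by
  rw [mellin_eq_fourier]
  have h1 : (1 / 2 + Complex.I * (2 * Real.pi * ξ : ℝ) : ℂ).re = 1 / 2 := by simp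
  have h2 : (1 / 2 + Complex.I * (2 * Real.pi * ξ : ℝ) : ℂ).im = 2 * Real.pi * ξ := by simp
  rw [h1, h2, mul_div_cancel_left₀ _ (by positivity)]
  rfl

theorem hasDerivWithinAt_exp_neg (s : Set ℝ) (x : ℝ) :
    HasDerivWithinAt (fun u : ℝ => Real.exp (-u)) (-Real.exp (-x)) s x := by
  have h := (hasDerivAt_neg x).exp
  simpa using! h.hasDerivWithinAt

theorem injOn_exp_neg (s : Set ℝ) : Set.InjOn (fun u : ℝ => Real.exp (-u)) s :=
  fun _ _ _ _ h => neg_injective (Real.exp_injective h)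

theorem image_exp_neg_univ : (fun u : ℝ => Real.exp (-u)) '' Set.univ = Set.Ioi 0 := by
  ext x
  constructor
  · rintro ⟨u, -, rfl⟩
    exact Real.exp_pos _
  · intro hx
    exact ⟨-Real.log x, trivial, by simpa using Real.exp_log hx⟩

theorem image_exp_neg_Iio : (fun u : ℝ => Real.exp (-u)) '' Set.Iio 0 = Set.Ioi 1 := by
  ext x
  constructor
  · rintro ⟨u, hu, rfl⟩
    exact Real.one_lt_exp_iff.2 (neg_pos.2 hu)
  · intro hx
    have hx : 1 < x := hx
    exact ⟨-Real.log x, neg_lt_zero.2 (Real.log_pos hx), by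
      simpa using Real.exp_log (by linarith)⟩

theorem norm_logPullback_sq (G : ℝ → ℂ) (u : ℝ) :
    ‖logPullback G u‖ ^ 2 = |-Real.exp (-u)| • ‖G (Real.exp (-u))‖ ^ 2 := by
  rw [logPullback, norm_smul, mul_pow, Real.norm_eq_abs, Real.abs_exp, abs_neg, Real.abs_exp,
    ← Real.exp_nat_mul, smul_eq_mul]
  ring_nf

theorem setIntegral_norm_logPullback_sq (G : ℝ → ℂ) {s : Set ℝ} (hs : MeasurableSet s) :
    ∫ u in s, ‖logPullback G u‖ ^ 2
      = ∫ x in (fun u : ℝ => Real.exp (-u)) '' s, ‖G x‖ ^ 2 := by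
  rw [integral_image_eq_integral_abs_deriv_smul hs (fun x _ => hasDerivWithinAt_exp_neg s x)
    (injOn_exp_neg s)]
  simp_rw [norm_logPullback_sq]

variable {G : ℝ → ℂ} {b : ℝ}

theorem continuous_logPullback (hcont : ContinuousOn G (Set.Ioi 0)) :
    Continuous (logPullback G) := by
  have h1 : Continuous fun u : ℝ => Real.exp (-(1 / 2) * u) := by fun_prop
  have h2 : Continuous fun u : ℝ => G (Real.exp (-u)) :=
    hcont.comp_continuous (by fun_prop) fun u => Real.exp_pos (-u)
  exact h1.smul h2

theorem integrable_logPullback (hb : 0 < b) (hcont : ContinuousOn G (Set.Ioi 0))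
    (htop : G =O[atTop] fun x => Real.exp (-b * x)) (hbot : G =O[𝓝[>] 0] fun _ => (1 : ℝ)) :
    Integrable (logPullback G) := by
  have hM : MellinConvergent G (1 / 2) := mellinConvergent_of_isBigO_rpow_exp hb
    (hcont.locallyIntegrableOn measurableSet_Ioi) htop (b := 0) (by simpa using hbot) (by norm_num)
  rw [MellinConvergent, ← image_exp_neg_univ, integrableOn_image_iff_integrableOn_abs_deriv_smul
    MeasurableSet.univ (fun x _ => hasDerivWithinAt_exp_neg _ x) (injOn_exp_neg _),
    integrableOn_univ] at hM
  refine hM.congr (ae_of_all _ fun u => ?_)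
  simp only [logPullback, abs_neg, Real.abs_exp]
  rw [← smul_assoc, ← Complex.coe_smul (Real.exp (-(1 / 2) * u))]
  congr 1
  rw [Complex.real_smul, show (1 / 2 - 1 : ℂ) = ((1 / 2 - 1 : ℝ) : ℂ) by push_cast; rfl,
    ← Complex.ofReal_cpow (Real.exp_pos _).le, ← Complex.ofReal_mul, ← Real.exp_mul, ← Real.exp_add]
  ring_nf

theorem integrableOn_norm_sq (hb : 0 < b) (hcont : ContinuousOn G (Set.Ioi 0))
    (htop : G =O[atTop] fun x => Real.exp (-b * x)) (hbot : G =O[𝓝[>] 0] fun _ => (1 : ℝ)) :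
    IntegrableOn (fun x => ‖G x‖ ^ 2) (Set.Ioi 0) := by
  have hM : MellinConvergent (fun x => ((‖G x‖ ^ 2 : ℝ) : ℂ)) 1 := by
    refine mellinConvergent_of_isBigO_rpow_exp (a := b + b) (b := 0) (by positivity)
      (ContinuousOn.locallyIntegrableOn ?_ measurableSet_Ioi) ?_ ?_ (by norm_num)
    · exact Complex.continuous_ofReal.comp_continuousOn (hcont.norm.pow 2)
    · rw [Complex.isBigO_ofReal_left]
      refine (htop.norm_left.pow 2).congr_right fun x => ?_
      rw [← Real.exp_nat_mul]
      ring_nf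
    · rw [Complex.isBigO_ofReal_left]
      refine (hbot.norm_left.pow 2).congr_right fun x => ?_
      simp
  refine (Integrable.re hM).congr (ae_of_all _ fun x => ?_)
  simp only [sub_self, Complex.cpow_zero, one_smul]
  exact Complex.ofReal_re _

theorem memLp_logPullback (hb : 0 < b) (hcont : ContinuousOn G (Set.Ioi 0))
    (htop : G =O[atTop] fun x => Real.exp (-b * x)) (hbot : G =O[𝓝[>] 0] fun _ => (1 : ℝ)) :
    MemLp (logPullback G) 2 := by
  rw [memLp_two_iff_integrable_sq_norm (continuous_logPullback hcont).aestronglyMeasurable]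
  have h := integrableOn_norm_sq hb hcont htop hbot
  rw [← image_exp_neg_univ, integrableOn_image_iff_integrableOn_abs_deriv_smul
    MeasurableSet.univ (fun x _ => hasDerivWithinAt_exp_neg _ x) (injOn_exp_neg _),
    integrableOn_univ] at h
  simpa only [norm_logPullback_sq] using h

theorem integral_norm_sq_mellin_eq (hb : 0 < b) (hcont : ContinuousOn G (Set.Ioi 0))
    (htop : G =O[atTop] fun x => Real.exp (-b * x)) (hbot : G =O[𝓝[>] 0] fun _ => (1 : ℝ)) :
    Integrable (fun t : ℝ => ‖mellin G (1 / 2 + Complex.I * t)‖ ^ 2) ∧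
      ∫ t : ℝ, ‖mellin G (1 / 2 + Complex.I * t)‖ ^ 2
        = 2 * Real.pi * ∫ x in Set.Ioi 0, ‖G x‖ ^ 2 := by
  have hπ : 2 * Real.pi ≠ 0 := by positivity
  have hi := integrable_logPullback hb hcont htop hbot
  have hL := memLp_logPullback hb hcont htop hbot
  have hF := memLp_fourier hi hL
  have hFi := (memLp_two_iff_integrable_sq_norm hF.1).1 hF
  have hP := integral_norm_sq_fourier_eq hi hL
  have hG := setIntegral_norm_logPullback_sq G MeasurableSet.univ
  rw [image_exp_neg_univ, Measure.restrict_univ] at hG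
  simp_rw [fourier_logPullback] at hFi hP
  refine ⟨(integrable_comp_mul_left_iff
    (fun t : ℝ => ‖mellin G (1 / 2 + Complex.I * t)‖ ^ 2) hπ).1 hFi, ?_⟩
  rw [Measure.integral_comp_mul_left
    (fun t : ℝ => ‖mellin G (1 / 2 + Complex.I * t)‖ ^ 2), hG, abs_of_pos (by positivity),
    smul_eq_mul] at hP
  rw [← hP]
  field_simp

end CriticalLine

section SecondMoment

open Filter Topology Asymptotics

theorem norm_Gamma_half_sq (t : ℝ) :
    ‖Complex.Gamma (1 / 2 + Complex.I * t)‖ ^ 2 = Real.pi / Real.cosh (Real.pi * t) := by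
  have h := Complex.Gamma_mul_Gamma_one_sub (1 / 2 + Complex.I * t)
  have h1 : (1 : ℂ) - (1 / 2 + Complex.I * t) = (starRingEnd ℂ) (1 / 2 + Complex.I * t) := by
    simp only [map_add, map_mul, Complex.conj_I, Complex.conj_ofReal, map_div₀, map_one,
      map_ofNat]
    ring
  have h2 : Complex.sin (Real.pi * (1 / 2 + Complex.I * t)) = Real.cosh (Real.pi * t) := by
    rw [show (Real.pi * (1 / 2 + Complex.I * t) : ℂ)
      = Real.pi / 2 - (-(Real.pi * t : ℝ) : ℂ) * Complex.I by push_cast; ring,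
      Complex.sin_pi_div_two_sub, Complex.cos_mul_I, Complex.cosh_neg, Complex.ofReal_cosh]
  rw [h1, Complex.Gamma_conj, Complex.mul_conj', h2] at h
  exact_mod_cast h

/-- The point of modulus `2π` and argument `π/2 - δ`. -/
noncomputable def rayPoint (δ : ℝ) : ℂ :=
  (2 * Real.pi : ℝ) * Complex.exp ((Real.pi / 2 - δ : ℝ) * Complex.I)

theorem rayPoint_re (δ : ℝ) : (rayPoint δ).re = 2 * Real.pi * Real.sin δ := by
  rw [rayPoint, Complex.re_ofReal_mul, Complex.exp_ofReal_mul_I_re, Real.cos_pi_div_two_sub]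

theorem rayPoint_im (δ : ℝ) : (rayPoint δ).im = 2 * Real.pi * Real.cos δ := by
  rw [rayPoint, Complex.im_ofReal_mul, Complex.exp_ofReal_mul_I_im, Real.sin_pi_div_two_sub]

variable {δ : ℝ}

theorem le_rayPoint_re (h0 : 0 < δ) (h1 : δ ≤ 1) : 4 * δ ≤ (rayPoint δ).re := by
  rw [rayPoint_re]
  have h := Real.mul_le_sin h0.le (by linarith [Real.pi_gt_three])
  have h' := mul_le_mul_of_nonneg_left h (by positivity : 0 ≤ 2 * Real.pi)
  refine le_trans (le_of_eq ?_) h'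
  field_simp
  ring

theorem rayPoint_re_pos (h0 : 0 < δ) (h1 : δ ≤ 1) : 0 < (rayPoint δ).re :=
  lt_of_lt_of_le (by positivity) (le_rayPoint_re h0 h1)

theorem one_le_rayPoint_im (h0 : 0 < δ) (h1 : δ ≤ 1) : 1 ≤ (rayPoint δ).im := by
  rw [rayPoint_im]
  have h := Real.one_sub_sq_div_two_le_cos (x := δ)
  have h2 : 1 / 2 ≤ Real.cos δ := by nlinarith
  nlinarith [Real.pi_gt_three]

theorem rayPoint_im_le (δ : ℝ) : (rayPoint δ).im ≤ 2 * Real.pi := by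
  rw [rayPoint_im]
  exact mul_le_of_le_one_right (by positivity) (Real.cos_le_one δ)

theorem log_rayPoint (h0 : 0 < δ) (h1 : δ ≤ 1) :
    Complex.log (rayPoint δ)
      = (Real.log (2 * Real.pi) : ℝ) + (Real.pi / 2 - δ : ℝ) * Complex.I := by
  have hπ := Real.pi_gt_three
  rw [rayPoint, Complex.log_ofReal_mul (by positivity) (Complex.exp_ne_zero _),
    Complex.log_exp]
  · rw [Complex.im_ofReal_mul, Complex.I_im]; linarith
  · rw [Complex.im_ofReal_mul, Complex.I_im]; linarith

theorem rayPoint_ne_zero (δ : ℝ) : rayPoint δ ≠ 0 :=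
  mul_ne_zero (by simp [Real.pi_ne_zero]) (Complex.exp_ne_zero _)

theorem rayPoint_cpow (h0 : 0 < δ) (h1 : δ ≤ 1) (s : ℂ) :
    rayPoint δ ^ (-s) = (2 * Real.pi : ℂ) ^ (-s) *
      Complex.exp (-(s * ((Real.pi / 2 - δ : ℝ) * Complex.I))) := by
  have h2 : (2 * Real.pi : ℂ) = ((2 * Real.pi : ℝ) : ℂ) := by push_cast; rfl
  rw [Complex.cpow_def_of_ne_zero (rayPoint_ne_zero δ), log_rayPoint h0 h1, h2,
    Complex.cpow_def_of_ne_zero (by simp [Real.pi_ne_zero]), ← Complex.exp_add,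
    Complex.ofReal_log (by positivity)]
  ring_nf

theorem norm_two_pi_cpow (t : ℝ) :
    ‖(2 * Real.pi : ℂ) ^ (-(1 / 2 + Complex.I * t))‖ ^ 2 = 1 / (2 * Real.pi) := by
  have h2 : (2 * Real.pi : ℂ) = ((2 * Real.pi : ℝ) : ℂ) := by push_cast; rfl
  rw [h2, Complex.norm_cpow_eq_rpow_re_of_pos (by positivity), ← Real.rpow_natCast,
    ← Real.rpow_mul (by positivity)]
  simp [Real.rpow_neg_one]

theorem norm_Gamma_mul_rayPoint_cpow_sq (h0 : 0 < δ) (h1 : δ ≤ 1) (t : ℝ) :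
    ‖Complex.Gamma (1 / 2 + Complex.I * t) * rayPoint δ ^ (-(1 / 2 + Complex.I * t))‖ ^ 2
      = Real.exp ((Real.pi - 2 * δ) * t) / (2 * Real.cosh (Real.pi * t)) := by
  rw [norm_mul, mul_pow, norm_Gamma_half_sq, rayPoint_cpow h0 h1, norm_mul, mul_pow,
    norm_two_pi_cpow, Complex.norm_exp, ← Real.exp_nat_mul]
  have h : (-((1 / 2 + Complex.I * t) * ((Real.pi / 2 - δ : ℝ) * Complex.I))).re
      = (Real.pi / 2 - δ) * t := by
    simp
    ring
  rw [h, show ((2 : ℕ) : ℝ) * ((Real.pi / 2 - δ) * t) = (Real.pi - 2 * δ) * t by push_cast; ring]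
  have := Real.cosh_pos (Real.pi * t)
  field_simp

theorem le_norm_Gamma_mul_rayPoint_cpow_sq (h0 : 0 < δ) (h1 : δ ≤ 1) {t : ℝ} (ht : 0 ≤ t) :
    Real.exp (-(2 * δ * t)) / 2 ≤
      ‖Complex.Gamma (1 / 2 + Complex.I * t) * rayPoint δ ^ (-(1 / 2 + Complex.I * t))‖ ^ 2 := by
  rw [norm_Gamma_mul_rayPoint_cpow_sq h0 h1, div_le_div_iff₀ (by norm_num)
    (by positivity)]
  have h : Real.cosh (Real.pi * t) ≤ Real.exp (Real.pi * t) := by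
    rw [Real.cosh_eq]
    have : Real.exp (-(Real.pi * t)) ≤ Real.exp (Real.pi * t) :=
      Real.exp_le_exp.2 (by nlinarith [Real.pi_pos])
    linarith
  have h2 : Real.exp ((Real.pi - 2 * δ) * t) = Real.exp (-(2 * δ * t)) * Real.exp (Real.pi * t) := by
    rw [← Real.exp_add]; ring_nf
  rw [h2]
  nlinarith [mul_le_mul_of_nonneg_left h (Real.exp_pos (-(2 * δ * t))).le]

/-- On the critical line `|2^s - 1|` is bounded below. -/
theorem le_norm_one_sub_two_cpow {s : ℂ} (hs : s.re = 1 / 2) : 2 / 5 ≤ ‖(2 : ℂ) ^ s - 1‖ := by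
  have h : ‖(2 : ℂ) ^ s‖ = Real.sqrt 2 := by
    rw [show (2 : ℂ) = ((2 : ℝ) : ℂ) by simp, Complex.norm_cpow_eq_rpow_re_of_pos (by norm_num), hs,
      Real.sqrt_eq_rpow]
  have h2 : (7 / 5 : ℝ) ≤ Real.sqrt 2 := Real.le_sqrt_of_sq_le (by norm_num)
  have h3 := norm_sub_norm_le ((2 : ℂ) ^ s) 1
  rw [h, norm_one] at h3
  linarith

end SecondMoment

section SecondMoment

open Filter Topology Asymptotics

theorem intervalIntegral_norm_sq_le_of_mellin_eq {G : ℝ → ℂ} {b : ℝ} (hb : 0 < b)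
    (hcont : ContinuousOn G (Set.Ioi 0)) (htop : G =O[atTop] fun x => Real.exp (-b * x))
    (hbot : G =O[𝓝[>] 0] fun _ => (1 : ℝ)) {T : ℝ} (hT : 1 ≤ T) {f q : ℝ → ℂ} {m : ℝ} (hm : 0 < m)
    (hq : ∀ t, m ≤ ‖q t‖)
    (hG : ∀ t : ℝ, 0 < t → mellin G (1 / 2 + Complex.I * t)
      = Complex.Gamma (1 / 2 + Complex.I * t) * rayPoint T⁻¹ ^ (-(1 / 2 + Complex.I * t))
        * f t * q t) :
    ∫ t in T..(2 * T), ‖f t‖ ^ 2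
      ≤ 4 * Real.pi * Real.exp 4 / m ^ 2 * ∫ x in Set.Ioi 0, ‖G x‖ ^ 2 := by
  obtain ⟨hi, he⟩ := integral_norm_sq_mellin_eq hb hcont htop hbot
  have hT0 : 0 < T := by linarith
  have hδ0 : 0 < T⁻¹ := inv_pos.2 hT0
  have hδ1 : T⁻¹ ≤ 1 := inv_le_one_of_one_le₀ hT
  rw [intervalIntegral.integral_of_le (by linarith)]
  calc ∫ t in Set.Ioc T (2 * T), ‖f t‖ ^ 2
      ≤ ∫ t in Set.Ioc T (2 * T),
          2 * Real.exp 4 / m ^ 2 * ‖mellin G (1 / 2 + Complex.I * t)‖ ^ 2 := by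
        refine integral_mono_of_nonneg (ae_of_all _ fun t => by positivity)
          (hi.const_mul _).integrableOn ?_
        rw [EventuallyLE, ae_restrict_iff' measurableSet_Ioc]
        refine ae_of_all _ fun t ht => ?_
        have ht0 : 0 < t := hT0.trans ht.1
        have h1 := le_norm_Gamma_mul_rayPoint_cpow_sq hδ0 hδ1 ht0.le
        have h2 : Real.exp (-4) / 2 ≤ Real.exp (-(2 * T⁻¹ * t)) / 2 := by
          have : T⁻¹ * t ≤ 2 := by
            rw [inv_mul_le_iff₀ hT0]; linarith [ht.2]
          have := Real.exp_le_exp.2 (show (-4 : ℝ) ≤ -(2 * T⁻¹ * t) by linarith)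
          linarith
        have h3 : m ^ 2 ≤ ‖q t‖ ^ 2 := pow_le_pow_left₀ hm.le (hq t) 2
        have h4 : Real.exp 4 * Real.exp (-4) = 1 := by rw [← Real.exp_add]; simp
        rw [hG t ht0, norm_mul, norm_mul, mul_pow, mul_pow, div_mul_eq_mul_div,
          le_div_iff₀ (by positivity)]
        calc ‖f t‖ ^ 2 * m ^ 2 = 2 * Real.exp 4 * (Real.exp (-4) / 2 * ‖f t‖ ^ 2 * m ^ 2) := by
              linear_combination -(‖f t‖ ^ 2 * m ^ 2) * h4
          _ ≤ _ := by
              refine mul_le_mul_of_nonneg_left ?_ (by positivity)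
              exact mul_le_mul (mul_le_mul_of_nonneg_right (h2.trans h1) (by positivity)) h3
                (by positivity) (by positivity)
    _ ≤ ∫ t : ℝ, 2 * Real.exp 4 / m ^ 2 * ‖mellin G (1 / 2 + Complex.I * t)‖ ^ 2 :=
        setIntegral_le_integral (hi.const_mul _) (ae_of_all _ fun t => by positivity)
    _ = _ := by
        rw [integral_const_mul, he]
        ring

theorem dilationSum_powCoeff_one {c : ℂ} (hc : 0 < c.re) {x : ℝ} (hx : 0 < x) :
    dilationSum Finset.univ ![1, -2] ![1, 2] (powCoeff 1) c x
      = Complex.exp (-(x * c)) / (1 + Complex.exp (-(x * c))) := by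
  have h1 : 0 < (x * c).re := by rw [Complex.re_ofReal_mul]; positivity
  have h2 : 0 < (2 * (x * c)).re := by
    rw [show (2 : ℂ) = ((2 : ℝ) : ℂ) by simp, Complex.re_ofReal_mul]; positivity
  rw [← geometric_sub_two_mul h1]
  have e1 := expSeries_powCoeff (u := 1) (by simp) h1
  have e2 := expSeries_powCoeff (u := 1) (by simp) h2
  simp only [one_mul] at e1 e2
  rw [← e1, ← e2]
  simp [dilationSum, Fin.sum_univ_two, mul_assoc, sub_eq_add_neg]

theorem dilationSum_powCoeff_one_eq_neg {c : ℂ} (hc : 0 < c.re) {x : ℝ} (hx : 0 < x) :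
    dilationSum Finset.univ ![1, -2] ![1, 2] (powCoeff 1) c x
      = -expSeries (powCoeff (-1)) (x * c) := by
  have h1 : 0 < (x * c).re := by rw [Complex.re_ofReal_mul]; positivity
  rw [dilationSum_powCoeff_one hc hx, expSeries_powCoeff (by simp) h1]
  simp [neg_div]

theorem norm_dilationSum_powCoeff_one_le {δ : ℝ} (h0 : 0 < δ) (h1 : δ ≤ 1) {x : ℝ} (hx : 0 < x)
    (hx' : x ≤ 1 / 4) :
    ‖dilationSum Finset.univ ![1, -2] ![1, 2] (powCoeff 1) (rayPoint δ) x‖ ≤ 1 := by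
  have hre := rayPoint_re_pos h0 h1
  have him := one_le_rayPoint_im h0 h1
  have h : 0 < (x * rayPoint δ).re := by rw [Complex.re_ofReal_mul]; positivity
  rw [dilationSum_powCoeff_one hre hx, norm_div]
  have hd : 1 ≤ ‖1 + Complex.exp (-(x * rayPoint δ))‖ := by
    apply one_le_norm_one_add_exp_neg <;> rw [Complex.im_ofReal_mul]
    · positivity
    · nlinarith [rayPoint_im_le δ, Real.pi_pos]
  exact (div_le_one (by linarith)).2 ((norm_exp_neg_lt_one h).le.trans hd)

theorem integral_norm_sq_dilationSum_powCoeff_le {T : ℝ} (hT : 4 ≤ T)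
    (hi : IntegrableOn (fun x => ‖dilationSum Finset.univ ![1, -2] ![1, 2] (powCoeff 1)
      (rayPoint T⁻¹) x‖ ^ 2) (Set.Ioi 0)) :
    ∫ x in Set.Ioi 0, ‖dilationSum Finset.univ ![1, -2] ![1, 2] (powCoeff 1)
      (rayPoint T⁻¹) x‖ ^ 2 ≤ 9 * (T * Real.log T) := by
  have hT0 : 0 < T := by linarith
  have hδ0 : 0 < T⁻¹ := inv_pos.2 hT0
  have hδ1 : T⁻¹ ≤ 1 := inv_le_one_of_one_le₀ (by linarith)
  have hre := rayPoint_re_pos hδ0 hδ1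
  have hre' := le_rayPoint_re hδ0 hδ1
  have him := one_le_rayPoint_im hδ0 hδ1
  have hlog : 1 ≤ Real.log T := by
    rw [Real.le_log_iff_exp_le hT0]
    linarith [Real.exp_one_lt_d9]
  set c := rayPoint T⁻¹
  rw [← Set.Ioc_union_Ioi_eq_Ioi (show (0 : ℝ) ≤ 1 / 4 by norm_num),
    setIntegral_union Set.Ioc_disjoint_Ioi_same measurableSet_Ioi
      (hi.mono_set Set.Ioc_subset_Ioi_self)
      (hi.mono_set (Set.Ioi_subset_Ioi (by norm_num)))]
  have hA : ∫ x in Set.Ioc 0 (1 / 4), ‖dilationSum Finset.univ ![1, -2] ![1, 2] (powCoeff 1)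
      c x‖ ^ 2 ≤ 1 / 4 := by
    calc _ ≤ ∫ x in Set.Ioc (0 : ℝ) (1 / 4), (1 : ℝ) := by
          refine setIntegral_mono_on (hi.mono_set Set.Ioc_subset_Ioi_self) (by simp)
            measurableSet_Ioc fun x hx => ?_
          exact pow_le_one₀ (norm_nonneg _) (norm_dilationSum_powCoeff_one_le hδ0 hδ1 hx.1 hx.2)
      _ = 1 / 4 := by simp
  have hB : ∫ x in Set.Ioi (1 / 4), ‖dilationSum Finset.univ ![1, -2] ![1, 2] (powCoeff 1)
      c x‖ ^ 2 ≤ 17 / 2 * (T * Real.log T) := by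
    have h := (integral_norm_sq_expSeries_le (norm_powCoeff_le (u := -1) (by simp)) hre
      (by linarith) (show (0 : ℝ) < 1 / 4 by norm_num)
      (meanSquareBound_le_of_norm_le_one (norm_powCoeff_le (u := -1) (by simp))
        (norm_powCoeff_le_one (by simp)) hre (by linarith) (by norm_num))).2
    rw [setIntegral_congr_fun (g := fun x : ℝ => ‖expSeries (powCoeff (-1)) (x * c)‖ ^ 2)
      measurableSet_Ioi fun x hx => by
        rw [dilationSum_powCoeff_one_eq_neg hre (lt_trans (by norm_num) hx), norm_neg]]
    refine h.trans ?_
    have l1 : -Real.log (1 - Real.exp (-(1 / 4 * c.re / 2))) ≤ 2 * Real.log T := by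
      have hη : 0 < T⁻¹ / 2 := by positivity
      refine (neg_log_one_sub_exp_antitone hη (by linarith)).trans
        ((neg_log_one_sub_exp_le hη (by linarith)).trans ?_)
      rw [← Real.log_rpow hT0]
      refine Real.log_le_log (by positivity) ?_
      norm_num
      field_simp
      nlinarith
    have l2 : 1 / c.re + 4 / (1 / 4 * c.re * c.im) ≤ 17 / 4 * T := by
      have e1 : 1 / c.re ≤ T / 4 := by
        rw [div_le_div_iff₀ hre (by norm_num)]
        have := mul_le_mul_of_nonneg_left hre' hT0.le
        rw [mul_left_comm, mul_inv_cancel₀ hT0.ne'] at this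
        linarith
      have e2 : 4 / (1 / 4 * c.re * c.im) ≤ 16 * (1 / c.re) := by
        rw [mul_one_div, div_le_div_iff₀ (by positivity) hre]
        nlinarith
      linarith
    calc _ ≤ 2 * Real.log T * (17 / 4 * T) :=
          mul_le_mul l1 l2 (by positivity) (by linarith)
      _ = _ := by ring
  nlinarith

theorem integral_norm_zeta_sq_le : ∃ C > (0 : ℝ), ∀ T : ℝ, 4 ≤ T →
    ∫ t in T..(2 * T), ‖riemannZeta (1 / 2 + Complex.I * t)‖ ^ 2 ≤ C * (T * Real.log T) := by
  refine ⟨4 * Real.pi * Real.exp 4 / (2 / 5) ^ 2 * 9, by positivity, fun T hT => ?_⟩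
  have hT0 : 0 < T := by linarith
  have hδ0 : 0 < T⁻¹ := inv_pos.2 hT0
  have hδ1 : T⁻¹ ≤ 1 := inv_le_one_of_one_le₀ (by linarith)
  have hre := rayPoint_re_pos hδ0 hδ1
  have ha := norm_powCoeff_le (u := 1) (by simp)
  have hr : ∀ j, (1 : ℝ) ≤ ![1, 2] j := by
    intro j; fin_cases j <;> norm_num
  have hcont := continuousOn_dilationSum (J := Finset.univ) (κ := ![1, -2]) ha hre
    fun j => lt_of_lt_of_le one_pos (hr j)
  have htop := dilationSum_isBigO_atTop (J := Finset.univ) (κ := ![1, -2]) ha hre one_pos hr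
  have hbot : dilationSum Finset.univ ![1, -2] ![1, 2] (powCoeff 1) (rayPoint T⁻¹)
      =O[𝓝[>] 0] fun _ => (1 : ℝ) := by
    refine IsBigO.of_bound 1 ?_
    filter_upwards [Ioc_mem_nhdsGT (show (0 : ℝ) < 1 / 4 by norm_num)] with x hx
    simpa using norm_dilationSum_powCoeff_one_le hδ0 hδ1 hx.1 hx.2
  have hb : 0 < 1 * (rayPoint T⁻¹).re / 2 := by positivity
  have h := intervalIntegral_norm_sq_le_of_mellin_eq hb hcont htop hbot (T := T) (by linarith)
    (f := fun t => riemannZeta (1 / 2 + Complex.I * t))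
    (q := fun t => 1 - (2 : ℂ) ^ (1 - (1 / 2 + Complex.I * t))) (m := 2 / 5) (by norm_num)
    (fun t => by
      rw [norm_sub_rev]
      exact le_norm_one_sub_two_cpow (by norm_num))
    (fun t ht => by
      rw [dilationSum_mellin_eq ha hre one_pos hr hbot
        (fun s hs => differentiableAt_riemannZeta hs) (fun s hs => LSeries_powCoeff_one hs)
        (by simp) (by simpa using ht.ne')]
      generalize (1 / 2 + Complex.I * t : ℂ) = s
      congr 1
      rw [Complex.cpow_sub _ _ two_ne_zero, Complex.cpow_one]
      simp [Fin.sum_univ_two, Complex.cpow_neg]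
      ring)
  refine h.trans ?_
  rw [mul_assoc _ (9 : ℝ)]
  exact mul_le_mul_of_nonneg_left (integral_norm_sq_dilationSum_powCoeff_le hT
    (integrableOn_norm_sq hb hcont htop hbot)) (by positivity)

end SecondMoment

section Duality

open Filter Topology Asymptotics FourierTransform ComplexConjugate

theorem fourier_const_mul_conj_comp_neg (A : ℝ → ℂ) (η : ℂ) (ξ : ℝ) :
    𝓕 (fun u => η * conj (A (-u))) ξ = η * conj (𝓕 A ξ) := by
  rw [Real.fourier_real_eq_integral_exp_smul, Real.fourier_real_eq_integral_exp_smul, ← integral_conj,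
    ← integral_neg_eq_self, ← integral_const_mul]
  congr 1
  ext u
  simp only [smul_eq_mul, neg_neg, map_mul, ← Complex.exp_conj, Complex.conj_ofReal, Complex.conj_I]
  rw [mul_left_comm]
  congr 3
  push_cast
  ring

/-- If the Fourier transform of `A` agrees with a unimodular multiple of its own conjugate up to a
square-integrable error, then the mass of `|A|²` is controlled by its mass on a half-line. -/
theorem integral_norm_sq_le_of_fourier_conj {A : ℝ → ℂ} (hA : Integrable A) (hA2 : MemLp A 2)
    {η : ℂ} (hη : ‖η‖ = 1) {g : ℝ → ℝ} (hg : Integrable g)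
    (h : ∀ᵐ ξ, ‖𝓕 A ξ - η * conj (𝓕 A ξ)‖ ^ 2 ≤ g ξ) :
    ∫ u, ‖A u‖ ^ 2 ≤ 3 * (∫ u in Set.Iic 0, ‖A u‖ ^ 2) + 2 * ∫ ξ, g ξ := by
  set B : ℝ → ℂ := fun u => η * conj (A (-u)) with hBdef
  have hneg : MemLp (fun u => A (-u)) 2 :=
    hA2.comp_measurePreserving (Measure.measurePreserving_neg _)
  have hstar : MemLp (fun u => conj (A (-u))) 2 := hneg.star
  have hB2 : MemLp B 2 := hstar.const_mul η
  have hB : Integrable B := by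
    have h1 : Integrable fun u => conj (A (-u)) :=
      (Complex.conjCLE : ℂ →L[ℝ] ℂ).integrable_comp hA.comp_neg
    exact h1.const_mul η
  have hD : Integrable (A - B) := hA.sub hB
  have hD2 : MemLp (A - B) 2 := hA2.sub hB2
  have hF : ∀ ξ, 𝓕 (A - B) ξ = 𝓕 A ξ - η * conj (𝓕 A ξ) := by
    intro ξ
    rw [← fourier_const_mul_conj_comp_neg, Real.fourier_eq, Real.fourier_eq, Real.fourier_eq]
    rw [← integral_sub]
    · simp only [Pi.sub_apply, smul_sub, hBdef]
    · exact (Real.fourierIntegral_convergent_iff ξ).2 hA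
    · exact (Real.fourierIntegral_convergent_iff ξ).2 hB
  have hDint : ∫ u, ‖A u - B u‖ ^ 2 ≤ ∫ ξ, g ξ := by
    have e := integral_norm_sq_fourier_eq hD hD2
    simp only [Pi.sub_apply] at e
    rw [← e]
    refine integral_mono_of_nonneg (ae_of_all _ fun _ => by positivity) hg ?_
    filter_upwards [h] with ξ hξ
    rw [hF]
    exact hξ
  have iA := (memLp_two_iff_integrable_sq_norm hA2.1).1 hA2
  have iD := (memLp_two_iff_integrable_sq_norm hD2.1).1 hD2
  simp only [Pi.sub_apply] at iD
  have iN : Integrable fun u => ‖A (-u)‖ ^ 2 := iA.comp_neg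
  have key : ∫ u in Set.Ioi 0, ‖A u‖ ^ 2
      ≤ 2 * (∫ u in Set.Iic 0, ‖A u‖ ^ 2) + 2 * ∫ ξ, g ξ := by
    calc ∫ u in Set.Ioi 0, ‖A u‖ ^ 2
        ≤ ∫ u in Set.Ioi 0, (2 * ‖A (-u)‖ ^ 2 + 2 * ‖A u - B u‖ ^ 2) := by
          refine integral_mono iA.integrableOn
            ((iN.const_mul 2).add (iD.const_mul 2)).integrableOn fun u => ?_
          have hb : ‖B u‖ = ‖A (-u)‖ := by
            simp only [hBdef, norm_mul, hη, one_mul, RCLike.norm_conj]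
          have ht : ‖A u‖ ≤ ‖A (-u)‖ + ‖A u - B u‖ := by
            rw [← hb]
            simpa using norm_add_le (B u) (A u - B u)
          have h0 := norm_nonneg (A u)
          simp only
          nlinarith [sq_nonneg (‖A (-u)‖ - ‖A u - B u‖), norm_nonneg (A (-u)),
            norm_nonneg (A u - B u)]
      _ = 2 * (∫ u in Set.Ioi 0, ‖A (-u)‖ ^ 2) + 2 * ∫ u in Set.Ioi 0, ‖A u - B u‖ ^ 2 := by
          rw [integral_add (iN.const_mul 2).integrableOn (iD.const_mul 2).integrableOn,
            integral_const_mul, integral_const_mul]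
      _ ≤ _ := by
          have e := integral_comp_neg_Ioi (0 : ℝ) fun u => ‖A u‖ ^ 2
          rw [neg_zero] at e
          rw [e]
          have := (setIntegral_le_integral (s := Set.Ioi 0) iD
            (ae_of_all _ fun u => by positivity)).trans hDint
          linarith
  have hsplit := intervalIntegral.integral_Iic_add_Ioi (b := (0 : ℝ)) (μ := volume)
    (f := fun u => ‖A u‖ ^ 2) iA.integrableOn iA.integrableOn
  linarith

/-- The functional equation gives `H(s) cos(πs/2) = |ζ(s)|²/2` on the critical line. -/
theorem two_pi_cpow_mul_Gamma_mul_zeta_sq_mul_cos (t : ℝ) :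
    (2 * Real.pi : ℂ) ^ (-(1 / 2 + Complex.I * t)) * Complex.Gamma (1 / 2 + Complex.I * t)
      * riemannZeta (1 / 2 + Complex.I * t) ^ 2
      * Complex.cos (Real.pi * (1 / 2 + Complex.I * t) / 2)
      = (‖riemannZeta (1 / 2 + Complex.I * t)‖ ^ 2 / 2 : ℝ) := by
  set s : ℂ := 1 / 2 + Complex.I * t with hs
  have hre : s.re = 1 / 2 := by simp [hs]
  have h1 : (1 : ℂ) - s = conj s := by
    simp only [hs, map_add, map_mul, Complex.conj_I, Complex.conj_ofReal, map_div₀, map_one,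
      map_ofNat]
    ring
  have h := riemannZeta_one_sub (s := s)
    (fun n hn => by
      have := congrArg Complex.re hn
      rw [hre, Complex.neg_re, Complex.natCast_re] at this
      have : (0 : ℝ) ≤ n := n.cast_nonneg
      linarith)
    (fun h1 => by rw [h1] at hre; norm_num at hre)
  rw [h1, riemannZeta_conj] at h
  have h2 := Complex.mul_conj' (riemannZeta s)
  rw [h] at h2
  push_cast
  rw [← h2]
  ring

theorem norm_sub_I_mul_conj_sq {H : ℂ} {t R : ℝ}
    (hH : H * Complex.cos (Real.pi * (1 / 2 + Complex.I * t) / 2) = R) :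
    ‖H - Complex.I * conj H‖ ^ 2
      = 2 * Real.exp (-(Real.pi * t)) / Real.cosh (Real.pi * t) * ‖H‖ ^ 2 := by
  set w : ℂ := Real.pi * (1 / 2 + Complex.I * t) / 2 with hw
  have hc : conj (Complex.cos w) = Complex.sin w := by
    rw [← Complex.cos_conj, ← Complex.cos_pi_div_two_sub]
    congr 1
    simp only [hw, map_add, map_mul, Complex.conj_I, Complex.conj_ofReal, map_div₀, map_one,
      map_ofNat]
    ring
  have hH' : conj H * Complex.sin w = H * Complex.cos w := by
    have := congrArg conj hH
    rw [map_mul, hc, Complex.conj_ofReal] at this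
    rw [this, hH]
  have e1 : (H - Complex.I * conj H) * Complex.sin w
      = -Complex.I * H * Complex.exp (w * Complex.I) := by
    rw [Complex.exp_mul_I]
    linear_combination -Complex.I * hH' + H * Complex.sin w * Complex.I_sq
  have hexp : ‖Complex.exp (w * Complex.I)‖ ^ 2 = Real.exp (-(Real.pi * t)) := by
    rw [Complex.norm_exp, ← Real.exp_nat_mul]
    congr 1
    simp [hw]
    ring
  have hsin : ‖Complex.sin w‖ ^ 2 = Real.cosh (Real.pi * t) / 2 := by
    have h1 := Complex.mul_conj' (Complex.sin w)
    rw [← hc, Complex.conj_conj, hc] at h1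
    have h2 : Complex.sin (2 * w) = Real.cosh (Real.pi * t) := by
      rw [show 2 * w = Real.pi / 2 - (-(Real.pi * t : ℝ) : ℂ) * Complex.I by
        rw [hw]; push_cast; ring,
        Complex.sin_pi_div_two_sub, Complex.cos_mul_I, Complex.cosh_neg, Complex.ofReal_cosh]
    rw [Complex.sin_two_mul] at h2
    have h3 : ((‖Complex.sin w‖ ^ 2 : ℝ) : ℂ) = ((Real.cosh (Real.pi * t) / 2 : ℝ) : ℂ) := by
      push_cast at h1 h2 ⊢
      rw [← h1, ← h2]
      ring
    exact_mod_cast h3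
  have e2 := congrArg (fun z : ℂ => ‖z‖ ^ 2) e1
  simp only [norm_mul, mul_pow, hexp, hsin, norm_neg, Complex.norm_I, one_mul] at e2
  have := Real.cosh_pos (Real.pi * t)
  field_simp
  linarith

end Duality

section FourthMoment

open Filter Topology Asymptotics FourierTransform ComplexConjugate

theorem integral_norm_sq_dilationSum_le {ι : Type*} {J : Finset ι} {κ r : ι → ℝ} {a : ℕ → ℂ}
    {c : ℂ} {r₀ : ℝ} (hr₀ : 0 < r₀) (hr : ∀ j, r₀ ≤ r j)
    (hi : IntegrableOn (fun x : ℝ => ‖expSeries a (x * c)‖ ^ 2) (Set.Ioi r₀)) :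
    ∫ x in Set.Ioi 1, ‖dilationSum J κ r a c x‖ ^ 2
      ≤ (J.card * ∑ j ∈ J, κ j ^ 2) / r₀ * ∫ x in Set.Ioi r₀, ‖expSeries a ((x : ℝ) * c)‖ ^ 2 := by
  set g : ℝ → ℝ := fun x => ‖expSeries a (x * c)‖ ^ 2 with hg
  have hpos : ∀ j, 0 < r j := fun j => hr₀.trans_le (hr j)
  have hsub : ∀ j, Set.Ioi (r j * 1) ⊆ Set.Ioi r₀ := fun j =>
    Set.Ioi_subset_Ioi (by simpa using hr j)
  have hij : ∀ j, IntegrableOn (fun x => g (r j * x)) (Set.Ioi 1) := fun j =>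
    (integrableOn_Ioi_comp_mul_left_iff g 1 (hpos j)).2 (hi.mono_set (hsub j))
  have hle : ∀ j, ∫ x in Set.Ioi 1, g (r j * x) ≤ r₀⁻¹ * ∫ x in Set.Ioi r₀, g x := by
    intro j
    rw [integral_comp_mul_left_Ioi _ _ (hpos j), smul_eq_mul]
    refine mul_le_mul (inv_anti₀ hr₀ (hr j)) ?_ (integral_nonneg fun x => by positivity)
      (by positivity)
    exact setIntegral_mono_set hi (ae_of_all _ fun x => by positivity) (hsub j).eventuallyLE
  calc ∫ x in Set.Ioi 1, ‖dilationSum J κ r a c x‖ ^ 2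
      ≤ ∫ x in Set.Ioi 1, ∑ j ∈ J, J.card * κ j ^ 2 * g (r j * x) := by
        refine integral_mono_of_nonneg (ae_of_all _ fun x => by positivity)
          (integrable_finsetSum _ fun j _ => (hij j).const_mul _) (ae_of_all _ fun x => ?_)
        have h1 : ‖dilationSum J κ r a c x‖ ≤ ∑ j ∈ J, ‖(κ j : ℂ) * expSeries a ((r j * x : ℝ) * c)‖ :=
          norm_sum_le _ _
        refine (pow_le_pow_left₀ (norm_nonneg _) h1 2).trans (sq_sum_le_card_mul_sum_sq.trans ?_)
        rw [Finset.mul_sum]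
        refine le_of_eq (Finset.sum_congr rfl fun j _ => ?_)
        simp only [hg, norm_mul, mul_pow, Complex.norm_real, Real.norm_eq_abs, sq_abs]
        ring
    _ = ∑ j ∈ J, J.card * κ j ^ 2 * ∫ x in Set.Ioi 1, g (r j * x) := by
        rw [integral_finsetSum _ fun j _ => (hij j).const_mul _]
        simp_rw [integral_const_mul]
    _ ≤ ∑ j ∈ J, J.card * κ j ^ 2 * (r₀⁻¹ * ∫ x in Set.Ioi r₀, g x) :=
        Finset.sum_le_sum fun j _ => mul_le_mul_of_nonneg_left (hle j) (by positivity)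
    _ = _ := by
        rw [← Finset.sum_mul, ← Finset.mul_sum]
        ring

/-- The combination of dilates of `∑ d(n) exp(-nxc)`, `c = rayPoint δ`, that is bounded near `0`. -/
noncomputable def divisorDilation (δ : ℝ) : ℝ → ℂ :=
  dilationSum Finset.univ ![1, -6, 13, -12, 4] ![1 / 4, 1 / 2, 1, 2, 4]
    (fun n => (n.divisors.card : ℂ)) (rayPoint δ)

theorem quarter_le_dilation (j : Fin 5) : (1 / 4 : ℝ) ≤ ![1 / 4, 1 / 2, 1, 2, 4] j := by
  fin_cases j <;> norm_num [Matrix.cons_val]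

variable {δ : ℝ}

theorem continuousOn_divisorDilation (h0 : 0 < δ) (h1 : δ ≤ 1) :
    ContinuousOn (divisorDilation δ) (Set.Ioi 0) :=
  continuousOn_dilationSum norm_natCast_divisors_card_le (rayPoint_re_pos h0 h1)
    fun j => lt_of_lt_of_le (by norm_num) (quarter_le_dilation j)

theorem divisorDilation_isBigO_atTop (h0 : 0 < δ) (h1 : δ ≤ 1) :
    divisorDilation δ =O[atTop] fun x => Real.exp (-(1 / 4 * (rayPoint δ).re / 2) * x) :=
  dilationSum_isBigO_atTop norm_natCast_divisors_card_le (rayPoint_re_pos h0 h1) (by norm_num)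
    quarter_le_dilation

theorem divisorDilation_isBigO_zero (h0 : 0 < δ) (h1 : δ ≤ 1) :
    divisorDilation δ =O[𝓝[>] 0] fun _ => (1 : ℝ) := by
  have hre := rayPoint_re_pos h0 h1
  have him : 0 < (rayPoint δ).im := one_pos.trans_le (one_le_rayPoint_im h0 h1)
  have hn : 0 < ‖rayPoint δ‖ := norm_pos_iff.2 (rayPoint_ne_zero δ)
  set c := rayPoint δ with hc
  set M := ‖c‖ / ((1 - Real.exp (-(Real.pi / 2 * (c.re / c.im)))) ^ 2 * c.re) with hM
  refine IsBigO.of_bound (M + 2 * M + M) ?_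
  filter_upwards [Ioc_mem_nhdsGT (show (0 : ℝ) < 1 / ‖c‖ by positivity)] with x hx
  have hx0 : 0 < x := hx.1
  have hxc : x * ‖c‖ ≤ 1 := (le_div_iff₀ hn).1 hx.2
  have b1 := norm_expSeries_card_divisors_combination_le hre him hx0 hxc
  have b2 := norm_expSeries_card_divisors_combination_le hre him (x := 1 / 2 * x) (by positivity)
    (by nlinarith [mul_pos hx0 hn])
  have b3 := norm_expSeries_card_divisors_combination_le hre him (x := 1 / 4 * x) (by positivity)
    (by nlinarith [mul_pos hx0 hn])
  rw [← hM] at b1 b2 b3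
  set F := expSeries (fun n => (n.divisors.card : ℂ)) with hF
  rw [show 2 * (((1 / 2 * x : ℝ) : ℂ) * c) = x * c by push_cast; ring,
    show 4 * (((1 / 2 * x : ℝ) : ℂ) * c) = 2 * (x * c) by push_cast; ring] at b2
  rw [show 2 * (((1 / 4 * x : ℝ) : ℂ) * c) = (1 / 2 * x : ℝ) * c by push_cast; ring,
    show 4 * (((1 / 4 * x : ℝ) : ℂ) * c) = x * c by push_cast; ring] at b3
  have e : divisorDilation δ x
      = (F (x * c) - 4 * F (2 * (x * c)) + 4 * F (4 * (x * c)))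
        + -2 * (F ((1 / 2 * x : ℝ) * c) - 4 * F (x * c) + 4 * F (2 * (x * c)))
        + (F ((1 / 4 * x : ℝ) * c) - 4 * F ((1 / 2 * x : ℝ) * c) + 4 * F (x * c)) := by
    have e1 : ((1 * x : ℝ) : ℂ) * c = x * c := by push_cast; ring
    have e2 : ((2 * x : ℝ) : ℂ) * c = 2 * (x * c) := by push_cast; ring
    have e4 : ((4 * x : ℝ) : ℂ) * c = 4 * (x * c) := by push_cast; ring
    simp only [divisorDilation, dilationSum, Fin.sum_univ_five, Matrix.cons_val, ← hF, ← hc, e1,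
      e2, e4]
    push_cast
    ring
  rw [norm_one, mul_one, e]
  refine (norm_add₃_le).trans (add_le_add (add_le_add b1 ?_) b3)
  rw [norm_mul]
  refine mul_le_mul (by simp) b2 (norm_nonneg _) (by norm_num)

theorem divisorDilation_factor (t : ℝ) :
    ∑ j : Fin 5, ((![1, -6, 13, -12, 4] j : ℝ) : ℂ)
      * ((![1 / 4, 1 / 2, 1, 2, 4] j : ℝ) : ℂ) ^ (-(1 / 2 + Complex.I * t))
      = (‖(2 : ℂ) ^ (1 / 2 + Complex.I * t) - 1‖ ^ 4 : ℝ) := by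
  have hre : (1 / 2 + Complex.I * t : ℂ).re = 1 / 2 := by simp
  have hs : (1 : ℂ) - (1 / 2 + Complex.I * t) = conj (1 / 2 + Complex.I * t) := by
    simp only [map_add, map_mul, Complex.conj_I, Complex.conj_ofReal, map_div₀, map_one,
      map_ofNat]
    ring
  generalize (1 / 2 + Complex.I * t : ℂ) = s at hre hs
  have hw : conj ((2 : ℂ) ^ s) = 2 * (2 : ℂ) ^ (-s) := by
    have h := Complex.cpow_conj 2 s (by
      rw [Complex.ofNat_arg]
      exact Real.pi_pos.ne)
    rw [map_ofNat, ← hs, sub_eq_add_neg, Complex.cpow_add _ _ two_ne_zero, Complex.cpow_one] at h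
    exact h.symm
  have h4 : ((4 : ℝ) : ℂ) ^ (-s) = (2 : ℂ) ^ (-s) * (2 : ℂ) ^ (-s) := by
    have := Complex.mul_cpow_ofReal_nonneg (a := 2) (b := 2) (by norm_num) (by norm_num) (-s)
    rw [← Complex.ofReal_mul] at this
    norm_num at this ⊢
    exact this
  have h2 : ((1 / 2 : ℝ) : ℂ) ^ (-s) = (2 : ℂ) ^ s := by
    rw [one_div, Complex.ofReal_inv, Complex.inv_cpow _ _ (by
      rw [Complex.arg_ofReal_of_nonneg (by norm_num)]; exact Real.pi_pos.ne), Complex.cpow_neg,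
      inv_inv]
    simp
  have h1 : ((1 / 4 : ℝ) : ℂ) ^ (-s) = (2 : ℂ) ^ s * (2 : ℂ) ^ s := by
    have := Complex.mul_cpow_ofReal_nonneg (a := 1 / 2) (b := 1 / 2) (by norm_num) (by norm_num) (-s)
    rw [← Complex.ofReal_mul, h2] at this
    rw [← this]
    norm_num
  have hinv : (2 : ℂ) ^ s * (2 : ℂ) ^ (-s) = 1 := by
    rw [← Complex.cpow_add _ _ two_ne_zero]; simp
  have hn := Complex.mul_conj' ((2 : ℂ) ^ s - 1)
  rw [map_sub, map_one, hw] at hn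
  simp only [Fin.sum_univ_five, Matrix.cons_val, h1, h2, h4, Complex.ofReal_one, Complex.one_cpow]
  rw [show ‖(2 : ℂ) ^ s - 1‖ ^ 4 = ‖(2 : ℂ) ^ s - 1‖ ^ 2 * ‖(2 : ℂ) ^ s - 1‖ ^ 2 by ring]
  push_cast
  rw [← hn]
  generalize (2 : ℂ) ^ s = w at *
  generalize (2 : ℂ) ^ (-s) = v at *
  linear_combination (-(4 : ℂ) * (w * v) + 8 * v + 4 * w - 12) * hinv

end FourthMoment

section FourthMoment

open Filter Topology Asymptotics FourierTransform ComplexConjugate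

variable {δ : ℝ}

theorem mellin_divisorDilation (h0 : 0 < δ) (h1 : δ ≤ 1) {t : ℝ} (ht : t ≠ 0) :
    mellin (divisorDilation δ) (1 / 2 + Complex.I * t)
      = Complex.Gamma (1 / 2 + Complex.I * t) * rayPoint δ ^ (-(1 / 2 + Complex.I * t))
        * riemannZeta (1 / 2 + Complex.I * t) ^ 2
        * (‖(2 : ℂ) ^ (1 / 2 + Complex.I * t) - 1‖ ^ 4 : ℝ) := by
  rw [← divisorDilation_factor]
  exact dilationSum_mellin_eq (L := fun s => riemannZeta s ^ 2) norm_natCast_divisors_card_le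
    (rayPoint_re_pos h0 h1) (by norm_num) quarter_le_dilation (divisorDilation_isBigO_zero h0 h1)
    (fun s hs => (differentiableAt_riemannZeta hs).pow 2) (fun s hs => LSeries_card_divisors hs)
    (by simp) (by simpa using ht)

/-- `(2π)^{-s} Γ(s) ζ(s)²` at `s = 1/2 + it`. -/
noncomputable def zetaSqKernel (t : ℝ) : ℂ :=
  (2 * Real.pi : ℂ) ^ (-(1 / 2 + Complex.I * t)) * Complex.Gamma (1 / 2 + Complex.I * t)
    * riemannZeta (1 / 2 + Complex.I * t) ^ 2

theorem mellin_divisorDilation_eq_zetaSqKernel (h0 : 0 < δ) (h1 : δ ≤ 1) {t : ℝ} (ht : t ≠ 0) :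
    mellin (divisorDilation δ) (1 / 2 + Complex.I * t)
      = (Real.exp ((Real.pi / 2 - δ) * t) * ‖(2 : ℂ) ^ (1 / 2 + Complex.I * t) - 1‖ ^ 4 : ℝ)
        * Complex.exp ((-((Real.pi / 2 - δ) / 2) : ℝ) * Complex.I) * zetaSqKernel t := by
  rw [mellin_divisorDilation h0 h1 ht, rayPoint_cpow h0 h1, zetaSqKernel]
  have h : -((1 / 2 + Complex.I * t) * ((Real.pi / 2 - δ : ℝ) * Complex.I))
      = ((Real.pi / 2 - δ) * t : ℝ) + (-((Real.pi / 2 - δ) / 2) : ℝ) * Complex.I := by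
    push_cast
    linear_combination -((Real.pi / 2 - δ) * t : ℂ) * Complex.I_sq
  rw [h, Complex.exp_add]
  push_cast
  ring

theorem norm_mellin_divisorDilation_sub_conj_sq_le (h0 : 0 < δ) (h1 : δ ≤ 1) {t : ℝ}
    (ht : t ≠ 0) :
    ‖mellin (divisorDilation δ) (1 / 2 + Complex.I * t)
        - Complex.I * Complex.exp ((-((Real.pi / 2 - δ) / 2) : ℝ) * Complex.I) ^ 2
          * conj (mellin (divisorDilation δ) (1 / 2 + Complex.I * t))‖ ^ 2
      ≤ 4 * ‖mellin (divisorDilation 1) (1 / 2 + Complex.I * t)‖ ^ 2 := by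
  rw [mellin_divisorDilation_eq_zetaSqKernel h0 h1 ht,
    mellin_divisorDilation_eq_zetaSqKernel one_pos le_rfl ht]
  set N := ‖(2 : ℂ) ^ (1 / 2 + Complex.I * t) - 1‖ ^ 4
  set H := zetaSqKernel t with hH
  have hε : ∀ x : ℝ, ‖Complex.exp (x * Complex.I)‖ = 1 := Complex.norm_exp_ofReal_mul_I
  have hu := hε (-((Real.pi / 2 - δ) / 2))
  set ε := Complex.exp ((-((Real.pi / 2 - δ) / 2) : ℝ) * Complex.I)
  have hεε : ε * conj ε = 1 := by rw [Complex.mul_conj', hu]; simp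
  have e : ((Real.exp ((Real.pi / 2 - δ) * t) * N : ℝ) : ℂ) * ε * H
      - Complex.I * ε ^ 2 * conj (((Real.exp ((Real.pi / 2 - δ) * t) * N : ℝ) : ℂ) * ε * H)
      = ((Real.exp ((Real.pi / 2 - δ) * t) * N : ℝ) : ℂ) * ε * (H - Complex.I * conj H) := by
    rw [map_mul, map_mul, Complex.conj_ofReal]
    linear_combination -(((Real.exp ((Real.pi / 2 - δ) * t) * N : ℝ) : ℂ) * ε * Complex.I
      * conj H) * hεε
  have hd := norm_sub_I_mul_conj_sq (two_pi_cpow_mul_Gamma_mul_zeta_sq_mul_cos t)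
  rw [← zetaSqKernel, ← hH] at hd
  have hsq : ∀ y : ℝ, Real.exp (y * t) ^ 2 = Real.exp (2 * y * t) := fun y => by
    rw [← Real.exp_nat_mul]; push_cast; ring_nf
  rw [e]
  simp only [norm_mul, mul_pow, hu, hε, hd, Complex.norm_real, Real.norm_eq_abs, sq_abs,
    mul_one, hsq]
  have hcosh : Real.exp (Real.pi * |t|) ≤ 2 * Real.cosh (Real.pi * t) := by
    rw [Real.cosh_eq]
    rcases abs_cases t with ⟨h, -⟩ | ⟨h, -⟩ <;> rw [h]
    · linarith [Real.exp_pos (-(Real.pi * t))]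
    · rw [mul_neg]
      linarith [Real.exp_pos (Real.pi * t)]
  have hmain : Real.exp (2 * (Real.pi / 2 - δ) * t) *
      (2 * Real.exp (-(Real.pi * t)) / Real.cosh (Real.pi * t))
      ≤ 4 * Real.exp (2 * (Real.pi / 2 - 1) * t) := by
    rw [mul_div_assoc', div_le_iff₀ (Real.cosh_pos _)]
    have h2 : Real.exp (2 * (Real.pi / 2 - δ) * t) * Real.exp (-(Real.pi * t))
        ≤ Real.exp (2 * (Real.pi / 2 - 1) * t) * Real.exp (Real.pi * |t|) := by
      rw [← Real.exp_add, ← Real.exp_add]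
      refine Real.exp_le_exp.2 ?_
      have hπ := Real.pi_gt_three
      rcases abs_cases t with ⟨h, h'⟩ | ⟨h, h'⟩ <;> rw [h] <;> nlinarith
    nlinarith [mul_le_mul_of_nonneg_left hcosh
      (Real.exp_pos (2 * (Real.pi / 2 - 1) * t)).le]
  calc _ = Real.exp (2 * (Real.pi / 2 - δ) * t) *
        (2 * Real.exp (-(Real.pi * t)) / Real.cosh (Real.pi * t)) * (N ^ 2 * ‖H‖ ^ 2) := by ring
    _ ≤ 4 * Real.exp (2 * (Real.pi / 2 - 1) * t) * (N ^ 2 * ‖H‖ ^ 2) :=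
        mul_le_mul_of_nonneg_right hmain (by positivity)
    _ = _ := by ring

theorem integral_norm_sq_divisorDilation_le (h0 : 0 < δ) (h1 : δ ≤ 1) :
    ∫ x in Set.Ioi 0, ‖divisorDilation δ x‖ ^ 2
      ≤ 3 * (∫ x in Set.Ioi 1, ‖divisorDilation δ x‖ ^ 2)
        + 8 * ∫ x in Set.Ioi 0, ‖divisorDilation 1 x‖ ^ 2 := by
  have hb : ∀ {δ : ℝ}, 0 < δ → δ ≤ 1 → 0 < 1 / 4 * (rayPoint δ).re / 2 := fun h0 h1 => by
    have := rayPoint_re_pos h0 h1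
    positivity
  have hi : ∀ {δ : ℝ}, 0 < δ → δ ≤ 1 → Integrable (logPullback (divisorDilation δ)) :=
    fun h0 h1 => integrable_logPullback (hb h0 h1) (continuousOn_divisorDilation h0 h1)
      (divisorDilation_isBigO_atTop h0 h1) (divisorDilation_isBigO_zero h0 h1)
  have hL : ∀ {δ : ℝ}, 0 < δ → δ ≤ 1 → MemLp (logPullback (divisorDilation δ)) 2 :=
    fun h0 h1 => memLp_logPullback (hb h0 h1) (continuousOn_divisorDilation h0 h1)
      (divisorDilation_isBigO_atTop h0 h1) (divisorDilation_isBigO_zero h0 h1)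
  have hF := memLp_fourier (hi one_pos le_rfl) (hL one_pos le_rfl)
  have hFi := (memLp_two_iff_integrable_sq_norm hF.1).1 hF
  have huniv : ∀ δ : ℝ, ∫ u, ‖logPullback (divisorDilation δ) u‖ ^ 2
      = ∫ x in Set.Ioi 0, ‖divisorDilation δ x‖ ^ 2 := fun δ => by
    rw [← image_exp_neg_univ, ← setIntegral_norm_logPullback_sq _ MeasurableSet.univ,
      Measure.restrict_univ]
  have h := integral_norm_sq_le_of_fourier_conj (hi h0 h1) (hL h0 h1)
    (η := Complex.I * Complex.exp ((-((Real.pi / 2 - δ) / 2) : ℝ) * Complex.I) ^ 2)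
    (by rw [norm_mul, norm_pow, Complex.norm_exp_ofReal_mul_I, Complex.norm_I]; norm_num)
    (hFi.const_mul 4)
    (by
      filter_upwards [Measure.ae_ne volume (0 : ℝ)] with ξ hξ
      rw [fourier_logPullback, fourier_logPullback]
      exact norm_mellin_divisorDilation_sub_conj_sq_le h0 h1
        (mul_ne_zero (by positivity) hξ))
  rw [integral_const_mul, integral_norm_sq_fourier_eq (hi one_pos le_rfl) (hL one_pos le_rfl),
    huniv, huniv, integral_Iic_eq_integral_Iio,
    setIntegral_norm_logPullback_sq _ measurableSet_Iio, image_exp_neg_Iio] at h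
  linarith

theorem integral_Ioi_one_norm_sq_divisorDilation_le {T : ℝ} (hT : 4 ≤ T) :
    ∫ x in Set.Ioi 1, ‖divisorDilation T⁻¹ x‖ ^ 2 ≤ 16865280 * (T * Real.log T ^ 4) := by
  have hT0 : 0 < T := by linarith
  have hδ0 : 0 < T⁻¹ := inv_pos.2 hT0
  have hδ1 : T⁻¹ ≤ 1 := inv_le_one_of_one_le₀ (by linarith)
  have hre := rayPoint_re_pos hδ0 hδ1
  have hre' := le_rayPoint_re hδ0 hδ1
  have him := one_le_rayPoint_im hδ0 hδ1
  have hlog : 0 ≤ Real.log T := Real.log_nonneg (by linarith)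
  obtain ⟨hi, h⟩ := integral_norm_sq_expSeries_le norm_natCast_divisors_card_le hre
    (by linarith) (show (0 : ℝ) < 1 / 4 by norm_num)
    (meanSquareBound_card_divisors_le hre (by linarith) (by norm_num))
  have hd := integral_norm_sq_dilationSum_le (J := Finset.univ) (κ := ![1, -6, 13, -12, 4])
    (by norm_num) quarter_le_dilation hi
  refine hd.trans ?_
  set c := rayPoint T⁻¹
  have l1 : -Real.log (1 - Real.exp (-(1 / 4 * c.re / 12))) ≤ 4 * Real.log T := by
    have hη : 0 < T⁻¹ / 12 := by positivity
    refine (neg_log_one_sub_exp_antitone hη (by linarith)).trans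
      ((neg_log_one_sub_exp_le hη (by linarith)).trans ?_)
    rw [← Real.log_rpow hT0]
    refine Real.log_le_log (by positivity) ?_
    norm_num
    field_simp
    nlinarith [mul_le_mul hT hT (by norm_num) hT0.le, pow_le_pow_left₀ (by norm_num) hT 3]
  have l2 : 1 / c.re + 8 / (1 / 4 * c.re * c.im) ≤ 9 * T := by
    have e1 : 1 / c.re ≤ T / 4 := by
      rw [div_le_div_iff₀ hre (by norm_num)]
      have := mul_le_mul_of_nonneg_left hre' hT0.le
      rw [mul_left_comm, mul_inv_cancel₀ hT0.ne'] at this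
      linarith
    have e2 : 8 / (1 / 4 * c.re * c.im) ≤ 32 * (1 / c.re) := by
      rw [mul_one_div, div_le_div_iff₀ (by positivity) hre]
      nlinarith
    linarith
  have l0 : 0 ≤ -Real.log (1 - Real.exp (-(1 / 4 * c.re / 12))) :=
    neg_log_one_sub_exp_nonneg (by positivity)
  have h' := h.trans (mul_le_mul (pow_le_pow_left₀ l0 l1 4) l2 (by positivity) (by positivity))
  have hκ : (((Finset.univ : Finset (Fin 5)).card : ℝ) *
      ∑ j : Fin 5, (![1, -6, 13, -12, 4] : Fin 5 → ℝ) j ^ 2) / (1 / 4) = 7320 := by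
    simp only [Fin.sum_univ_five, Matrix.cons_val, Finset.card_univ, Fintype.card_fin]
    norm_num
  rw [hκ]
  linarith

theorem integral_norm_zeta_pow_four_le : ∃ C > (0 : ℝ), ∀ T : ℝ, 4 ≤ T →
    ∫ t in T..(2 * T), ‖riemannZeta (1 / 2 + Complex.I * t)‖ ^ 4
      ≤ C * (T * Real.log T ^ 4) := by
  set C₀ := ∫ x in Set.Ioi 0, ‖divisorDilation 1 x‖ ^ 2 with hC₀
  have hC₀0 : 0 ≤ C₀ := integral_nonneg fun x => by positivity
  refine ⟨4 * Real.pi * Real.exp 4 / ((2 / 5) ^ 4) ^ 2 * (3 * 16865280 + 8 * C₀), by positivity,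
    fun T hT => ?_⟩
  have hT0 : 0 < T := by linarith
  have hδ0 : 0 < T⁻¹ := inv_pos.2 hT0
  have hδ1 : T⁻¹ ≤ 1 := inv_le_one_of_one_le₀ (by linarith)
  have hre := rayPoint_re_pos hδ0 hδ1
  have hlog : 1 ≤ Real.log T := by
    rw [Real.le_log_iff_exp_le hT0]
    linarith [Real.exp_one_lt_d9]
  have h := intervalIntegral_norm_sq_le_of_mellin_eq
    (show 0 < 1 / 4 * (rayPoint T⁻¹).re / 2 by positivity) (continuousOn_divisorDilation hδ0 hδ1)
    (divisorDilation_isBigO_atTop hδ0 hδ1) (divisorDilation_isBigO_zero hδ0 hδ1)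
    (T := T) (by linarith) (f := fun t => riemannZeta (1 / 2 + Complex.I * t) ^ 2)
    (q := fun t => (‖(2 : ℂ) ^ (1 / 2 + Complex.I * t) - 1‖ ^ 4 : ℝ)) (m := (2 / 5) ^ 4)
    (by norm_num)
    (fun t => by
      rw [Complex.norm_real, Real.norm_eq_abs, abs_of_nonneg (by positivity)]
      exact pow_le_pow_left₀ (by norm_num) (le_norm_one_sub_two_cpow (by simp)) 4)
    (fun t ht => mellin_divisorDilation hδ0 hδ1 ht.ne')
  simp_rw [norm_pow, ← pow_mul] at h
  refine h.trans ?_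
  rw [mul_assoc _ (_ + _ : ℝ), pow_mul]
  refine mul_le_mul_of_nonneg_left ?_ (by positivity)
  refine (integral_norm_sq_divisorDilation_le hδ0 hδ1).trans ?_
  have h1 := integral_Ioi_one_norm_sq_divisorDilation_le hT
  have h2 : 1 ≤ T * Real.log T ^ 4 :=
    one_le_mul_of_one_le_of_one_le (by linarith) (one_le_pow₀ hlog)
  rw [← hC₀]
  nlinarith

end FourthMoment

section CubicMoment

theorem norm_eTheta_le_one (t : ℝ) : ‖eTheta t‖ ≤ 1 := by
  rw [eTheta, norm_mul, Complex.norm_cpow_eq_rpow_re_of_pos Real.pi_pos, norm_div, Complex.norm_real,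
    norm_norm]
  have h : (-(Complex.I * (t : ℂ)) / 2).re = 0 := by simp
  rw [h, Real.rpow_zero, one_mul]
  exact div_self_le_one _

theorem abs_HardyZ_le (t : ℝ) : |HardyZ t| ≤ ‖riemannZeta (1 / 2 + Complex.I * (t : ℂ))‖ := by
  refine (Complex.abs_re_le_norm _).trans ?_
  rw [norm_mul]
  exact mul_le_of_le_one_left (norm_nonneg _) (norm_eTheta_le_one t)

theorem continuous_riemannZeta_half : Continuous fun t : ℝ => riemannZeta (1 / 2 + Complex.I * t) := by
  refine continuous_iff_continuousAt.2 fun t => ?_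
  have h : (1 / 2 + Complex.I * t : ℂ) ≠ 1 := fun h => by
    have := congrArg Complex.re h
    norm_num at this
  exact ContinuousAt.comp (f := fun t : ℝ => (1 / 2 + Complex.I * t : ℂ))
    (differentiableAt_riemannZeta h).continuousAt (by fun_prop)

theorem pow_three_le_of_pos {y z : ℝ} (hy : 0 < y) :
    z ^ 3 ≤ y / 2 * z ^ 2 + 1 / (2 * y) * z ^ 4 := by
  have h : y / 2 * z ^ 2 + 1 / (2 * y) * z ^ 4 - z ^ 3 = z ^ 2 * (y - z) ^ 2 / (2 * y) := by
    field_simp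
    ring
  have : 0 ≤ z ^ 2 * (y - z) ^ 2 / (2 * y) := by positivity
  linarith

end CubicMoment

theorem cubic_moment_Z_bound :
    ∃ C > (0 : ℝ), ∃ T₀ : ℝ, ∀ T ≥ T₀,
      |∫ t in T..(2 * T), (HardyZ t) ^ 3| ≤ C * T * (Real.log T) ^ ((5 : ℝ) / 2) := by
  obtain ⟨C₁, hC₁, h₁⟩ := integral_norm_zeta_sq_le
  obtain ⟨C₂, hC₂, h₂⟩ := integral_norm_zeta_pow_four_le
  refine ⟨(C₁ + C₂) / 2, by positivity, 4, fun T hT => ?_⟩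
  have hL : 0 < Real.log T := Real.log_pos (by linarith)
  set L := Real.log T with hLdef
  set y : ℝ := L ^ ((3 : ℝ) / 2) with hy
  have hy0 : 0 < y := Real.rpow_pos_of_pos hL _
  set z : ℝ → ℝ := fun t => ‖riemannZeta (1 / 2 + Complex.I * t)‖ with hz
  have hzc : Continuous z := continuous_riemannZeta_half.norm
  have i₁ : IntervalIntegrable (fun t => y / 2 * z t ^ 2) volume T (2 * T) :=
    Continuous.intervalIntegrable (by fun_prop) _ _
  have i₂ : IntervalIntegrable (fun t => 1 / (2 * y) * z t ^ 4) volume T (2 * T) :=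
    Continuous.intervalIntegrable (by fun_prop) _ _
  have hle := intervalIntegral.norm_integral_le_of_norm_le (f := fun t => HardyZ t ^ 3)
    (show T ≤ 2 * T by linarith)
    (ae_of_all volume fun t _ => by
      rw [norm_pow, Real.norm_eq_abs]
      exact (pow_le_pow_left₀ (abs_nonneg _) (abs_HardyZ_le t) 3).trans
        (pow_three_le_of_pos hy0))
    (i₁.add i₂)
  rw [intervalIntegral.integral_add i₁ i₂, intervalIntegral.integral_const_mul,
    intervalIntegral.integral_const_mul, Real.norm_eq_abs] at hle
  have e₁ : y * L = L ^ ((5 : ℝ) / 2) := by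
    rw [hy, ← Real.rpow_add_one hL.ne']
    norm_num
  have e₂ : L ^ 4 / y = L ^ ((5 : ℝ) / 2) := by
    rw [hy, ← Real.rpow_natCast, ← Real.rpow_sub hL]
    norm_num
  calc _ ≤ y / 2 * (C₁ * (T * L)) + 1 / (2 * y) * (C₂ * (T * L ^ 4)) :=
        hle.trans (add_le_add (mul_le_mul_of_nonneg_left (h₁ T hT) (by positivity))
          (mul_le_mul_of_nonneg_left (h₂ T hT) (by positivity)))
    _ = C₁ / 2 * T * (y * L) + C₂ / 2 * T * (L ^ 4 / y) := by ring
    _ = _ := by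
        rw [e₁, e₂]
        ring
end

section
/- The Riemann zeta-function has infinitely many zeros on the critical line Re s = 1/2; equivalently, Hardy's function Z(t) has infinitely many real zeros, i.e. for every T_0 there exists t > T_0 with Z(t) = 0. -/
open MeasureTheory

/-- Jacobi's theta function in the variable `w` (with `0 < re w`), minus its leading terms as
`w → ∞` and as `w → 0`. -/
noncomputable def thetaRemainder (w : ℂ) : ℂ :=
  jacobiTheta (Complex.I * w) - 1 - w ^ (-(1 / 2) : ℂ)

lemma jacobiTheta_I_mul_eq {w : ℂ} (hw : 0 < w.re) :
    jacobiTheta (Complex.I * w) = w ^ (-(1 / 2) : ℂ) * jacobiTheta (Complex.I * w⁻¹) := by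
  have hw0 : w ≠ 0 := by rintro rfl; simp at hw
  simp only [jacobiTheta_eq_jacobiTheta₂]
  rw [jacobiTheta₂_functional_equation]
  have h1 : -Complex.I * (Complex.I * w) = w := by
    rw [← mul_assoc, neg_mul, Complex.I_mul_I]; ring
  have h2 : -1 / (Complex.I * w) = Complex.I * w⁻¹ := by
    field_simp
    simp
  rw [h1, h2, Complex.cpow_neg]
  simp

lemma thetaRemainder_eq_mul_inv {w : ℂ} (hw : 0 < w.re) :
    thetaRemainder w = w ^ (-(1 / 2) : ℂ) * thetaRemainder w⁻¹ := by
  have hw0 : w ≠ 0 := by rintro rfl; simp at hw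
  have harg : w.arg ≠ Real.pi := by
    have := Complex.abs_arg_lt_pi_div_two_iff.mpr (Or.inl hw)
    intro h
    rw [h, abs_of_pos Real.pi_pos] at this
    linarith [Real.pi_pos]
  have hc : w ^ (1 / 2 : ℂ) ≠ 0 := by simp [Complex.cpow_eq_zero_iff, hw0]
  rw [thetaRemainder, thetaRemainder, jacobiTheta_I_mul_eq hw, Complex.inv_cpow _ _ harg,
    Complex.cpow_neg, inv_inv]
  field_simp
  ring

lemma differentiableAt_thetaRemainder {w : ℂ} (hw : 0 < w.re) :
    DifferentiableAt ℂ thetaRemainder w := by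
  have h1 : DifferentiableAt ℂ (fun w : ℂ ↦ jacobiTheta (Complex.I * w)) w :=
    (differentiableAt_jacobiTheta (τ := Complex.I * w) (by simpa using hw)).comp w
      (differentiableAt_id.const_mul _)
  have h2 : DifferentiableAt ℂ (fun w : ℂ ↦ w ^ (-(1 / 2) : ℂ)) w :=
    differentiableAt_id.cpow_const (Or.inl hw)
  exact (h1.sub_const 1).sub h2

lemma norm_cpow_neg_half {w : ℂ} (hw : w ≠ 0) :
    ‖w ^ (-(1 / 2) : ℂ)‖ = ‖w‖ ^ (-(1 / 2) : ℝ) := by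
  rw [Complex.norm_cpow_of_ne_zero hw]
  norm_num

lemma mul_exp_neg_le_rpow {b : ℝ} (hb : 0 < b) :
    ∃ C : ℝ, 0 ≤ C ∧ ∀ r : ℝ, 1 ≤ r → Real.exp (-(b * r)) ≤ C * r ^ (-(1 / 2) : ℝ) := by
  refine ⟨1 / b, by positivity, fun r hr ↦ ?_⟩
  have hr0 : 0 < r := by linarith
  have h1 : Real.exp (-(b * r)) ≤ 1 / (b * r) := by
    rw [Real.exp_neg, ← one_div]
    exact one_div_le_one_div_of_le (by positivity) (by linarith [Real.add_one_le_exp (b * r)])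
  have h2 : r⁻¹ ≤ r ^ (-(1 / 2) : ℝ) := by
    rw [← Real.rpow_neg_one]
    exact Real.rpow_le_rpow_of_exponent_le hr (by norm_num)
  calc _ ≤ 1 / (b * r) := h1
    _ = 1 / b * r⁻¹ := by field_simp
    _ ≤ _ := by gcongr

/-- Bound for `thetaRemainder` in a sector strictly inside the right half plane. -/
lemma exists_norm_thetaRemainder_le {a : ℝ} (ha : 0 < a) :
    ∃ C : ℝ, 0 ≤ C ∧ ∀ w : ℂ, w ≠ 0 → a * ‖w‖ ≤ w.re →
      ‖thetaRemainder w‖ ≤ C * min 1 (‖w‖ ^ (-(1 / 2) : ℝ)) := by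
  obtain ⟨C₁, hC₁, h₁⟩ := mul_exp_neg_le_rpow (mul_pos Real.pi_pos ha)
  set q := Real.exp (-(Real.pi * a)) with hq
  have hq1 : q < 1 := Real.exp_lt_one_iff.mpr (by have := mul_pos Real.pi_pos ha; linarith)
  have hq2 : 0 < 1 - q := by linarith
  set C := 2 / (1 - q) * C₁ + 1 with hC
  have hC0 : 0 ≤ C := by positivity
  have large : ∀ w : ℂ, 1 ≤ ‖w‖ → a * ‖w‖ ≤ w.re →
      ‖thetaRemainder w‖ ≤ C * ‖w‖ ^ (-(1 / 2) : ℝ) := by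
    intro w hw hwa
    have hre : 0 < w.re := by nlinarith
    have hw0 : w ≠ 0 := by rintro rfl; simp at hre
    have h2 := norm_jacobiTheta_sub_one_le (τ := Complex.I * w) (by simpa using hre)
    have h3 : Real.exp (-Real.pi * (Complex.I * w).im) ≤ Real.exp (-(Real.pi * a * ‖w‖)) := by
      apply Real.exp_le_exp.mpr
      have : Real.pi * (a * ‖w‖) ≤ Real.pi * w.re := by gcongr
      simp only [Complex.mul_im, Complex.I_re, Complex.I_im, zero_mul, one_mul, zero_add]
      linarith
    have h4 : Real.exp (-(Real.pi * a * ‖w‖)) ≤ q := by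
      apply Real.exp_le_exp.mpr
      have : Real.pi * a * 1 ≤ Real.pi * a * ‖w‖ := by gcongr
      linarith
    have h5 : ‖jacobiTheta (Complex.I * w) - 1‖ ≤ 2 / (1 - q) * (C₁ * ‖w‖ ^ (-(1 / 2) : ℝ)) := by
      refine h2.trans ?_
      gcongr
      · exact h3.trans h4
      · exact h3.trans (h₁ _ hw)
    calc ‖thetaRemainder w‖ ≤ ‖jacobiTheta (Complex.I * w) - 1‖ + ‖w ^ (-(1 / 2) : ℂ)‖ :=
          norm_sub_le _ _
      _ ≤ 2 / (1 - q) * (C₁ * ‖w‖ ^ (-(1 / 2) : ℝ)) + ‖w‖ ^ (-(1 / 2) : ℝ) := by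
          rw [norm_cpow_neg_half hw0]
          gcongr
      _ = _ := by rw [hC]; ring
  refine ⟨C, hC0, fun w hw0 hwa ↦ ?_⟩
  have hn : 0 < ‖w‖ := norm_pos_iff.mpr hw0
  rcases le_total 1 ‖w‖ with hw | hw
  · rw [min_eq_right (Real.rpow_le_one_of_one_le_of_nonpos hw (by norm_num))]
    exact large w hw hwa
  · rw [min_eq_left (Real.one_le_rpow_of_pos_of_le_one_of_nonpos hn hw (by norm_num))]
    have hre : 0 < w.re := lt_of_lt_of_le (by positivity) hwa
    rw [thetaRemainder_eq_mul_inv hre, norm_mul, norm_cpow_neg_half hw0]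
    have := large w⁻¹ (by rw [norm_inv]; exact (one_le_inv₀ hn).mpr hw) (by
      rw [norm_inv, Complex.inv_re, Complex.normSq_eq_norm_sq]
      rw [le_div_iff₀ (by positivity)]
      calc a * ‖w‖⁻¹ * ‖w‖ ^ 2 = a * ‖w‖ := by field_simp
        _ ≤ _ := hwa)
    calc _ ≤ ‖w‖ ^ (-(1 / 2) : ℝ) * (C * ‖w⁻¹‖ ^ (-(1 / 2) : ℝ)) := by gcongr
      _ = C * 1 := by
        rw [norm_inv, Real.inv_rpow hn.le]
        have : ‖w‖ ^ (-(1 / 2) : ℝ) ≠ 0 := by positivity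
        field_simp

lemma jacobiTheta_add_one {τ : ℂ} (hτ : 0 < τ.im) :
    jacobiTheta (τ + 1) = 2 * jacobiTheta (4 * τ) - jacobiTheta τ := by
  have key (σ : ℂ) (hσ : 0 < σ.im) :
      HasSum (fun n : ℤ ↦ Complex.exp (Real.pi * Complex.I * (n : ℂ) ^ 2 * σ)) (jacobiTheta σ) := by
    have := hasSum_jacobiTheta₂_term 0 hσ
    rw [← jacobiTheta_eq_jacobiTheta₂] at this
    simpa [jacobiTheta₂_term] using this
  have h1 := (key (τ + 1) (by simpa using hτ)).add (key τ hτ)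
  have h2 := (key (4 * τ) (by simpa using hτ)).mul_left 2
  have hinj : Function.Injective (fun n : ℤ ↦ 2 * n) := fun a b h ↦ by simpa using h
  have hexp (n : ℤ) : Complex.exp (Real.pi * Complex.I * (n : ℂ) ^ 2 * (τ + 1)) =
      (-1) ^ (n ^ 2).natAbs * Complex.exp (Real.pi * Complex.I * (n : ℂ) ^ 2 * τ) := by
    rw [mul_add, Complex.exp_add, mul_comm]
    congr 1
    rw [mul_one, mul_comm, ← Complex.exp_pi_mul_I, ← Complex.exp_nat_mul]
    congr 2
    rw [Nat.cast_natAbs, abs_of_nonneg (sq_nonneg n)]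
    push_cast
    ring
  have heven (n : ℤ) :
      Complex.exp (Real.pi * Complex.I * ((2 * n : ℤ) : ℂ) ^ 2 * (τ + 1)) +
        Complex.exp (Real.pi * Complex.I * ((2 * n : ℤ) : ℂ) ^ 2 * τ) =
      2 * Complex.exp (Real.pi * Complex.I * (n : ℂ) ^ 2 * (4 * τ)) := by
    have : Even ((2 * n) ^ 2).natAbs := Int.natAbs_even.mpr (by simp [Int.even_pow])
    rw [hexp, this.neg_one_pow, one_mul, ← two_mul]
    congr 2
    push_cast
    ring
  have h3 := (hinj.hasSum_iff (f := fun n : ℤ ↦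
      Complex.exp (Real.pi * Complex.I * (n : ℂ) ^ 2 * (τ + 1)) +
      Complex.exp (Real.pi * Complex.I * (n : ℂ) ^ 2 * τ)) (a := 2 * jacobiTheta (4 * τ)) (by
    intro n hn
    have hodd : Odd n := by
      rw [← Int.not_even_iff_odd]
      rintro ⟨k, hk⟩
      exact hn ⟨k, by simp [hk, two_mul]⟩
    have : Odd (n ^ 2).natAbs := Int.natAbs_odd.mpr hodd.pow
    simp only [hexp, this.neg_one_pow]
    ring)).mp (by
    simpa only [Function.comp_def, heven] using h2)
  linear_combination h1.unique h3

lemma real_mul_cpow {r : ℝ} (hr : 0 < r) {z : ℂ} (hz : z ≠ 0) (c : ℂ) :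
    ((r : ℂ) * z) ^ c = (r : ℂ) ^ c * z ^ c := by
  have hr0 : (r : ℂ) ≠ 0 := by exact_mod_cast hr.ne'
  rw [Complex.cpow_def_of_ne_zero (mul_ne_zero hr0 hz), Complex.cpow_def_of_ne_zero hr0,
    Complex.cpow_def_of_ne_zero hz, Complex.log_ofReal_mul hr hz, Complex.ofReal_log hr.le,
    add_mul, Complex.exp_add]

lemma jacobiTheta_neg_one_div {τ : ℂ} (hτ : 0 < τ.im) :
    jacobiTheta (-1 / τ) = (-Complex.I * τ) ^ (1 / 2 : ℂ) * jacobiTheta τ := by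
  have hτ0 : τ ≠ 0 := by rintro rfl; simp at hτ
  have h := jacobiTheta_I_mul_eq (w := -Complex.I * τ) (by simpa using hτ)
  have h1 : Complex.I * (-Complex.I * τ) = τ := by
    rw [← mul_assoc, mul_neg, Complex.I_mul_I]; ring
  have h2 : Complex.I * (-Complex.I * τ)⁻¹ = -1 / τ := by
    field_simp
  have hc : (-Complex.I * τ) ^ (1 / 2 : ℂ) ≠ 0 := by
    simp [Complex.cpow_eq_zero_iff, hτ0]
  rw [h1, h2, Complex.cpow_neg] at h
  rw [h]
  field_simp

lemma norm_jacobiTheta_neg_one_div {τ : ℂ} (hτ : 0 < τ.im) :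
    ‖jacobiTheta (-1 / τ)‖ = √‖τ‖ * ‖jacobiTheta τ‖ := by
  have hτ0 : τ ≠ 0 := by rintro rfl; simp at hτ
  rw [jacobiTheta_neg_one_div hτ, norm_mul, Complex.norm_cpow_of_ne_zero (by simpa using hτ0),
    Real.sqrt_eq_rpow]
  norm_num

/-- Near the cusp `1`, the theta function is a difference of two values near `i∞`. -/
lemma jacobiTheta_one_sub_inv {τ : ℂ} (hτ : 0 < τ.im) :
    jacobiTheta (1 + -1 / τ) =
      (-Complex.I * τ) ^ (1 / 2 : ℂ) * (jacobiTheta (τ / 4) - jacobiTheta τ) := by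
  have hτ0 : τ ≠ 0 := by rintro rfl; simp at hτ
  have him : 0 < (-1 / τ).im := by
    have := Complex.normSq_pos.mpr hτ0
    rw [neg_div, Complex.neg_im, one_div, Complex.inv_im, neg_div, neg_neg]
    positivity
  have hq : ((1 / 4 : ℝ) : ℂ) ^ (1 / 2 : ℂ) = 1 / 2 := by
    have : ((1 / 4 : ℝ) : ℂ) ^ (((1 / 2 : ℝ)) : ℂ) = ((1 / 2 : ℝ) : ℂ) := by
      rw [← Complex.ofReal_cpow (by norm_num), ← Real.sqrt_eq_rpow,
        show (1 / 4 : ℝ) = (1 / 2) ^ 2 by norm_num, Real.sqrt_sq (by norm_num)]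
    simpa using this
  have h4 : jacobiTheta (4 * (-1 / τ)) =
      (1 / 2) * (-Complex.I * τ) ^ (1 / 2 : ℂ) * jacobiTheta (τ / 4) := by
    have h := jacobiTheta_neg_one_div (τ := τ / 4) (by
      rw [show τ / 4 = ((1 / 4 : ℝ) : ℂ) * τ by push_cast; ring, Complex.im_ofReal_mul]
      linarith)
    rw [show 4 * (-1 / τ) = -1 / (τ / 4) by field_simp, h,
      show -Complex.I * (τ / 4) = ((1 / 4 : ℝ) : ℂ) * (-Complex.I * τ) by push_cast; ring,
      real_mul_cpow (by norm_num) (by simpa using hτ0), hq]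
  rw [add_comm, jacobiTheta_add_one him, h4, jacobiTheta_neg_one_div hτ]
  ring

lemma exists_norm_jacobiTheta_sub_one_le :
    ∃ K : ℝ, 0 ≤ K ∧ ∀ (R : ℝ) (τ : ℂ), 1 / 4 ≤ R → R ≤ τ.im →
      ‖jacobiTheta τ - 1‖ ≤ K / (1 + R) := by
  set q := Real.exp (-Real.pi * (1 / 4)) with hq
  have hq1 : q < 1 := Real.exp_lt_one_iff.mpr (by linarith [Real.pi_pos])
  have hq2 : 0 < 1 - q := by linarith
  refine ⟨2 / (1 - q), by positivity, fun R τ hR hRτ ↦ ?_⟩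
  have h1 : Real.exp (-Real.pi * τ.im) ≤ 1 / (1 + R) := by
    rw [neg_mul, Real.exp_neg, ← one_div]
    apply one_div_le_one_div_of_le (by linarith)
    have := Real.add_one_le_exp (Real.pi * τ.im)
    nlinarith [Real.pi_gt_three]
  have h2 : Real.exp (-Real.pi * τ.im) ≤ q := by
    apply Real.exp_le_exp.mpr
    nlinarith [Real.pi_pos]
  calc _ ≤ 2 / (1 - Real.exp (-Real.pi * τ.im)) * Real.exp (-Real.pi * τ.im) :=
        norm_jacobiTheta_sub_one_le (by linarith)
    _ ≤ 2 / (1 - q) * (1 / (1 + R)) := by gcongr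
    _ = _ := by ring

/-- The theta function is bounded as its argument tends to the cusp `1` along the unit circle. -/
lemma exists_norm_jacobiTheta_near_one_le :
    ∃ C : ℝ, ∀ R : ℝ, 1 ≤ R →
      ‖jacobiTheta (1 + -1 / (1 / 2 + R * Complex.I))‖ ≤ C := by
  obtain ⟨K, hK, h⟩ := exists_norm_jacobiTheta_sub_one_le
  refine ⟨8 * K, fun R hR ↦ ?_⟩
  set τ : ℂ := 1 / 2 + R * Complex.I with hτ
  have him : τ.im = R := by simp [hτ]
  have him4 : (τ / 4).im = R / 4 := by simp [hτ]
  have hnorm : ‖τ‖ ≤ 1 + R := by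
    calc ‖τ‖ ≤ ‖(1 / 2 : ℂ)‖ + ‖R * Complex.I‖ := norm_add_le _ _
      _ = 1 / 2 + R := by simp [abs_of_nonneg (by linarith : 0 ≤ R)]
      _ ≤ 1 + R := by linarith
  have hτ0 : τ ≠ 0 := by
    intro h0
    rw [h0] at him
    simp at him
    linarith
  have hs : √‖τ‖ ≤ 1 + R := by
    rw [Real.sqrt_le_left (by linarith)]
    nlinarith
  rw [jacobiTheta_one_sub_inv (by rw [him]; linarith), norm_mul,
    Complex.norm_cpow_of_ne_zero (by simpa using hτ0)]
  have h1 := h (R / 4) (τ / 4) (by linarith) him4.ge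
  have h2 := h (R / 4) τ (by linarith) (by rw [him]; linarith)
  have h3 : ‖jacobiTheta (τ / 4) - jacobiTheta τ‖ ≤ 2 * (K / (1 + R / 4)) := by
    rw [← sub_sub_sub_cancel_right _ _ 1]
    exact (norm_sub_le _ _).trans (by linarith)
  calc _ = √‖τ‖ * ‖jacobiTheta (τ / 4) - jacobiTheta τ‖ := by
        rw [Real.sqrt_eq_rpow]; norm_num
    _ ≤ (1 + R) * (2 * (K / (1 + R / 4))) := by gcongr
    _ ≤ 8 * K := by
        rw [show (1 + R) * (2 * (K / (1 + R / 4))) = 2 * K * ((1 + R) / (1 + R / 4)) by ring]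
        have : (1 + R) / (1 + R / 4) ≤ 4 := by
          rw [div_le_iff₀ (by linarith)]; linarith
        nlinarith

/-- The theta function blows up as its argument tends to the cusp `2` along a circle. -/
lemma exists_le_norm_jacobiTheta_near_two :
    ∃ R₀ : ℝ, ∀ R : ℝ, R₀ ≤ R →
      √(R / 2) / 2 ≤ ‖jacobiTheta (2 * (1 + -1 / (1 / 2 + R * Complex.I)))‖ := by
  obtain ⟨K, hK, h⟩ := exists_norm_jacobiTheta_sub_one_le
  refine ⟨1 + 4 * K, fun R hR ↦ ?_⟩
  set τ : ℂ := 1 / 2 + R * Complex.I with hτ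
  have him2 : (τ / 2).im = R / 2 := by simp [hτ]
  have hτ0 : τ ≠ 0 := by
    intro h0
    rw [h0] at him2
    simp at him2
    linarith
  have h1 := h (R / 2) (τ / 2) (by linarith) him2.ge
  have h2 : K / (1 + R / 2) ≤ 1 / 2 := by
    rw [div_le_iff₀ (by linarith)]; linarith
  have h3 : 1 / 2 ≤ ‖jacobiTheta (τ / 2)‖ := by
    have := norm_sub_norm_le (1 : ℂ) (jacobiTheta (τ / 2))
    rw [norm_sub_rev, norm_one] at this
    linarith
  have h4 : R / 2 ≤ ‖τ / 2‖ := by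
    rw [← him2]
    exact (le_abs_self _).trans (Complex.abs_im_le_norm _)
  rw [show 2 * (1 + -1 / τ) = 2 + -1 / (τ / 2) by field_simp, jacobiTheta_two_add,
    norm_jacobiTheta_neg_one_div (by rw [him2]; linarith)]
  calc _ = √(R / 2) * (1 / 2) := by ring
    _ ≤ _ := by gcongr

lemma integrableOn_rpow_mul_min {m σ : ℝ} (hm : 0 < m) (hσ : 0 < σ) (hσ' : σ < 1 / 2) :
    IntegrableOn (fun x : ℝ ↦ x ^ (σ - 1) * min 1 ((m * x) ^ (-(1 / 2) : ℝ))) (Set.Ioi 0) := by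
  have hcont : ContinuousOn (fun x : ℝ ↦ min 1 ((m * x) ^ (-(1 / 2) : ℝ))) (Set.Ioi 0) := by
    refine continuousOn_const.inf (ContinuousOn.rpow_const (by fun_prop) fun x hx ↦ ?_)
    exact Or.inl (mul_pos hm hx).ne'
  refine mellin_convergent_of_isBigO_scalar (a := 1 / 2) (b := 0)
    (hcont.locallyIntegrableOn measurableSet_Ioi) ?_ hσ' ?_ hσ
  · refine Asymptotics.IsBigO.of_bound (m ^ (-(1 / 2) : ℝ)) ?_
    filter_upwards [Filter.eventually_gt_atTop 0] with x hx
    rw [Real.norm_of_nonneg (by positivity), Real.norm_of_nonneg (by positivity),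
      ← Real.mul_rpow hm.le hx.le]
    exact min_le_right _ _
  · refine Asymptotics.IsBigO.of_bound 1 ?_
    filter_upwards [self_mem_nhdsWithin] with x (hx : 0 < x)
    rw [Real.norm_of_nonneg (by positivity)]
    simp

lemma continuousOn_thetaRemainder_mul {w : ℂ} (hw : 0 < w.re) :
    ContinuousOn (fun x : ℝ ↦ thetaRemainder (w * x)) (Set.Ioi 0) := by
  intro x hx
  refine ContinuousAt.continuousWithinAt ?_
  exact ContinuousAt.comp (f := fun x : ℝ ↦ w * x)
    (differentiableAt_thetaRemainder (by simpa using mul_pos hw hx)).continuousAt (by fun_prop)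

lemma continuousOn_ofReal_cpow (s : ℂ) :
    ContinuousOn (fun x : ℝ ↦ (x : ℂ) ^ s) (Set.Ioi 0) := fun x hx ↦
  (Complex.continuousAt_ofReal_cpow_const x s (Or.inr (ne_of_gt hx))).continuousWithinAt

/-- A bound for `thetaRemainder (w * x)` that is uniform for `w` near a given point. -/
lemma exists_ball_norm_thetaRemainder_mul_le {w₀ : ℂ} (hw₀ : 0 < w₀.re) :
    ∃ C : ℝ, 0 ≤ C ∧ ∀ w ∈ Metric.ball w₀ (w₀.re / 2), 0 < w.re ∧ ∀ x : ℝ, 0 < x →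
      ‖thetaRemainder (w * x)‖ ≤ C * min 1 ((w₀.re / 2 * x) ^ (-(1 / 2) : ℝ)) := by
  have hn : 0 < ‖w₀‖ := norm_pos_iff.mpr (by rintro rfl; simp at hw₀)
  obtain ⟨C, hC, h⟩ := exists_norm_thetaRemainder_le
    (a := w₀.re / 2 / (‖w₀‖ + w₀.re / 2)) (by positivity)
  refine ⟨C, hC, fun w hw ↦ ?_⟩
  rw [mem_ball_iff_norm] at hw
  have h1 : w₀.re / 2 ≤ w.re := by
    have := (Complex.abs_re_le_norm (w - w₀)).trans hw.le
    rw [abs_le, Complex.sub_re] at this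
    linarith [this.1]
  have h2 : ‖w‖ ≤ ‖w₀‖ + w₀.re / 2 := by
    calc ‖w‖ = ‖w₀ + (w - w₀)‖ := by congr 1; ring
      _ ≤ ‖w₀‖ + ‖w - w₀‖ := norm_add_le _ _
      _ ≤ _ := by gcongr
  have hwre : 0 < w.re := by linarith
  refine ⟨hwre, fun x hx ↦ ?_⟩
  have hw0 : w ≠ 0 := by rintro rfl; simp at hwre
  have hx0 : (x : ℂ) ≠ 0 := by exact_mod_cast hx.ne'
  have hnx : ‖w * x‖ = ‖w‖ * x := by
    rw [norm_mul, Complex.norm_real, Real.norm_of_nonneg hx.le]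
  have h3 : w₀.re / 2 / (‖w₀‖ + w₀.re / 2) * ‖w * x‖ ≤ (w * x).re := by
    rw [hnx, Complex.re_mul_ofReal, div_mul_eq_mul_div, div_le_iff₀ (by positivity)]
    calc w₀.re / 2 * (‖w‖ * x) ≤ w.re * ((‖w₀‖ + w₀.re / 2) * x) := by gcongr
      _ = _ := by ring
  refine (h (w * x) (mul_ne_zero hw0 hx0) h3).trans ?_
  have h4 : w₀.re / 2 * x ≤ ‖w * x‖ := by
    rw [hnx]
    gcongr
    exact h1.trans ((le_abs_self _).trans (Complex.abs_re_le_norm w))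
  gcongr C * min 1 ?_
  exact Real.rpow_le_rpow_of_nonpos (by positivity) h4 (by norm_num)

lemma mellinConvergent_thetaRemainder_mul {w : ℂ} (hw : 0 < w.re) {s : ℂ} (hs : 0 < s.re)
    (hs' : s.re < 1 / 2) : MellinConvergent (fun x : ℝ ↦ thetaRemainder (w * x)) s := by
  obtain ⟨C, hC, h⟩ := exists_ball_norm_thetaRemainder_mul_le hw
  have hb := (integrableOn_rpow_mul_min (m := w.re / 2) (by linarith) hs hs').const_mul C
  refine Integrable.mono' hb
    (((continuousOn_ofReal_cpow _).smul
      (continuousOn_thetaRemainder_mul hw)).aestronglyMeasurable measurableSet_Ioi) ?_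
  refine (ae_restrict_iff' measurableSet_Ioi).mpr (Filter.Eventually.of_forall fun x hx ↦ ?_)
  rw [norm_smul, Complex.norm_cpow_eq_rpow_re_of_pos hx, Complex.sub_re, Complex.one_re,
    mul_left_comm]
  have := (h w (Metric.mem_ball_self (by linarith))).2 x hx
  have h0 : 0 ≤ x ^ (s.re - 1) := Real.rpow_nonneg (le_of_lt hx) _
  gcongr

lemma differentiableAt_mellin_thetaRemainder_mul {w₀ : ℂ} (hw₀ : 0 < w₀.re) {s : ℂ}
    (hs : 0 < s.re) (hs' : s.re < 1 / 2) :
    DifferentiableAt ℂ (fun w ↦ mellin (fun x : ℝ ↦ thetaRemainder (w * x)) s) w₀ := by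
  obtain ⟨C, hC, h⟩ := exists_ball_norm_thetaRemainder_mul_le hw₀
  set r := w₀.re / 2 with hr
  have hr0 : 0 < r := by linarith
  have hball {w : ℂ} (hw : w ∈ Metric.ball w₀ (r / 4)) : Metric.closedBall w (r / 4) ⊆
      Metric.ball w₀ r := by
    intro z hz
    rw [Metric.mem_ball] at hw ⊢
    rw [Metric.mem_closedBall] at hz
    linarith [dist_triangle z w w₀]
  have hdiff {w : ℂ} (hw : 0 < w.re) {x : ℝ} (hx : 0 < x) :
      DifferentiableAt ℂ (fun w : ℂ ↦ thetaRemainder (w * x)) w :=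
    DifferentiableAt.comp (f := fun w : ℂ ↦ w * x) w
      (differentiableAt_thetaRemainder (by simpa using mul_pos hw hx)) (by fun_prop)
  have hb := ((integrableOn_rpow_mul_min hr0 hs hs').const_mul C).div_const (r / 4)
  have hmeas : AEStronglyMeasurable (fun x : ℝ ↦ (x : ℂ) ^ (s - 1) •
      deriv (fun w : ℂ ↦ thetaRemainder (w * x)) w₀) (volume.restrict (Set.Ioi 0)) := by
    have heq : Set.EqOn (fun x : ℝ ↦ deriv (fun w : ℂ ↦ thetaRemainder (w * x)) w₀)
        (fun x : ℝ ↦ deriv thetaRemainder (w₀ * x) * x) (Set.Ioi 0) := by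
      intro x hx
      have hd := (differentiableAt_thetaRemainder (w := w₀ * x)
        (by simpa using mul_pos hw₀ hx)).hasDerivAt
      have hl : HasDerivAt (fun w : ℂ ↦ w * x) x w₀ := by
        simpa using (hasDerivAt_id w₀).mul_const (x : ℂ)
      exact (HasDerivAt.comp w₀ hd hl).deriv
    have hcd : ContinuousOn (deriv thetaRemainder) {w : ℂ | 0 < w.re} := by
      refine DifferentiableOn.continuousOn (𝕜 := ℂ) (DifferentiableOn.deriv ?_ ?_)
      · exact fun w hw ↦ (differentiableAt_thetaRemainder hw).differentiableWithinAt
      · exact isOpen_lt continuous_const Complex.continuous_re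
    have hc : ContinuousOn (fun x : ℝ ↦ deriv (fun w : ℂ ↦ thetaRemainder (w * x)) w₀)
        (Set.Ioi 0) := by
      refine ContinuousOn.congr (ContinuousOn.mul ?_ (by fun_prop)) heq
      exact hcd.comp (f := fun x : ℝ ↦ w₀ * x) (by fun_prop)
        fun x hx ↦ by simpa using mul_pos hw₀ hx
    exact ((continuousOn_ofReal_cpow _).smul hc).aestronglyMeasurable measurableSet_Ioi
  refine (hasDerivAt_integral_of_dominated_loc_of_deriv_le
    (F := fun w (x : ℝ) ↦ (x : ℂ) ^ (s - 1) • thetaRemainder (w * x))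
    (F' := fun w (x : ℝ) ↦ (x : ℂ) ^ (s - 1) • deriv (fun w : ℂ ↦ thetaRemainder (w * x)) w)
    (Metric.ball_mem_nhds w₀ (by positivity : 0 < r / 4)) ?_
    (mellinConvergent_thetaRemainder_mul hw₀ hs hs') hmeas ?_ hb ?_).2.differentiableAt
  · filter_upwards [Metric.ball_mem_nhds w₀ hr0] with w hw
    exact ((continuousOn_ofReal_cpow _).smul
      (continuousOn_thetaRemainder_mul (h w hw).1)).aestronglyMeasurable measurableSet_Ioi
  · refine (ae_restrict_iff' measurableSet_Ioi).mpr (Filter.Eventually.of_forall fun x hx w hw ↦ ?_)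
    have hx' : 0 < x := hx
    rw [norm_smul, Complex.norm_cpow_eq_rpow_re_of_pos hx, Complex.sub_re, Complex.one_re,
      mul_left_comm, mul_div_assoc]
    gcongr
    refine Complex.norm_deriv_le_of_forall_mem_sphere_norm_le (by positivity) ?_ fun z hz ↦ ?_
    · refine DifferentiableOn.diffContOnCl_ball (U := Metric.ball w₀ r) (fun z hz ↦ ?_) (hball hw)
      exact (hdiff (h z hz).1 hx).differentiableWithinAt
    · exact (h z (hball hw (Metric.sphere_subset_closedBall hz))).2 x hx
  · refine (ae_restrict_iff' measurableSet_Ioi).mpr (Filter.Eventually.of_forall fun x hx w hw ↦ ?_)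
    exact (hdiff (h w (hball hw (Metric.mem_closedBall_self (by positivity)))).1
      hx).hasDerivAt.fun_const_smul _

lemma hasMellin_cpow_neg_half_Ioi {s : ℂ} (hs : s.re < 1 / 2) :
    HasMellin ((Set.Ioi (1 : ℝ)).indicator fun x : ℝ ↦ (x : ℂ) ^ (-(1 / 2) : ℂ)) s
      (1 / (1 / 2 - s)) := by
  have hre : (s - 3 / 2).re < -1 := by
    rw [Complex.sub_re]
    norm_num
    linarith
  have heq : (fun x : ℝ ↦ (x : ℂ) ^ (s - 1) •
      (Set.Ioi (1 : ℝ)).indicator (fun x : ℝ ↦ (x : ℂ) ^ (-(1 / 2) : ℂ)) x) =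
      (Set.Ioi (1 : ℝ)).indicator (fun x : ℝ ↦ (x : ℂ) ^ (s - 3 / 2)) := by
    funext x
    by_cases hx : x ∈ Set.Ioi (1 : ℝ)
    · have hx0 : (x : ℂ) ≠ 0 := by
        have : (0 : ℝ) < x := lt_trans one_pos hx
        exact_mod_cast this.ne'
      rw [Set.indicator_of_mem hx, Set.indicator_of_mem hx, smul_eq_mul, ← Complex.cpow_add _ _ hx0]
      congr 1
      ring
    · simp [Set.indicator_of_notMem hx]
  have hsub : Set.Ioi (0 : ℝ) ∩ Set.Ioi 1 = Set.Ioi 1 :=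
    Set.inter_eq_right.mpr (Set.Ioi_subset_Ioi zero_le_one)
  constructor
  · rw [MellinConvergent, heq]
    exact ((integrableOn_Ioi_cpow_of_lt hre one_pos).integrable_indicator
      measurableSet_Ioi).integrableOn
  · rw [mellin, heq, setIntegral_indicator measurableSet_Ioi, hsub,
      integral_Ioi_cpow_of_lt hre one_pos, Complex.ofReal_one, Complex.one_cpow,
      show s - 3 / 2 + 1 = -(1 / 2 - s) by ring, neg_div_neg_eq]

/-- The Mellin transform of the theta remainder in the critical strip. -/
lemma mellin_thetaRemainder {s : ℂ} (hs : 0 < s.re) (hs' : s.re < 1 / 2) :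
    mellin (fun x : ℝ ↦ thetaRemainder x) s = 2 * completedRiemannZeta (2 * s) := by
  have h1 : MellinConvergent (fun x : ℝ ↦ thetaRemainder x) s := by
    simpa using mellinConvergent_thetaRemainder_mul (w := 1) (by simp) hs hs'
  have h2 := hasMellin_one_Ioc hs
  have h3 := hasMellin_cpow_neg_half_Ioi hs'
  have h4 := hasMellin_add h1 h2.1
  have h5 := hasMellin_add h4.1 h3.1
  have h6 : (HurwitzZeta.hurwitzEvenFEPair 0).Λ₀ s =
      mellin (fun x : ℝ ↦ thetaRemainder x) s + 1 / s + 1 / (1 / 2 - s) := by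
    rw [← h2.2, ← h3.2, ← h4.2, ← h5.2, WeakFEPair.Λ₀, mellin, mellin]
    refine setIntegral_congr_ae measurableSet_Ioi ?_
    filter_upwards [compl_mem_ae_iff.mpr (measure_singleton (1 : ℝ))] with x hx1 hx
    congr 1
    have hx0 : 0 < x := hx
    have hker : (HurwitzZeta.hurwitzEvenFEPair 0).f x = jacobiTheta (Complex.I * x) := by
      have := HurwitzZeta.evenKernel_def 0 x
      simpa [HurwitzZeta.hurwitzEvenFEPair, jacobiTheta_eq_jacobiTheta₂] using this
    have hf₀ : (HurwitzZeta.hurwitzEvenFEPair 0).f₀ = 1 := if_pos rfl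
    have hg₀ : (HurwitzZeta.hurwitzEvenFEPair 0).g₀ = 1 := rfl
    have hε : (HurwitzZeta.hurwitzEvenFEPair 0).ε = 1 := rfl
    have hk : (HurwitzZeta.hurwitzEvenFEPair 0).k = 1 / 2 := rfl
    have hpow : ((x ^ (-(1 / 2) : ℝ) : ℝ) : ℂ) = (x : ℂ) ^ (-(1 / 2) : ℂ) := by
      rw [Complex.ofReal_cpow hx0.le]
      norm_num
    rw [WeakFEPair.f_modif, Pi.add_apply, hf₀, hg₀, hε, hk]
    rcases lt_or_gt_of_ne (show x ≠ 1 from hx1) with hlt | hgt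
    · rw [Set.indicator_of_notMem (by simpa using hlt.le),
        Set.indicator_of_mem (Set.mem_Ioo.mpr ⟨hx0, hlt⟩),
        Set.indicator_of_mem (Set.mem_Ioc.mpr ⟨hx0, hlt.le⟩),
        Set.indicator_of_notMem (by simpa using hlt.le), hker, hpow, thetaRemainder, smul_eq_mul]
      ring
    · rw [Set.indicator_of_mem (Set.mem_Ioi.mpr hgt),
        Set.indicator_of_notMem (fun h ↦ hgt.not_gt h.2),
        Set.indicator_of_notMem (fun h ↦ hgt.not_ge h.2),
        Set.indicator_of_mem (Set.mem_Ioi.mpr hgt), hker, thetaRemainder]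
      ring
  have h7 : completedRiemannZeta (2 * s) = (HurwitzZeta.hurwitzEvenFEPair 0).Λ s / 2 := by
    rw [completedRiemannZeta, HurwitzZeta.completedHurwitzZetaEven,
      mul_div_cancel_left₀ _ (two_ne_zero' ℂ)]
  have hf₀ : (HurwitzZeta.hurwitzEvenFEPair 0).f₀ = 1 := if_pos rfl
  have hg₀ : (HurwitzZeta.hurwitzEvenFEPair 0).g₀ = 1 := rfl
  have hε : (HurwitzZeta.hurwitzEvenFEPair 0).ε = 1 := rfl
  have hk : (HurwitzZeta.hurwitzEvenFEPair 0).k = 1 / 2 := rfl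
  rw [h7, WeakFEPair.Λ, h6, hf₀, hg₀, hε, hk]
  push_cast
  simp only [smul_eq_mul]
  ring

/-- The Mellin transform of the theta remainder along a rotated ray. -/
lemma mellin_thetaRemainder_mul {s : ℂ} (hs : 0 < s.re) (hs' : s.re < 1 / 2) {w : ℂ}
    (hw : 0 < w.re) :
    mellin (fun x : ℝ ↦ thetaRemainder (w * x)) s =
      w ^ (-s) * (2 * completedRiemannZeta (2 * s)) := by
  have hopen : IsOpen {w : ℂ | 0 < w.re} := isOpen_lt continuous_const Complex.continuous_re
  have hreal {x : ℝ} (hx : 0 < x) : mellin (fun y : ℝ ↦ thetaRemainder (x * y)) s =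
      (x : ℂ) ^ (-s) * (2 * completedRiemannZeta (2 * s)) := by
    rw [← mellin_thetaRemainder hs hs', ← smul_eq_mul, ← mellin_comp_mul_left _ _ hx]
    simp
  refine AnalyticOnNhd.eqOn_of_preconnected_of_frequently_eq (U := {w : ℂ | 0 < w.re})
    (f := fun w ↦ mellin (fun x : ℝ ↦ thetaRemainder (w * x)) s)
    (g := fun w ↦ w ^ (-s) * (2 * completedRiemannZeta (2 * s))) (z₀ := 1)
    ?_ ?_ ?_ (by simp) ?_ hw
  · exact DifferentiableOn.analyticOnNhd (fun w hw ↦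
      (differentiableAt_mellin_thetaRemainder_mul hw hs hs').differentiableWithinAt) hopen
  · refine DifferentiableOn.analyticOnNhd (fun w hw ↦ ?_) hopen
    exact ((differentiableAt_id.cpow_const (Or.inl hw)).mul_const _).differentiableWithinAt
  · exact (convex_halfSpace_re_gt 0).isPreconnected
  · have ht : Filter.Tendsto (fun x : ℝ ↦ (x : ℂ)) (nhdsWithin 1 {1}ᶜ) (nhdsWithin 1 {1}ᶜ) := by
      refine tendsto_nhdsWithin_iff.mpr ⟨?_, ?_⟩
      · have := Complex.continuous_ofReal.tendsto 1
        rw [Complex.ofReal_one] at this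
        exact this.mono_left nhdsWithin_le_nhds
      · filter_upwards [self_mem_nhdsWithin] with x hx
        simpa using hx
    refine ht.frequently (Filter.Eventually.frequently ?_)
    filter_upwards [nhdsWithin_le_nhds (lt_mem_nhds (zero_lt_one' ℝ))] with x hx
    exact hreal hx

/-- The completed zeta function on the critical line. -/
noncomputable def criticalXi (t : ℝ) : ℝ :=
  (completedRiemannZeta (1 / 2 + Complex.I * t)).re

lemma Gammaℝ_conj (s : ℂ) :
    Complex.Gammaℝ (starRingEnd ℂ s) = starRingEnd ℂ (Complex.Gammaℝ s) := by
  have harg : (Real.pi : ℂ).arg ≠ Real.pi := by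
    rw [Complex.arg_ofReal_of_nonneg Real.pi_pos.le]
    exact Real.pi_pos.ne
  have h1 : starRingEnd ℂ s / 2 = starRingEnd ℂ (s / 2) := by simp [map_ofNat]
  have h2 : -starRingEnd ℂ s / 2 = starRingEnd ℂ (-s / 2) := by simp [map_ofNat]
  have h3 := Complex.conj_cpow (Real.pi : ℂ) (starRingEnd ℂ (-s / 2)) harg
  rw [Complex.conj_ofReal, Complex.conj_conj] at h3
  rw [Complex.Gammaℝ_def, Complex.Gammaℝ_def, map_mul, h1, h2, Complex.Gamma_conj, h3]

lemma completedRiemannZeta_eq_Gammaℝ_mul {s : ℂ} (hs : 0 < s.re) :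
    completedRiemannZeta s = Complex.Gammaℝ s * riemannZeta s := by
  have hs0 : s ≠ 0 := by rintro rfl; simp at hs
  rw [riemannZeta_def_of_ne_zero hs0,
    mul_div_cancel₀ _ (Complex.Gammaℝ_ne_zero_of_re_pos hs)]

lemma ofReal_criticalXi (t : ℝ) :
    (criticalXi t : ℂ) = completedRiemannZeta (1 / 2 + Complex.I * t) := by
  rw [criticalXi, ← Complex.conj_eq_iff_re]
  have hre : 0 < (1 / 2 + Complex.I * t : ℂ).re := by simp
  have hre' : 0 < (starRingEnd ℂ (1 / 2 + Complex.I * t)).re := by simp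
  have hconj : starRingEnd ℂ (1 / 2 + Complex.I * t) = 1 - (1 / 2 + Complex.I * t) := by
    simp only [map_add, map_div₀, map_one, map_ofNat, map_mul, Complex.conj_I, Complex.conj_ofReal]
    ring
  rw [completedRiemannZeta_eq_Gammaℝ_mul hre, map_mul, ← Gammaℝ_conj, ← riemannZeta_conj,
    ← completedRiemannZeta_eq_Gammaℝ_mul hre', ← completedRiemannZeta_eq_Gammaℝ_mul hre, hconj,
    completedRiemannZeta_one_sub]

lemma criticalXi_neg (t : ℝ) : criticalXi (-t) = criticalXi t := by
  rw [criticalXi, criticalXi, ← completedRiemannZeta_one_sub]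
  congr 2
  push_cast
  ring

lemma continuous_criticalXi : Continuous criticalXi := by
  refine Complex.continuous_re.comp (continuous_iff_continuousAt.mpr fun t ↦ ?_)
  refine ContinuousAt.comp (f := fun t : ℝ ↦ (1 / 2 + Complex.I * t : ℂ))
    (differentiableAt_completedZeta ?_ ?_).continuousAt (by fun_prop)
  · exact fun h ↦ by simpa using congrArg Complex.re h
  · exact fun h ↦ by
      have := congrArg Complex.re h
      norm_num at this

lemma HardyZ_eq (t : ℝ) :
    HardyZ t = Real.pi ^ (1 / 4 : ℝ) / ‖Complex.Gamma (1 / 4 + Complex.I * t / 2)‖ *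
      criticalXi t := by
  have hre : 0 < (1 / 2 + Complex.I * t : ℂ).re := by simp
  have hpi : (Real.pi : ℂ) ≠ 0 := by exact_mod_cast Real.pi_ne_zero
  have hpow : (Real.pi : ℂ) ^ (-(Complex.I * t) / 2) =
      (Real.pi : ℂ) ^ (1 / 4 : ℂ) * (Real.pi : ℂ) ^ (-(1 / 2 + Complex.I * t) / 2) := by
    rw [← Complex.cpow_add _ _ hpi]
    congr 1
    ring
  have hhalf : (1 / 2 + Complex.I * t) / 2 = 1 / 4 + Complex.I * t / 2 := by ring
  have hquarter : ((Real.pi ^ (1 / 4 : ℝ) : ℝ) : ℂ) = (Real.pi : ℂ) ^ (1 / 4 : ℂ) := by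
    rw [Complex.ofReal_cpow Real.pi_pos.le]
    norm_num
  have key : eTheta t * riemannZeta (1 / 2 + Complex.I * t) =
      ((Real.pi ^ (1 / 4 : ℝ) / ‖Complex.Gamma (1 / 4 + Complex.I * t / 2)‖ * criticalXi t : ℝ) :
        ℂ) := by
    rw [Complex.ofReal_mul, ofReal_criticalXi, completedRiemannZeta_eq_Gammaℝ_mul hre,
      Complex.Gammaℝ_def, eTheta, hpow, hhalf, Complex.ofReal_div, hquarter]
    ring
  rw [HardyZ, key, Complex.ofReal_re]

lemma Gamma_quarter_add_ne_zero (t : ℝ) : Complex.Gamma (1 / 4 + Complex.I * t / 2) ≠ 0 := by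
  refine Complex.Gamma_ne_zero_of_re_pos ?_
  have : (Complex.I * t / 2 : ℂ) = ((t / 2 : ℝ) : ℂ) * Complex.I := by push_cast; ring
  rw [this]
  norm_num

lemma HardyZ_eq_zero_iff (t : ℝ) : HardyZ t = 0 ↔ criticalXi t = 0 := by
  have h1 : Real.pi ^ (1 / 4 : ℝ) ≠ 0 := (Real.rpow_pos_of_pos Real.pi_pos _).ne'
  have h2 := norm_ne_zero_iff.mpr (Gamma_quarter_add_ne_zero t)
  rw [HardyZ_eq, mul_eq_zero, or_iff_right (div_ne_zero h1 h2)]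

lemma riemannZeta_eq_zero_of_criticalXi_eq_zero {t : ℝ} (ht : criticalXi t = 0) :
    riemannZeta (1 / 2 + Complex.I * t) = 0 := by
  have hre : 0 < (1 / 2 + Complex.I * t : ℂ).re := by simp
  have h := ofReal_criticalXi t
  rw [ht, Complex.ofReal_zero, completedRiemannZeta_eq_Gammaℝ_mul hre] at h
  exact (mul_eq_zero.mp h.symm).resolve_left (Complex.Gammaℝ_ne_zero_of_re_pos hre)

lemma integrable_exp_neg_mul_abs {a : ℝ} (ha : 0 < a) :
    Integrable fun y : ℝ ↦ Real.exp (-(a * |y|)) := by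
  rw [← integrableOn_univ, ← Set.Iic_union_Ioi (a := (0 : ℝ))]
  refine IntegrableOn.union ?_ ?_
  · refine (integrableOn_exp_mul_Iic ha 0).congr_fun (fun y hy ↦ ?_) measurableSet_Iic
    simp [abs_of_nonpos (Set.mem_Iic.mp hy)]
  · refine (integrableOn_exp_mul_Ioi (neg_neg_of_pos ha) 0).congr_fun (fun y hy ↦ ?_)
      measurableSet_Ioi
    simp [abs_of_pos (Set.mem_Ioi.mp hy)]

/-- The exponential integral of a function of eventually constant sign controls its absolute
exponential integral. -/
lemma exists_integral_exp_mul_abs_le {h : ℝ → ℝ} (hc : Continuous h) (heven : ∀ y, h (-y) = h y)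
    {b T : ℝ} (hne : ∀ y, T < y → h y ≠ 0) :
    ∃ C : ℝ, ∀ γ : ℝ, |γ| ≤ b → Integrable (fun y ↦ Real.exp (γ * y) * h y) →
      ∫ y, Real.exp (γ * y) * |h y| ≤ |∫ y, Real.exp (γ * y) * h y| + C := by
  obtain ⟨ε, hε, hsign⟩ : ∃ ε : ℝ, |ε| = 1 ∧ ∀ y, T < y → |h y| = ε * h y := by
    have hpre : IsPreconnected (h '' Set.Ioi T) := isPreconnected_Ioi.image _ hc.continuousOn
    have h0 : (0 : ℝ) ∉ h '' Set.Ioi T := fun ⟨y, hy, hy0⟩ ↦ hne y hy hy0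
    by_cases hpos : 0 < h (T + 1)
    · refine ⟨1, by simp, fun y hy ↦ ?_⟩
      have : 0 < h y := by
        by_contra! hle
        exact h0 (hpre.Icc_subset ⟨y, hy, rfl⟩ ⟨T + 1, by simp, rfl⟩ ⟨hle, hpos.le⟩)
      rw [abs_of_pos this, one_mul]
    · refine ⟨-1, by simp, fun y hy ↦ ?_⟩
      have : h y < 0 := by
        by_contra! hle
        exact h0 (hpre.Icc_subset ⟨T + 1, by simp, rfl⟩ ⟨y, hy, rfl⟩ ⟨not_lt.mp hpos, hle⟩)
      rw [abs_of_neg this, neg_one_mul]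
  have hsign' (y : ℝ) (hy : T < |y|) : |h y| = ε * h y := by
    rcases abs_choice y with hy' | hy'
    · exact hsign y (hy' ▸ hy)
    · have := hsign (-y) (hy' ▸ hy)
      rwa [heven] at this
  set K := Set.Icc (-T) T with hK
  have hint : Integrable (K.indicator fun y ↦ 2 * Real.exp (b * T) * |h y|) :=
    (ContinuousOn.integrableOn_Icc (by fun_prop)).integrable_indicator measurableSet_Icc
  refine ⟨∫ y, K.indicator (fun y ↦ 2 * Real.exp (b * T) * |h y|) y, fun γ hγ hi ↦ ?_⟩
  calc ∫ y, Real.exp (γ * y) * |h y|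
      ≤ ∫ y, (ε * (Real.exp (γ * y) * h y) +
          K.indicator (fun y ↦ 2 * Real.exp (b * T) * |h y|) y) := by
        refine integral_mono ?_ ((hi.const_mul ε).add hint) fun y ↦ ?_
        · refine hi.abs.congr (Filter.Eventually.of_forall fun y ↦ ?_)
          simp [abs_mul]
        · have hεh : -|h y| ≤ ε * h y := by
            have := neg_abs_le (ε * h y)
            rwa [abs_mul, hε, one_mul] at this
          by_cases hy : T < |y|
          · have h0 : 0 ≤ K.indicator (fun y ↦ 2 * Real.exp (b * T) * |h y|) y :=
              Set.indicator_nonneg (fun _ _ ↦ by positivity) _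
            calc Real.exp (γ * y) * |h y| = ε * (Real.exp (γ * y) * h y) := by
                  rw [hsign' y hy]; ring
              _ ≤ _ := le_add_of_nonneg_right h0
          · rw [not_lt] at hy
            have hexp : Real.exp (γ * y) ≤ Real.exp (b * T) := by
              refine Real.exp_le_exp.mpr ((le_abs_self _).trans ?_)
              rw [abs_mul]
              gcongr
              exact (abs_nonneg γ).trans hγ
            have hm : y ∈ K := abs_le.mp hy
            rw [Set.indicator_of_mem hm]
            have h1 : Real.exp (γ * y) * |h y| ≤ Real.exp (b * T) * |h y| := by gcongr
            have h2 : Real.exp (γ * y) * (-|h y|) ≤ Real.exp (γ * y) * (ε * h y) := by gcongr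
            linarith
    _ = ε * (∫ y, Real.exp (γ * y) * h y) +
          ∫ y, K.indicator (fun y ↦ 2 * Real.exp (b * T) * |h y|) y := by
        rw [integral_add (hi.const_mul ε) hint, integral_const_mul]
    _ ≤ _ := by
        gcongr
        refine (le_abs_self _).trans ?_
        rw [abs_mul, hε, one_mul]

lemma exp_mul_I_re_pos {γ : ℝ} (hγ : |γ| < Real.pi / 2) : 0 < (Complex.exp (γ * Complex.I)).re := by
  rw [Complex.exp_ofReal_mul_I_re]
  exact Real.cos_pos_of_mem_Ioo (abs_lt.mp hγ)

/-- The Mellin transform of the theta remainder along the ray of argument `γ`, on the line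
`Re s = 1 / 4`. -/
lemma mellin_thetaRemainder_exp_mul {γ : ℝ} (hγ : |γ| < Real.pi / 2) (y : ℝ) :
    mellin (fun x : ℝ ↦ thetaRemainder (Complex.exp (γ * Complex.I) * x))
        (((1 / 4 : ℝ) : ℂ) + y * Complex.I) =
      2 * Complex.exp (-(γ / 4) * Complex.I) *
        ((Real.exp (γ * y) * criticalXi (2 * y) : ℝ) : ℂ) := by
  have hlog : Complex.log (Complex.exp (γ * Complex.I)) = γ * Complex.I := by
    have := abs_lt.mp hγ
    refine Complex.log_exp ?_ ?_ <;> simp <;> linarith [Real.pi_pos]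
  have harg : 2 * (((1 / 4 : ℝ) : ℂ) + y * Complex.I) =
      1 / 2 + Complex.I * ((2 * y : ℝ) : ℂ) := by
    push_cast
    ring
  have hexp : γ * Complex.I * -(((1 / 4 : ℝ) : ℂ) + y * Complex.I) =
      -(γ / 4) * Complex.I + γ * y := by
    push_cast
    linear_combination -(γ * y : ℂ) * Complex.I_sq
  rw [mellin_thetaRemainder_mul (by simp) (by norm_num) (exp_mul_I_re_pos hγ),
    Complex.cpow_def_of_ne_zero (Complex.exp_ne_zero _), hlog, harg, ← ofReal_criticalXi, hexp,
    Complex.exp_add]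
  push_cast
  ring

lemma norm_exp_quarter (γ : ℝ) : ‖Complex.exp (-(γ / 4) * Complex.I)‖ = 1 := by
  simpa using Complex.norm_exp_ofReal_mul_I (-(γ / 4))

lemma exists_exp_mul_abs_criticalXi_le {γ : ℝ} (hγ : |γ| < Real.pi / 2) :
    ∃ C : ℝ, ∀ y : ℝ, Real.exp (γ * y) * |criticalXi (2 * y)| ≤ C := by
  set f := fun x : ℝ ↦ thetaRemainder (Complex.exp (γ * Complex.I) * x) with hf
  refine ⟨(∫ x in Set.Ioi (0 : ℝ), x ^ ((1 / 4 : ℝ) - 1) * ‖f x‖) / 2, fun y ↦ ?_⟩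
  have h1 := mellin_thetaRemainder_exp_mul hγ y
  have h2 : ‖mellin f (((1 / 4 : ℝ) : ℂ) + y * Complex.I)‖ ≤
      ∫ x in Set.Ioi (0 : ℝ), x ^ ((1 / 4 : ℝ) - 1) * ‖f x‖ := by
    rw [mellin]
    refine (norm_integral_le_integral_norm _).trans_eq
      (setIntegral_congr_fun measurableSet_Ioi fun x hx ↦ ?_)
    simp [Complex.norm_cpow_eq_rpow_re_of_pos hx]
  rw [h1, norm_mul, norm_mul, norm_exp_quarter, Complex.norm_real, Real.norm_eq_abs, abs_mul,
    Real.abs_exp, Complex.norm_ofNat] at h2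
  rw [le_div_iff₀ two_pos]
  linarith

lemma integrable_exp_mul_criticalXi {γ : ℝ} (hγ : |γ| < Real.pi / 2) :
    Integrable fun y ↦ Real.exp (γ * y) * criticalXi (2 * y) := by
  obtain ⟨β, hβ, hβ'⟩ := exists_between hγ
  have hβabs : |β| < Real.pi / 2 := by rwa [abs_of_pos ((abs_nonneg γ).trans_lt hβ)]
  obtain ⟨C, hC⟩ := exists_exp_mul_abs_criticalXi_le hβabs
  refine Integrable.mono' ((integrable_exp_neg_mul_abs (sub_pos.mpr hβ)).const_mul C)
    (Continuous.aestronglyMeasurable ?_) (Filter.Eventually.of_forall fun y ↦ ?_)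
  · exact Continuous.mul (by fun_prop) (continuous_criticalXi.comp (by fun_prop))
  · have habs : Real.exp (β * |y|) * |criticalXi (2 * y)| ≤ C := by
      rcases abs_choice y with hy | hy
      · rw [hy]
        exact hC y
      · rw [hy]
        have := hC (-y)
        rwa [mul_neg 2, criticalXi_neg] at this
    have hle : γ * y ≤ |γ| * |y| := (le_abs_self _).trans (abs_mul γ y).le
    rw [norm_mul, Real.norm_eq_abs, Real.norm_eq_abs, Real.abs_exp]
    calc Real.exp (γ * y) * |criticalXi (2 * y)|
        ≤ Real.exp (|γ| * |y|) * |criticalXi (2 * y)| := by gcongr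
      _ = Real.exp (β * |y|) * |criticalXi (2 * y)| * Real.exp (-((β - |γ|) * |y|)) := by
          rw [mul_right_comm, ← Real.exp_add]
          congr 2
          ring
      _ ≤ _ := by gcongr

/-- Mellin inversion for the theta remainder along the ray of argument `γ`. -/
lemma thetaRemainder_exp_mul_eq_integral {γ : ℝ} (hγ : |γ| < Real.pi / 2) {x : ℝ} (hx : 0 < x) :
    thetaRemainder (Complex.exp (γ * Complex.I) * x) =
      (1 / (2 * Real.pi)) • ∫ y : ℝ, (x : ℂ) ^ (-(((1 / 4 : ℝ) : ℂ) + y * Complex.I)) •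
        (2 * Complex.exp (-(γ / 4) * Complex.I) *
          ((Real.exp (γ * y) * criticalXi (2 * y) : ℝ) : ℂ)) := by
  have hw := exp_mul_I_re_pos hγ
  have h := mellinInv_mellin_eq (1 / 4)
    (fun x : ℝ ↦ thetaRemainder (Complex.exp (γ * Complex.I) * x)) hx
    (mellinConvergent_thetaRemainder_mul hw (by norm_num) (by norm_num)) ?_
    ((continuousOn_thetaRemainder_mul hw).continuousAt (Ioi_mem_nhds hx))
  · rw [← h, mellinInv]
    simp_rw [mellin_thetaRemainder_exp_mul hγ]
  · rw [Complex.VerticalIntegrable]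
    simp_rw [mellin_thetaRemainder_exp_mul hγ]
    exact (integrable_exp_mul_criticalXi hγ).ofReal.const_mul _

lemma norm_thetaRemainder_exp_eq {γ : ℝ} (hγ : |γ| < Real.pi / 2) :
    ‖thetaRemainder (Complex.exp (γ * Complex.I))‖ =
      1 / Real.pi * |∫ y, Real.exp (γ * y) * criticalXi (2 * y)| := by
  have h := thetaRemainder_exp_mul_eq_integral hγ one_pos
  simp_rw [Complex.ofReal_one, mul_one, Complex.one_cpow, one_smul] at h
  rw [integral_const_mul, integral_complex_ofReal] at h
  have hpi : ‖1 / (2 * Real.pi)‖ = 1 / (2 * Real.pi) := Real.norm_of_nonneg (by positivity)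
  rw [h, norm_smul, norm_mul, norm_mul, norm_exp_quarter, Complex.norm_real, hpi, Complex.norm_ofNat,
    Real.norm_eq_abs]
  field_simp

lemma norm_thetaRemainder_exp_mul_two_le {γ : ℝ} (hγ : |γ| < Real.pi / 2) :
    2 ^ (1 / 4 : ℝ) * ‖thetaRemainder (Complex.exp (γ * Complex.I) * 2)‖ ≤
      1 / Real.pi * ∫ y, Real.exp (γ * y) * |criticalXi (2 * y)| := by
  have h := thetaRemainder_exp_mul_eq_integral hγ two_pos
  have hnorm : ‖∫ y : ℝ, ((2 : ℝ) : ℂ) ^ (-(((1 / 4 : ℝ) : ℂ) + y * Complex.I)) •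
        (2 * Complex.exp (-(γ / 4) * Complex.I) *
          ((Real.exp (γ * y) * criticalXi (2 * y) : ℝ) : ℂ))‖ ≤
      2 ^ (-(1 / 4) : ℝ) * 2 * ∫ y, Real.exp (γ * y) * |criticalXi (2 * y)| := by
    rw [← integral_const_mul]
    refine (norm_integral_le_integral_norm _).trans_eq (integral_congr_ae ?_)
    refine Filter.Eventually.of_forall fun y ↦ ?_
    dsimp only
    rw [norm_smul, norm_mul, norm_mul, norm_exp_quarter,
      Complex.norm_cpow_eq_rpow_re_of_pos two_pos, Complex.norm_real, Real.norm_eq_abs, abs_mul,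
      Real.abs_exp, Complex.norm_ofNat]
    have : (-(((1 / 4 : ℝ) : ℂ) + y * Complex.I)).re = -(1 / 4) := by simp
    rw [this]
    ring
  rw [Complex.ofReal_ofNat] at h
  rw [Complex.ofReal_ofNat] at hnorm
  rw [h, norm_smul, Real.norm_of_nonneg (by positivity)]
  have h2 : (2 : ℝ) ^ (1 / 4 : ℝ) * 2 ^ (-(1 / 4) : ℝ) = 1 := by
    rw [← Real.rpow_add two_pos]
    norm_num
  calc _ ≤ (2 : ℝ) ^ (1 / 4 : ℝ) * (1 / (2 * Real.pi) *
        (2 ^ (-(1 / 4) : ℝ) * 2 * ∫ y, Real.exp (γ * y) * |criticalXi (2 * y)|)) := by gcongr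
    _ = (2 : ℝ) ^ (1 / 4 : ℝ) * 2 ^ (-(1 / 4) : ℝ) *
        (1 / Real.pi * ∫ y, Real.exp (γ * y) * |criticalXi (2 * y)|) := by
        field_simp
    _ = _ := by rw [h2, one_mul]

/-- If Hardy's function had no large zeros, the theta remainder would not grow faster at `2 * w`
than at `w`, for `w` on the right half of the unit circle. -/
lemma exists_norm_thetaRemainder_mul_two_le {T : ℝ} (hT : ∀ t, T < t → criticalXi t ≠ 0) :
    ∃ C : ℝ, ∀ w : ℂ, ‖w‖ = 1 → 0 < w.re →
      ‖thetaRemainder (w * 2)‖ ≤ ‖thetaRemainder w‖ + C := by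
  obtain ⟨C, hC⟩ := exists_integral_exp_mul_abs_le (h := fun y ↦ criticalXi (2 * y))
    (continuous_criticalXi.comp (by fun_prop)) (fun y ↦ by rw [mul_neg, criticalXi_neg])
    (b := Real.pi / 2) (T := T / 2) (fun y hy ↦ hT _ (by linarith))
  refine ⟨1 / Real.pi * C, fun w hw hre ↦ ?_⟩
  have hγ : |w.arg| < Real.pi / 2 := Complex.abs_arg_lt_pi_div_two_iff.mpr (Or.inl hre)
  have hexp : Complex.exp (w.arg * Complex.I) = w := by
    have := Complex.norm_mul_exp_arg_mul_I w
    rwa [hw, Complex.ofReal_one, one_mul] at this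
  have h1 := norm_thetaRemainder_exp_eq hγ
  have h2 := norm_thetaRemainder_exp_mul_two_le hγ
  rw [hexp] at h1 h2
  have h3 : (1 : ℝ) ≤ 2 ^ (1 / 4 : ℝ) := Real.one_le_rpow one_le_two (by norm_num)
  calc ‖thetaRemainder (w * 2)‖ ≤ 2 ^ (1 / 4 : ℝ) * ‖thetaRemainder (w * 2)‖ :=
        le_mul_of_one_le_left (norm_nonneg _) h3
    _ ≤ 1 / Real.pi * ∫ y, Real.exp (w.arg * y) * |criticalXi (2 * y)| := h2
    _ ≤ 1 / Real.pi * (|∫ y, Real.exp (w.arg * y) * criticalXi (2 * y)| + C) := by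
        gcongr
        exact hC _ hγ.le (integrable_exp_mul_criticalXi hγ)
    _ = _ := by rw [h1]; ring

/-- The theta remainder grows faster at `2 * w` than at `w` as `w` approaches `-I` along the unit
circle. -/
lemma exists_norm_thetaRemainder_add_lt (C : ℝ) :
    ∃ w : ℂ, ‖w‖ = 1 ∧ 0 < w.re ∧ ‖thetaRemainder w‖ + C < ‖thetaRemainder (w * 2)‖ := by
  obtain ⟨C₁, h₁⟩ := exists_norm_jacobiTheta_near_one_le
  obtain ⟨R₀, h₂⟩ := exists_le_norm_jacobiTheta_near_two
  have htend : Filter.Tendsto (fun R : ℝ ↦ √(R / 2) / 2) Filter.atTop Filter.atTop :=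
    (Real.tendsto_sqrt_atTop.comp (Filter.tendsto_id.atTop_div_const two_pos)).atTop_div_const
      two_pos
  obtain ⟨R, hR, hR1, hR0⟩ := ((htend.eventually_gt_atTop (C₁ + C + 4)).and
    ((Filter.eventually_ge_atTop 1).and (Filter.eventually_ge_atTop R₀))).exists
  specialize h₁ R hR1
  specialize h₂ R hR0
  set ζ : ℂ := 1 + -1 / (1 / 2 + R * Complex.I) with hζ
  have hden : (1 / 2 + R * Complex.I : ℂ) ≠ 0 := fun h ↦ by
    simpa using congrArg Complex.re h
  have hζ' : ζ = (-1 / 2 + R * Complex.I) / (1 / 2 + R * Complex.I) := by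
    rw [hζ, eq_div_iff hden, add_mul, div_mul_cancel₀ _ hden]
    ring
  have hnorm : ‖ζ‖ = 1 := by
    have hconj : (-1 / 2 + R * Complex.I : ℂ) =
        -(starRingEnd ℂ (1 / 2 + R * Complex.I)) := by
      simp only [map_add, map_div₀, map_one, map_ofNat, map_mul, Complex.conj_I,
        Complex.conj_ofReal]
      ring
    rw [hζ', norm_div, hconj, norm_neg, RCLike.norm_conj, div_self (norm_ne_zero_iff.mpr hden)]
  have him : 0 < ζ.im := by
    have : 0 < Complex.normSq (1 / 2 + R * Complex.I) := Complex.normSq_pos.mpr hden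
    have hR' : 0 < R := by linarith
    have him : ζ.im = R / Complex.normSq (1 / 2 + R * Complex.I) := by
      simp [hζ, neg_div]
    rw [him]
    positivity
  have hI (z : ℂ) : Complex.I * (-Complex.I * z) = z := by
    rw [← mul_assoc, mul_neg, Complex.I_mul_I, neg_neg, one_mul]
  have hw1 : ‖-Complex.I * ζ‖ = 1 := by simp [hnorm]
  have hw0 : -Complex.I * ζ ≠ 0 := norm_ne_zero_iff.mp (by rw [hw1]; exact one_ne_zero)
  refine ⟨-Complex.I * ζ, hw1, by simpa using him, ?_⟩
  have hupper : ‖thetaRemainder (-Complex.I * ζ)‖ ≤ C₁ + 2 := by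
    rw [thetaRemainder, hI]
    have h3 : ‖(-Complex.I * ζ) ^ (-(1 / 2) : ℂ)‖ = 1 := by
      rw [norm_cpow_neg_half hw0, hw1, Real.one_rpow]
    calc _ ≤ ‖jacobiTheta ζ‖ + ‖(1 : ℂ)‖ + ‖(-Complex.I * ζ) ^ (-(1 / 2) : ℂ)‖ :=
          (norm_sub_le _ _).trans (by gcongr; exact norm_sub_le _ _)
      _ ≤ _ := by rw [h3, norm_one]; linarith
  have hlower : √(R / 2) / 2 - 2 ≤ ‖thetaRemainder (-Complex.I * ζ * 2)‖ := by
    have h3 : ‖(-Complex.I * ζ * 2) ^ (-(1 / 2) : ℂ)‖ ≤ 1 := by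
      rw [norm_cpow_neg_half (mul_ne_zero hw0 two_ne_zero), norm_mul, hw1, Complex.norm_ofNat,
        one_mul]
      exact Real.rpow_le_one_of_one_le_of_nonpos one_le_two (by norm_num)
    rw [thetaRemainder, mul_assoc, hI, mul_comm ζ 2]
    have h4 := norm_sub_norm_le (jacobiTheta (2 * ζ) - 1) ((-Complex.I * (2 * ζ)) ^ (-(1 / 2) : ℂ))
    have h5 := norm_sub_norm_le (jacobiTheta (2 * ζ)) 1
    rw [mul_assoc, mul_comm ζ 2] at h3
    rw [norm_one] at h5
    linarith
  linarith

lemma exists_gt_criticalXi_eq_zero (T : ℝ) : ∃ t, T < t ∧ criticalXi t = 0 := by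
  by_contra! h
  obtain ⟨C, hC⟩ := exists_norm_thetaRemainder_mul_two_le h
  obtain ⟨w, hw, hre, hlt⟩ := exists_norm_thetaRemainder_add_lt C
  exact hlt.not_ge (hC w hw hre)

theorem infinitely_many_zeros_on_critical_line :
    {s : ℂ | s.re = 1 / 2 ∧ riemannZeta s = 0}.Infinite ∧
      ∀ T₀ : ℝ, ∃ t : ℝ, t > T₀ ∧ HardyZ t = 0 := by
  refine ⟨fun hfin ↦ ?_, fun T₀ ↦ ?_⟩
  · obtain ⟨M, hM⟩ := (hfin.image Complex.im).bddAbove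
    obtain ⟨t, ht, hzero⟩ := exists_gt_criticalXi_eq_zero M
    refine ht.not_ge (hM ⟨1 / 2 + Complex.I * t, ⟨by simp, ?_⟩, by simp⟩)
    exact riemannZeta_eq_zero_of_criticalXi_eq_zero hzero
  · obtain ⟨t, ht, hzero⟩ := exists_gt_criticalXi_eq_zero T₀
    exact ⟨t, ht, (HardyZ_eq_zero_iff t).mpr hzero⟩
end
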